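/- Fix a small ε > 0 and assume the complex scalar field φ vanishes at null infinity; write ψ = rφ, J^μ[φ] = Im(φ·conj(D^μφ)), F = dA. Then for every 0 ≤ p ≤ 2 there is a constant C depending only on R, γ₀, ε, p such that: (interior) for all 0 ≤ τ₁ ≤ τ₂ and v₀ ≥ (τ₂+R)/2, ∫_{H_{τ₂*}} r^p|D_Lψ|² dv dω + ∫_{τ₁}^{τ₂}∫_{H_{τ*}} r^{p−1}(p|D_Lψ|² + (2−p)|D̸ψ|²) dv dω dτ + ∫_{H̲_{v₀}^{τ₁,τ₂}} r^p|D̸ψ|² du dω ≤ C( ∫_{H_{τ₁*}} r^p|D_Lψ|² dv dω + I^{max{1+ε,p}}_{min{1+ε,p}}[□_Aφ](𝒟_{τ₁}^{τ₂}) + E[φ](Σ_{τ₁}) + I^{1+ε}_0[□_Aφ](𝒟_{τ₁}^{τ₂}) + ∬_{𝒟_{τ₁}^{τ₂}}(|F_{L̲μ}J^μ[φ]| + |F_{Lμ}J^μ[φ]|) dx dt + ∬_{𝒟̄_{τ₁}^{τ₂}} r^p|F_{Lμ}J^μ[φ]| dx dt ); and (exterior) for all τ₂ ≤ τ₁ ≤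 0, ∫_{H_{τ₁*}^{−τ₂*}} r^p|D_Lψ|² dv dω + ∬_{𝒟_{τ₁}^{τ₂}} r^{p−1}(p|D_Lψ|² + (2−p)|D̸ψ|²) dv dω du + ∫_{H̲_{−τ₂*}^{τ₁*}} r^p|D̸ψ|² du dω ≤ C( ∫_{B_{R−τ₁}^{R−τ₂}} r^p(|D_Lψ|² + |D̸ψ|²) dr dω + I^{max{p,1+ε}}_{min{1+ε,p}}[□_Aφ](𝒟_{τ₁}^{τ₂}) + ∬_{𝒟_{τ₁}^{τ₂}} r^p|F_{Lμ}J^μ[φ]| dx dt ). -/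

import Mathlib

/-!  Common setup: Minkowski space ℝ^{3+1}, null frame, Maxwell–Klein–Gordon objects. -/

noncomputable section

open MeasureTheory ENNReal Set Metric

/-- spacetime points of ℝ^{3+1} -/
abbrev V : Type := Fin 4 → ℝ
/-- spatial points -/
abbrev E3 : Type := EuclideanSpace ℝ (Fin 3)

namespace MKG

def oR (x : ℝ) : ℝ≥0∞ := ENNReal.ofReal x

/-! ## Coordinates -/
def tC (p : V) : ℝ := p 0
def rad (p : V) : ℝ := Real.sqrt (∑ i : Fin 3, (p i.succ) ^ 2)
def uC (p : V) : ℝ := (tC p - rad p) / 2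
def vC (p : V) : ℝ := (tC p + rad p) / 2
def rplus (p : V) : ℝ := 1 + rad p
def uplus (p : V) : ℝ := 1 + |uC p|
def taupl (τ : ℝ) : ℝ := 1 + |τ|
/-- Minkowski metric diag(-1,1,1,1) (diagonal entries). -/
def eta : Fin 4 → ℝ := fun μ => if μ = 0 then -1 else 1

/-- spacetime point from time and space -/
def stp (t : ℝ) (x : E3) : V := ![t, x 0, x 1, x 2]
/-- spacetime point from time, radius and angle -/
def pt (t r : ℝ) (ω : E3) : V := ![t, r * ω 0, r * ω 1, r * ω 2]

/-! ## Derivatives, connection, curvature -/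
def pd (μ : Fin 4) (f : V → ℝ) (p : V) : ℝ := fderiv ℝ f p (Pi.single μ 1)
def pdC (μ : Fin 4) (f : V → ℂ) (p : V) : ℂ := fderiv ℝ f p (Pi.single μ 1)

/-- covariant derivative D_μ = ∂_μ + i A_μ -/
def covD (A : V → Fin 4 → ℝ) (μ : Fin 4) (φ : V → ℂ) (p : V) : ℂ :=
  pdC μ φ p + Complex.I * (A p μ) * φ p
/-- second covariant derivative D_μ D_ν φ -/
def covD2 (A : V → Fin 4 → ℝ) (μ ν : Fin 4) (φ : V → ℂ) (p : V) : ℂ :=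
  pdC μ (covD A ν φ) p + Complex.I * (A p μ) * covD A ν φ p
/-- covariant wave operator □_A = D^μ D_μ -/
def boxA (A : V → Fin 4 → ℝ) (φ : V → ℂ) (p : V) : ℂ :=
  ∑ μ, (eta μ : ℂ) * covD2 A μ μ φ p
/-- curvature 2-form F = dA -/
def curv (A : V → Fin 4 → ℝ) (p : V) (μ ν : Fin 4) : ℝ :=
  pd μ (fun q => A q ν) p - pd ν (fun q => A q μ) p

/-- (δG)_ν = ∂^μ G_{μν} (divergence over the first index) -/
def divFst (G : V → Fin 4 → Fin 4 → ℝ) (p : V) (ν : Fin 4) : ℝ :=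
  ∑ μ, eta μ * pd μ (fun q => G q μ ν) p
/-- J_μ = ∂^ν G_{μν} (divergence over the second index) -/
def divSnd (G : V → Fin 4 → Fin 4 → ℝ) (p : V) (μ : Fin 4) : ℝ :=
  ∑ ν, eta ν * pd ν (fun q => G q μ ν) p

/-! ## Null frame and null decompositions -/
/-- outgoing null vector L = ∂_t + ∂_r -/
def Lv (p : V) : V := ![1, p 1 / rad p, p 2 / rad p, p 3 / rad p]
/-- incoming null vector L̲ = ∂_t − ∂_r -/
def Lbv (p : V) : V := ![1, -(p 1 / rad p), -(p 2 / rad p), -(p 3 / rad p)]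
/-- radial vector ∂_r -/
def rv (p : V) : V := ![0, p 1 / rad p, p 2 / rad p, p 3 / rad p]
/-- tangential projection frame P_j = ∂_j − ω_j ∂_r (spanning the spheres'
tangent space; for any covector ξ one has Σ_j ξ(P_j)² = |ξ restricted to the sphere|²). -/
def Pv (p : V) (j : Fin 3) : V :=
  fun μ => if μ = 0 then 0 else
    (if μ = j.succ then 1 else 0) - p j.succ * p μ / rad p ^ 2

/-- evaluation of a 2-form on two vectors -/
def ap2 (G : V → Fin 4 → Fin 4 → ℝ) (X Y : V) (p : V) : ℝ := ∑ μ, ∑ ν, X μ * Y ν * G p μ ν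
/-- evaluation of a 1-form on a vector -/
def ap1 (J : V → Fin 4 → ℝ) (X : V) (p : V) : ℝ := ∑ μ, X μ * J p μ

/-- |α|² = Σ_i F(L,e_i)² -/
def alphaSq (G : V → Fin 4 → Fin 4 → ℝ) (p : V) : ℝ := ∑ j : Fin 3, (ap2 G (Lv p) (Pv p j) p) ^ 2
/-- |α̲|² = Σ_i F(L̲,e_i)² -/
def abarSq (G : V → Fin 4 → Fin 4 → ℝ) (p : V) : ℝ := ∑ j : Fin 3, (ap2 G (Lbv p) (Pv p j) p) ^ 2
/-- ρ = ½ F(L̲,L) -/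
def rhoC (G : V → Fin 4 → Fin 4 → ℝ) (p : V) : ℝ := (1 / 2) * ap2 G (Lbv p) (Lv p) p
/-- σ² = F(e₁,e₂)² -/
def sigmaSq (G : V → Fin 4 → Fin 4 → ℝ) (p : V) : ℝ :=
  (1 / 2) * ∑ j : Fin 3, ∑ k : Fin 3, (ap2 G (Pv p j) (Pv p k) p) ^ 2
/-- |F|², the sum of the squares of all (independent) components -/
def fSq (G : V → Fin 4 → Fin 4 → ℝ) (p : V) : ℝ := (1 / 2) * ∑ μ, ∑ ν, (G p μ ν) ^ 2
/-- squared angular part |J̸|² of a 1-form -/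
def JslashSq (J : V → Fin 4 → ℝ) (p : V) : ℝ := ∑ j : Fin 3, (ap1 J (Pv p j) p) ^ 2

/-! ## Scalar field: null derivatives and energy densities -/
/-- directional covariant derivative -/
def dirD (A : V → Fin 4 → ℝ) (X : V) (φ : V → ℂ) (p : V) : ℂ :=
  ∑ μ, (X μ : ℂ) * covD A μ φ p
/-- the weighted field ψ = rφ -/
def psi (φ : V → ℂ) (p : V) : ℂ := (rad p : ℂ) * φ p
def eDL (A : V → Fin 4 → ℝ) (φ : V → ℂ) (p : V) : ℝ := ‖dirD A (Lv p) φ p‖ ^ 2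
def eDLb (A : V → Fin 4 → ℝ) (φ : V → ℂ) (p : V) : ℝ := ‖dirD A (Lbv p) φ p‖ ^ 2
/-- |D̸φ|² -/
def eDslash (A : V → Fin 4 → ℝ) (φ : V → ℂ) (p : V) : ℝ :=
  ∑ j : Fin 3, ‖dirD A (Pv p j) φ p‖ ^ 2
/-- |Dφ|² -/
def eD (A : V → Fin 4 → ℝ) (φ : V → ℂ) (p : V) : ℝ := ∑ μ, ‖covD A μ φ p‖ ^ 2
/-- |D̄φ|² = |Dφ|² + r₊^{-2}|φ|² -/
def eDbar (A : V → Fin 4 → ℝ) (φ : V → ℂ) (p : V) : ℝ := eD A φ p + ‖φ p‖ ^ 2 / rplus p ^ 2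
/-- the covariant angular Laplacian D̸² -/
def covLapSph (A : V → Fin 4 → ℝ) (φ : V → ℂ) (p : V) : ℂ :=
  ∑ j : Fin 3, dirD A (Pv p j) (fun q => dirD A (Pv q j) φ q) p

/-- the current J_μ[φ] = Im(φ · conj(D_μ φ)) -/
def Jsf (A : V → Fin 4 → ℝ) (φ : V → ℂ) (p : V) (μ : Fin 4) : ℝ :=
  (φ p * (starRingEnd ℂ) (covD A μ φ p)).im
/-- X^μ F_{μν} J^ν[φ] -/
def FJcontr (G : V → Fin 4 → Fin 4 → ℝ) (A : V → Fin 4 → ℝ) (φ : V → ℂ)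
    (X : V → V) (p : V) : ℝ :=
  ∑ ν, (∑ μ, X p μ * G p μ ν) * (eta ν * Jsf A φ p ν)

/-! ## Integrals over spheres, null hypersurfaces and regions -/
/-- integral over the unit sphere (2-dimensional Hausdorff measure) -/
def sphLInt (f : E3 → ℝ≥0∞) : ℝ≥0∞ := ∫⁻ ω in sphere (0 : E3) 1, f ω ∂ μH[2]
/-- sphere integral of a density on the sphere of radius r at time t -/
def sphI (f : V → ℝ) (t r : ℝ) : ℝ≥0∞ := sphLInt (fun ω => oR (f (pt t r ω)))
/-- ∫_{H_u ∩ {v ≥ v₀}} f dv dω -/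
def lIntH (u v0 : ℝ) (f : V → ℝ) : ℝ≥0∞ := ∫⁻ v in Ici v0, sphI f (u + v) (v - u)
/-- ∫_{H_u ∩ {v₀ ≤ v ≤ v₁}} f dv dω -/
def lIntHseg (u v0 v1 : ℝ) (f : V → ℝ) : ℝ≥0∞ := ∫⁻ v in Icc v0 v1, sphI f (u + v) (v - u)
/-- ∫_{H̲_v ∩ {u₀ ≤ u ≤ u₁}} f du dω -/
def lIntHb (v u0 u1 : ℝ) (f : V → ℝ) : ℝ≥0∞ := ∫⁻ u in Icc u0 u1, sphI f (u + v) (v - u)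
/-- integral over the ball {|x| ≤ R'} at time t -/
def lIntBall (t R' : ℝ) (f : V → ℝ) : ℝ≥0∞ := ∫⁻ x in closedBall (0 : E3) R', oR (f (stp t x))
/-- integral over the annulus {r₀ ≤ |x| ≤ r₁} at time t -/
def lIntAnn (t r0 r1 : ℝ) (f : V → ℝ) : ℝ≥0∞ :=
  ∫⁻ x in {x : E3 | r0 ≤ ‖x‖ ∧ ‖x‖ ≤ r1}, oR (f (stp t x))
/-- integral over {|x| ≥ r₀} at time t -/
def lIntExt (t r0 : ℝ) (f : V → ℝ) : ℝ≥0∞ := ∫⁻ x in {x : E3 | r0 ≤ ‖x‖}, oR (f (stp t x))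
/-- integral over all of ℝ³ -/
def lIntE3 (f : E3 → ℝ) : ℝ≥0∞ := ∫⁻ x, oR (f x)

/-! ## The foliation Σ_τ and the regions -/
/-- the foliation parameter through a point: t in the cylinder {r ≤ R}, 2u+R outside -/
def sigP (R : ℝ) (p : V) : ℝ := if rad p ≤ R then tC p else 2 * uC p + R
def SigmaSet (R τ : ℝ) : Set V := {p | 0 ≤ tC p ∧ sigP R p = τ}
/-- interior region 𝒟_{τ₁}^{τ₂} between Σ_{τ₁} and Σ_{τ₂} -/
def Dint (R τ₁ τ₂ : ℝ) : Set V := {p | 0 ≤ tC p ∧ τ₁ ≤ sigP R p ∧ sigP R p ≤ τ₂}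
/-- 𝒟̄_{τ₁}^{τ₂} = 𝒟_{τ₁}^{τ₂} ∩ {r ≥ R} -/
def DbarInt (R τ₁ τ₂ : ℝ) : Set V := Dint R τ₁ τ₂ ∩ {p | R ≤ rad p}
/-- exterior region 𝒟_{τ₁}^{τ₂} (τ₂ ≤ τ₁ ≤ 0), the Cauchy development of
the annulus {R−τ₁ ≤ |x| ≤ R−τ₂} -/
def Dext (R τ₁ τ₂ : ℝ) : Set V :=
  {p | 0 ≤ tC p ∧ uC p ≤ (τ₁ - R) / 2 ∧ vC p ≤ -((τ₂ - R) / 2)}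
/-- 𝒟_τ : future of Σ_τ (τ ≥ 0), resp. 𝒟_τ^{-∞} (τ < 0) -/
def Dfrom (R τ : ℝ) : Set V :=
  if 0 ≤ τ then {p | 0 ≤ tC p ∧ τ ≤ sigP R p} else {p | 0 ≤ tC p ∧ uC p ≤ (τ - R) / 2}
def DbarFrom (R τ : ℝ) : Set V := Dfrom R τ ∩ {p | R ≤ rad p}
def halfSpace : Set V := {p | 0 ≤ tC p}
def regGe (R : ℝ) : Set V := {p | 0 ≤ tC p ∧ R ≤ rad p}
def regLe (R' : ℝ) : Set V := {p | 0 ≤ tC p ∧ rad p ≤ R'}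

/-- weighted spacetime norm  I^{pw}_{qw}[·](D) = ∫_D u₊^{qw} r₊^{pw} g  (g = squared magnitude) -/
def wI (pw qw : ℝ) (g : V → ℝ) (D : Set V) : ℝ≥0∞ :=
  ∫⁻ x in D, oR (uplus x ^ qw * rplus x ^ pw * g x)

/-- surface integral over Σ_τ with the measures dx (ball part) and r²dv dω (null part) -/
def lIntSigE (R τ : ℝ) (f : V → ℝ) : ℝ≥0∞ :=
  if 0 ≤ τ then lIntBall τ R f + lIntH ((τ - R) / 2) ((τ + R) / 2) (fun p => f p * rad p ^ 2)
  else lIntH ((τ - R) / 2) (-((τ - R) / 2)) (fun p => f p * rad p ^ 2)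
/-- integral over Σ_τ with the measure dv′dω (v′ = v on the null part, r in the cylinder) -/
def lIntSig (R τ : ℝ) (f : V → ℝ) : ℝ≥0∞ :=
  if 0 ≤ τ then (∫⁻ r' in Icc (0 : ℝ) R, sphI f τ r') + lIntH ((τ - R) / 2) ((τ + R) / 2) f
  else lIntH ((τ - R) / 2) (-((τ - R) / 2)) f

/-- the starting value v(u) of H_u (t = 0 in the exterior, r = R in the interior) -/
def vStart (R u : ℝ) : ℝ := if u ≤ -R / 2 then -u else 2 * R + u

/-- exterior region in (u,v,ω) coordinates: double null integral ∬_{𝒟_{τ₁}^{τ₂}} f dv dω du -/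
def lIntExtUV (R τ₁ τ₂ : ℝ) (f : V → ℝ) : ℝ≥0∞ :=
  ∫⁻ u in Icc ((τ₂ - R) / 2) ((τ₁ - R) / 2),
    ∫⁻ v in Icc (-u) (-((τ₂ - R) / 2)), sphI f (u + v) (v - u)

/-! ## Energy fluxes -/
def EphiH (A : V → Fin 4 → ℝ) (φ : V → ℂ) (u v0 : ℝ) : ℝ≥0∞ :=
  lIntH u v0 (fun p => (eDL A φ p + eDslash A φ p) * rad p ^ 2)
def EphiHseg (A : V → Fin 4 → ℝ) (φ : V → ℂ) (u v0 v1 : ℝ) : ℝ≥0∞ :=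
  lIntHseg u v0 v1 (fun p => (eDL A φ p + eDslash A φ p) * rad p ^ 2)
def EphiHb (A : V → Fin 4 → ℝ) (φ : V → ℂ) (v u0 u1 : ℝ) : ℝ≥0∞ :=
  lIntHb v u0 u1 (fun p => (eDLb A φ p + eDslash A φ p) * rad p ^ 2)
/-- energy flux E[φ](Σ_τ) -/
def EphiSig (R : ℝ) (A : V → Fin 4 → ℝ) (φ : V → ℂ) (τ : ℝ) : ℝ≥0∞ :=
  if 0 ≤ τ then lIntBall τ R (eD A φ) + EphiH A φ ((τ - R) / 2) ((τ + R) / 2)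
  else EphiH A φ ((τ - R) / 2) (-((τ - R) / 2))

def EfH (G : V → Fin 4 → Fin 4 → ℝ) (u v0 : ℝ) : ℝ≥0∞ :=
  lIntH u v0 (fun p => (rhoC G p ^ 2 + sigmaSq G p + alphaSq G p) * rad p ^ 2)
def EfHseg (G : V → Fin 4 → Fin 4 → ℝ) (u v0 v1 : ℝ) : ℝ≥0∞ :=
  lIntHseg u v0 v1 (fun p => (rhoC G p ^ 2 + sigmaSq G p + alphaSq G p) * rad p ^ 2)
def EfHb (G : V → Fin 4 → Fin 4 → ℝ) (v u0 u1 : ℝ) : ℝ≥0∞ :=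
  lIntHb v u0 u1 (fun p => (rhoC G p ^ 2 + sigmaSq G p + abarSq G p) * rad p ^ 2)
/-- energy flux E[G](Σ_τ) of a 2-form -/
def EfSig (R : ℝ) (G : V → Fin 4 → Fin 4 → ℝ) (τ : ℝ) : ℝ≥0∞ :=
  if 0 ≤ τ then
    lIntBall τ R (fun p => rhoC G p ^ 2 + sigmaSq G p + (1 / 2) * (alphaSq G p + abarSq G p))
      + EfH G ((τ - R) / 2) ((τ + R) / 2)
  else EfH G ((τ - R) / 2) (-((τ - R) / 2))

/-! ## The commutation vector fields Z = {∂_t, Ω_ij} and Lie derivatives -/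
inductive Gen : Type
  | time : Gen
  | rot : Fin 3 → Fin 3 → Gen
  deriving DecidableEq

instance : Fintype Gen := by
  classical
  exact Fintype.ofSurjective
    (fun x : Option (Fin 3 × Fin 3) => (x.casesOn Gen.time (fun ij => Gen.rot ij.1 ij.2) : Gen))
    (by rintro (_ | ⟨i, j⟩); exacts [⟨none, rfl⟩, ⟨some (i, j), rfl⟩])

/-- the vector field of a generator: ∂_t, resp. Ω_ij = x_i ∂_j − x_j ∂_i -/
def genV : Gen → V → V
  | Gen.time, _ => Pi.single 0 1
  | Gen.rot i j, p => fun μ => (if μ = j.succ then p i.succ else 0) - (if μ = i.succ then p j.succ else 0)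

/-- Lie derivative of a 2-form along X -/
def lie2 (X : V → V) (G : V → Fin 4 → Fin 4 → ℝ) (p : V) (μ ν : Fin 4) : ℝ :=
  fderiv ℝ (fun q => G q μ ν) p (X p)
    + ∑ lam, pd μ (fun q => X q lam) p * G p lam ν
    + ∑ lam, pd ν (fun q => X q lam) p * G p μ lam
/-- Lie derivative of a 1-form along X -/
def lie1 (X : V → V) (J : V → Fin 4 → ℝ) (p : V) (μ : Fin 4) : ℝ :=
  fderiv ℝ (fun q => J q μ) p (X p) + ∑ lam, pd μ (fun q => X q lam) p * J p lam

def lie2Iter : List Gen → (V → Fin 4 → Fin 4 → ℝ) → V → Fin 4 → Fin 4 → ℝ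
  | [], G => G
  | g :: w, G => lie2 (genV g) (lie2Iter w G)
def lie1Iter : List Gen → (V → Fin 4 → ℝ) → V → Fin 4 → ℝ
  | [], J => J
  | g :: w, J => lie1 (genV g) (lie1Iter w J)

/-- covariant derivative D_Z along a generator -/
def covDZ (A : V → Fin 4 → ℝ) (g : Gen) (φ : V → ℂ) (p : V) : ℂ := dirD A (genV g p) φ p
def covDZIter (A : V → Fin 4 → ℝ) : List Gen → (V → ℂ) → V → ℂ
  | [], φ => φ
  | g :: w, φ => covDZ A g (covDZIter A w φ)

/-! ## Charge and the chargeless part -/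
def esingle (j : Fin 3) : E3 := EuclideanSpace.single j 1
/-- total charge q₀ = (1/4π) ∫ div E dx computed at t = 0 -/
def charge (G : V → Fin 4 → Fin 4 → ℝ) : ℝ :=
  (1 / (4 * Real.pi)) *
    ∫ x : E3, ∑ i : Fin 3, fderiv ℝ (fun y => G (stp 0 y) 0 i.succ) x (esingle i)
/-- the 2-form dt ∧ dr -/
def dtdr (p : V) (μ ν : Fin 4) : ℝ :=
  (if μ = 0 then 1 else 0) * (if ν = 0 then 0 else p ν / rad p)
    - (if ν = 0 then 1 else 0) * (if μ = 0 then 0 else p μ / rad p)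
/-- the chargeless part F̄ = F − χ_{{r ≥ t+R}} q₀ r^{-2} dt∧dr -/
def Fbar (R q0 : ℝ) (G : V → Fin 4 → Fin 4 → ℝ) (p : V) (μ ν : Fin 4) : ℝ :=
  G p μ ν - (if tC p + R ≤ rad p then q0 / rad p ^ 2 else 0) * dtdr p μ ν

/-! ## The norms m_k, E₀^k, M_k of the Maxwell data and current -/
def twoSqAll (G : V → Fin 4 → Fin 4 → ℝ) (p : V) : ℝ := ∑ μ, ∑ ν, (G p μ ν) ^ 2
/-- |∇J|² (spatial gradient of a 1-form) -/
def grad3Sq1 (J : V → Fin 4 → ℝ) (p : V) : ℝ :=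
  ∑ i : Fin 3, ∑ μ, (pd i.succ (fun q => J q μ) p) ^ 2
def JdensL (J : V → Fin 4 → ℝ) (p : V) : ℝ := (ap1 J (Lv p) p) ^ 2
def JdensLb (J : V → Fin 4 → ℝ) (p : V) : ℝ := (ap1 J (Lbv p) p) ^ 2
def JdensMix (J : V → Fin 4 → ℝ) (p : V) : ℝ :=
  (Real.sqrt (JslashSq J p) + |ap1 J (Lv p) p|) ^ 2

/-- the quantity m_k measuring the current J -/
def mFn (R γ₀ ε : ℝ) (J : V → Fin 4 → ℝ) (q0 : ℝ) (k : ℕ) : ℝ≥0∞ :=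
  (∑ l ∈ Finset.range (k + 1), ∑ w : Fin l → Gen,
      (wI (1 + γ₀) (1 + ε) (JslashSq (lie1Iter (List.ofFn w) J)) (regGe R)
        + wI (2 + γ₀) 0 (JdensL (lie1Iter (List.ofFn w) J)) (regGe R)
        + wI (1 + ε) (1 + γ₀) (JdensMix (lie1Iter (List.ofFn w) J)) halfSpace
        + wI (1 - ε) (1 + γ₀ + 2 * ε) (JdensLb (lie1Iter (List.ofFn w) J)) halfSpace))
  + (∑ l ∈ Finset.range k, ∑ w : Fin l → Gen,
      wI 0 (1 + γ₀) (grad3Sq1 (lie1Iter (List.ofFn w) J)) (regLe (2 * R)))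
  + oR |q0| * ⨆ (τ : ℝ) (_ : τ ≤ 0), oR (taupl τ ^ (1 + γ₀)) *
      ∫⁻ p in Dfrom R τ, oR (|ap1 J (Lbv p) p| / rad p ^ 2)

/-- weighted initial energy E₀^k[G] of a 2-form -/
def E0F (γ₀ : ℝ) (G : V → Fin 4 → Fin 4 → ℝ) (k : ℕ) : ℝ≥0∞ :=
  ∑ l ∈ Finset.range (k + 1), ∑ w : Fin l → Gen,
    lIntE3 (fun x => (1 + ‖x‖) ^ (1 + γ₀) * twoSqAll (lie2Iter (List.ofFn w) G) (stp 0 x))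

/-- M_k = m_k + E₀^k[F̄] + 1 + |q₀| for the Maxwell field G with current δG -/
def MFn (R γ₀ ε : ℝ) (G : V → Fin 4 → Fin 4 → ℝ) (k : ℕ) : ℝ≥0∞ :=
  mFn R γ₀ ε (fun p μ => divSnd G p μ) (charge G) k
    + E0F γ₀ (Fbar R (charge G) G) k + 1 + oR |charge G|

/-! ## The norms E₀^k[φ], 𝓔_k[φ] of the scalar field -/
def E0phi (γ₀ : ℝ) (A : V → Fin 4 → ℝ) (φ : V → ℂ) (k : ℕ) : ℝ≥0∞ :=
  ∑ l ∈ Finset.range (k + 1), ∑ w : Fin l → Gen, ∑ j : Fin 3,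
    lIntE3 (fun x =>
      (1 + ‖x‖) ^ (1 + γ₀) * ‖covDZIter A (List.ofFn w) (covD A j.succ φ) (stp 0 x)‖ ^ 2)

def calE (γ₀ ε : ℝ) (A : V → Fin 4 → ℝ) (φ : V → ℂ) (k : ℕ) : ℝ≥0∞ :=
  E0phi γ₀ A φ k
    + ∑ l ∈ Finset.range (k + 1), ∑ w : Fin l → Gen,
        (wI (1 + γ₀) (1 + ε) (fun p => ‖covDZIter A (List.ofFn w) (boxA A φ) p‖ ^ 2) halfSpace
          + wI (1 + ε) (1 + γ₀) (fun p => ‖covDZIter A (List.ofFn w) (boxA A φ) p‖ ^ 2) halfSpace)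

/-! ## Mixed L_u²L_v^∞L_ω² and L_v²L_u^∞L_ω² norms on 𝒟̄_τ -/
def mixULV (R τ : ℝ) (f : V → ℝ) : ℝ≥0∞ :=
  if 0 ≤ τ then
    ∫⁻ u in Ici ((τ - R) / 2), ⨆ v ∈ Ici (u + R), sphI (fun p => f p ^ 2) (u + v) (v - u)
  else
    ∫⁻ u in Iic ((τ - R) / 2), ⨆ v ∈ Ici (-u), sphI (fun p => f p ^ 2) (u + v) (v - u)
def mixVLU (R τ : ℝ) (f : V → ℝ) : ℝ≥0∞ :=
  if 0 ≤ τ then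
    ∫⁻ v in Ici ((τ + R) / 2),
      ⨆ u ∈ Icc ((τ - R) / 2) (v - R), sphI (fun p => f p ^ 2) (u + v) (v - u)
  else
    ∫⁻ v in Ici (-((τ - R) / 2)),
      ⨆ u ∈ Icc (-v) ((τ - R) / 2), sphI (fun p => f p ^ 2) (u + v) (v - u)

/-! ## Asymptotic vanishing conditions -/
def vanishNullInf (φ : V → ℂ) : Prop :=
  ∀ u : ℝ, ∀ ω : E3, ‖ω‖ = 1 →
    Filter.Tendsto (fun v => φ (pt (u + v) (v - u) ω)) Filter.atTop (nhds 0)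
def vanishSpatialInf (φ : V → ℂ) : Prop :=
  ∀ ω : E3, ‖ω‖ = 1 → Filter.Tendsto (fun r => φ (pt 0 r ω)) Filter.atTop (nhds 0)

/-! ## Structural properties -/
def AntiSym (G : V → Fin 4 → Fin 4 → ℝ) : Prop := ∀ p μ ν, G p μ ν = -G p ν μ
def Bianchi (G : V → Fin 4 → Fin 4 → ℝ) : Prop :=
  ∀ (p : V) (γ' μ ν : Fin 4),
    pd γ' (fun q => G q μ ν) p + pd μ (fun q => G q ν γ') p + pd ν (fun q => G q γ' μ) p = 0
def Smooth2Form (G : V → Fin 4 → Fin 4 → ℝ) : Prop := ∀ μ ν, ContDiff ℝ (⊤ : ℕ∞) (fun p => G p μ ν)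

/-! ## Initial data (for the Cauchy problem) -/
def pd3 (j : Fin 3) (f : E3 → ℝ) (x : E3) : ℝ := fderiv ℝ f x (esingle j)
def pd3C (j : Fin 3) (f : E3 → ℂ) (x : E3) : ℂ := fderiv ℝ f x (esingle j)
/-- rotation Ω_ij acting on a scalar -/
def rotSc (i j : Fin 3) (f : E3 → ℝ) (x : E3) : ℝ := x i * pd3 j f x - x j * pd3 i f x
def rotScC (i j : Fin 3) (f : E3 → ℂ) (x : E3) : ℂ :=
  (x i : ℂ) * pd3C j f x - (x j : ℂ) * pd3C i f x
/-- rotation Ω_ij acting on a vector field (Lie derivative) -/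
def rotVF (i j : Fin 3) (W : E3 → Fin 3 → ℝ) (x : E3) (k : Fin 3) : ℝ :=
  rotSc i j (fun y => W y k) x - ((if k = j then W x i else 0) - (if k = i then W x j else 0))

abbrev Gen3 : Type := Fin 3 × Fin 3

def rotScIter : List Gen3 → (E3 → ℝ) → E3 → ℝ
  | [], f => f
  | g :: w, f => rotSc g.1 g.2 (rotScIter w f)
def rotScCIter : List Gen3 → (E3 → ℂ) → E3 → ℂ
  | [], f => f
  | g :: w, f => rotScC g.1 g.2 (rotScCIter w f)
def rotVFIter : List Gen3 → (E3 → Fin 3 → ℝ) → E3 → Fin 3 → ℝ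
  | [], W => W
  | g :: w, W => rotVF g.1 g.2 (rotVFIter w W)
def pd3Iter : List (Fin 3) → (E3 → ℝ) → E3 → ℝ
  | [], f => f
  | j :: w, f => pd3 j (pd3Iter w f)
def pd3CIter : List (Fin 3) → (E3 → ℂ) → E3 → ℂ
  | [], f => f
  | j :: w, f => pd3C j (pd3CIter w f)
def pd3VFIter (w : List (Fin 3)) (W : E3 → Fin 3 → ℝ) (x : E3) (k : Fin 3) : ℝ :=
  pd3Iter w (fun y => W y k) x

/-- the weighted Sobolev norm 𝓜 of the Maxwell initial data (E^{df}, H) -/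
def calM (γ₀ : ℝ) (Edf Hd : E3 → Fin 3 → ℝ) : ℝ≥0∞ :=
  ∑ l ∈ Finset.range 3,
    ((∑ w : Fin l → Gen3, lIntE3 (fun x => (1 + ‖x‖) ^ (1 + γ₀) *
        ((∑ k : Fin 3, (rotVFIter (List.ofFn w) Edf x k) ^ 2)
          + ∑ k : Fin 3, (rotVFIter (List.ofFn w) Hd x k) ^ 2)))
      + ∑ w : Fin l → Fin 3, lIntE3 (fun x => (1 + ‖x‖) ^ (1 + γ₀) *
        ((∑ k : Fin 3, (pd3VFIter (List.ofFn w) Edf x k) ^ 2)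
          + ∑ k : Fin 3, (pd3VFIter (List.ofFn w) Hd x k) ^ 2)))

/-- the weighted Sobolev norm 𝓔 of the scalar initial data (φ₀, φ₁) -/
def calEdata (γ₀ : ℝ) (φ₀ φ₁ : E3 → ℂ) : ℝ≥0∞ :=
  ∑ l ∈ Finset.range 3,
    ((∑ w : Fin l → Gen3, lIntE3 (fun x => (1 + ‖x‖) ^ (1 + γ₀) *
        ((∑ j : Fin 3, ‖pd3C j (rotScCIter (List.ofFn w) φ₀) x‖ ^ 2)
          + ‖rotScCIter (List.ofFn w) φ₁ x‖ ^ 2)))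
      + (∑ w : Fin (l + 1) → Fin 3,
          lIntE3 (fun x => (1 + ‖x‖) ^ (1 + γ₀) * ‖pd3CIter (List.ofFn w) φ₀ x‖ ^ 2))
      + (∑ w : Fin l → Fin 3,
          lIntE3 (fun x => (1 + ‖x‖) ^ (1 + γ₀) * ‖pd3CIter (List.ofFn w) φ₁ x‖ ^ 2))
      + lIntE3 (fun x => (1 + ‖x‖) ^ (1 + γ₀) * ‖φ₀ x‖ ^ 2))

/-- the Maxwell–Klein–Gordon equations (for t ≥ 0) -/
def IsMKG (A : V → Fin 4 → ℝ) (φ : V → ℂ) : Prop :=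
  ∀ p : V, 0 ≤ tC p →
    (∀ μ, divSnd (curv A) p μ = Jsf A φ p μ) ∧ boxA A φ p = 0

/-- the solution attains the initial data (E, H, φ₀, φ₁) -/
def InitData (A : V → Fin 4 → ℝ) (φ : V → ℂ) (Ed Hd : E3 → Fin 3 → ℝ)
    (φ₀ φ₁ : E3 → ℂ) : Prop :=
  (∀ (x : E3) (i : Fin 3), curv A (stp 0 x) 0 i.succ = Ed x i)
    ∧ (∀ x : E3, curv A (stp 0 x) 2 3 = Hd x 0 ∧ curv A (stp 0 x) 3 1 = Hd x 1
        ∧ curv A (stp 0 x) 1 2 = Hd x 2)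
    ∧ (∀ x : E3, φ (stp 0 x) = φ₀ x) ∧ (∀ x : E3, covD A 0 φ (stp 0 x) = φ₁ x)

/-- the compatibility (constraint) conditions -/
def Admissible (Ed Hd : E3 → Fin 3 → ℝ) (φ₀ φ₁ : E3 → ℂ) : Prop :=
  (∀ x : E3, (∑ i : Fin 3, pd3 i (fun y => Ed y i) x) = (φ₀ x * (starRingEnd ℂ) (φ₁ x)).im)
    ∧ (∀ x : E3, (∑ i : Fin 3, pd3 i (fun y => Hd y i) x) = 0)

end MKG

namespace MKG

open scoped Pointwise NNReal

/-- The point of `E3` with `k`-th coordinate `1` and the remaining coordinates `y`. -/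
def faceLift (k : Fin 3) (y : Fin 2 → ℝ) : E3 := WithLp.toLp 2 (k.insertNth (1 : ℝ) y)

lemma faceLift_self (k : Fin 3) (y : Fin 2 → ℝ) : faceLift k y k = 1 := by
  simp [faceLift]

lemma faceLift_succAbove (k : Fin 3) (y : Fin 2 → ℝ) (j : Fin 2) :
    faceLift k y (k.succAbove j) = y j := by
  simp [faceLift]

lemma sq_norm_eq_succAbove (k : Fin 3) (x : E3) :
    ‖x‖ ^ 2 = x k ^ 2 + (x (k.succAbove 0) ^ 2 + x (k.succAbove 1) ^ 2) := by
  rw [EuclideanSpace.norm_sq_eq, Fin.sum_univ_succAbove _ k]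
  simp [Fin.sum_univ_two]

lemma one_le_norm_faceLift (k : Fin 3) (y : Fin 2 → ℝ) : 1 ≤ ‖faceLift k y‖ := by
  have h := sq_norm_eq_succAbove k (faceLift k y)
  rw [faceLift_self, faceLift_succAbove, faceLift_succAbove] at h
  nlinarith [norm_nonneg (faceLift k y), sq_nonneg (y 0), sq_nonneg (y 1)]

lemma norm_faceLift_sub_le (k : Fin 3) (y z : Fin 2 → ℝ) :
    ‖faceLift k y - faceLift k z‖ ≤ 2 * ‖y - z‖ := by
  have h := sq_norm_eq_succAbove k (faceLift k y - faceLift k z)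
  simp only [PiLp.sub_apply, faceLift_self, faceLift_succAbove] at h
  have h0 : |y 0 - z 0| ≤ ‖y - z‖ := norm_le_pi_norm (y - z) 0
  have h1 : |y 1 - z 1| ≤ ‖y - z‖ := norm_le_pi_norm (y - z) 1
  have h0' := sq_le_sq' (neg_le_of_abs_le h0) (le_of_abs_le h0)
  have h1' := sq_le_sq' (neg_le_of_abs_le h1) (le_of_abs_le h1)
  refine abs_le_of_sq_le_sq' ?_ (by positivity) |>.2
  nlinarith [norm_nonneg (y - z)]

lemma norm_normalize_sub_le {x y : E3} (hx : 1 ≤ ‖x‖) (hy : 1 ≤ ‖y‖) :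
    ‖‖x‖⁻¹ • x - ‖y‖⁻¹ • y‖ ≤ 2 * ‖x - y‖ := by
  have hx0 : 0 < ‖x‖ := by linarith
  have hy0 : 0 < ‖y‖ := by linarith
  have e : ‖x‖⁻¹ • x - ‖y‖⁻¹ • y = ‖x‖⁻¹ • (x - y) + (‖x‖⁻¹ - ‖y‖⁻¹) • y := by
    module
  have h1 : ‖‖x‖⁻¹ • (x - y)‖ ≤ ‖x - y‖ := by
    rw [norm_smul, norm_inv, norm_norm]
    exact mul_le_of_le_one_left (norm_nonneg _) (inv_le_one_of_one_le₀ hx)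
  have h2 : ‖(‖x‖⁻¹ - ‖y‖⁻¹) • y‖ ≤ ‖x - y‖ := by
    have e2 : (‖x‖⁻¹ - ‖y‖⁻¹) = (‖y‖ - ‖x‖) * (‖x‖⁻¹ * ‖y‖⁻¹) := by
      field_simp
    rw [norm_smul, e2, norm_mul, norm_mul, norm_inv, norm_inv, norm_norm, norm_norm, mul_assoc,
      mul_assoc, inv_mul_cancel₀ hy0.ne', mul_one]
    have h3 : ‖‖y‖ - ‖x‖‖ ≤ ‖x - y‖ := by
      rw [norm_sub_rev x y]; exact abs_norm_sub_norm_le y x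
    calc _ ≤ ‖‖y‖ - ‖x‖‖ * 1 := by
          gcongr; exact inv_le_one_of_one_le₀ hx
      _ ≤ _ := by linarith
  rw [e]
  exact (norm_add_le _ _).trans (by linarith)

/-- Radial projection of a face of a cube to the unit sphere. -/
def faceMap (k : Fin 3) (σ : ℝ) (y : Fin 2 → ℝ) : E3 := σ • (‖faceLift k y‖⁻¹ • faceLift k y)

lemma lipschitz_faceMap (k : Fin 3) {σ : ℝ} (hσ : |σ| = 1) : LipschitzWith 4 (faceMap k σ) := by
  refine LipschitzWith.of_dist_le_mul fun y z => ?_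
  rw [dist_eq_norm, dist_eq_norm, faceMap, faceMap, ← smul_sub, norm_smul, Real.norm_eq_abs, hσ,
    one_mul]
  have := norm_normalize_sub_le (one_le_norm_faceLift k y) (one_le_norm_faceLift k z)
  have h2 := norm_faceLift_sub_le k y z
  push_cast
  linarith

lemma hausdorff_face_le_cone (k : Fin 3) {σ : ℝ} (hσ : |σ| = 1) {A : Set E3}
    (hA : MeasurableSet A) (hS : A ⊆ sphere 0 1) :
    μH[2] (A ∩ {ω | 1 / 2 ≤ σ * ω k}) ≤ 3456 * volume (Ioo (0 : ℝ) 1 • A) := by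
  have hσ2 : σ * σ = 1 := by rw [← abs_mul_abs_self, hσ, one_mul]
  set B : Set (Fin 2 → ℝ) := faceMap k σ ⁻¹' A ∩ closedBall 0 2 with hB
  have hBm : MeasurableSet B :=
    ((lipschitz_faceMap k hσ).continuous.measurable hA).inter measurableSet_closedBall
  have hsub : A ∩ {ω | 1 / 2 ≤ σ * ω k} ⊆ faceMap k σ '' B := by
    rintro ω ⟨hω, hk⟩
    simp only [mem_ofPred_eq] at hk
    have hk0 : ω k ≠ 0 := by rintro h; rw [h] at hk; norm_num at hk
    have hn : ‖ω‖ = 1 := by simpa using hS hω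
    have hle : faceLift k (fun j => ω (k.succAbove j) / ω k) = (ω k)⁻¹ • ω := by
      ext i
      refine Fin.succAboveCases k ?_ (fun j => ?_) i
      · simp [faceLift_self, hk0]
      · simp [faceLift_succAbove, div_eq_inv_mul]
    have hΦ : faceMap k σ (fun j => ω (k.succAbove j) / ω k) = ω := by
      have habs : |ω k| = σ * ω k := by
        rw [← abs_of_pos (by linarith : 0 < σ * ω k), abs_mul, hσ, one_mul]
      rw [faceMap, hle, norm_smul, hn, mul_one, norm_inv, inv_inv, Real.norm_eq_abs, habs,
        smul_smul, smul_smul]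
      rw [show σ * (σ * ω k) * (ω k)⁻¹ = 1 by field_simp; linarith, one_smul]
    refine ⟨_, ⟨?_, ?_⟩, hΦ⟩
    · rw [mem_preimage, hΦ]; exact hω
    · rw [mem_closedBall_zero_iff, pi_norm_le_iff_of_nonneg (by norm_num)]
      intro j
      have habs : 1 / 2 ≤ |ω k| := by
        calc 1 / 2 ≤ σ * ω k := hk
          _ ≤ |σ * ω k| := le_abs_self _
          _ = |ω k| := by rw [abs_mul, hσ, one_mul]
      have hj : |ω (k.succAbove j)| ≤ 1 := hn ▸ PiLp.norm_apply_le ω _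
      rw [norm_div, Real.norm_eq_abs, Real.norm_eq_abs, div_le_iff₀ (by linarith)]
      linarith
  have hH : μH[2] (A ∩ {ω | 1 / 2 ≤ σ * ω k}) ≤ 16 * volume B := by
    have h := (lipschitz_faceMap k hσ).hausdorffMeasure_image_le (d := 2) (by norm_num) B
    have h2 : (μH[2] : Measure (Fin 2 → ℝ)) = volume := by
      have := hausdorffMeasure_pi_real (ι := Fin 2)
      simpa using this
    rw [h2] at h
    refine (measure_mono hsub).trans (h.trans (le_of_eq ?_))
    congr 1
    norm_num
  have hV : volume B ≤ 216 * volume (Ioo (0 : ℝ) 1 • A) := by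
    set I : Set ℝ := (fun z => σ * z) ⁻¹' Ioo (1 / 6) (1 / 3) with hIdef
    have hIm : MeasurableSet I := measurableSet_Ioo.preimage (by fun_prop)
    set S : Set (ℝ × (Fin 2 → ℝ)) :=
      Prod.fst ⁻¹' I ∩ (fun q : ℝ × (Fin 2 → ℝ) => q.1⁻¹ • q.2) ⁻¹' B with hSdef
    have hSm : MeasurableSet S :=
      (measurable_fst hIm).inter ((measurable_fst.inv.smul measurable_snd) hBm)
    let e : E3 ≃ᵐ ℝ × (Fin 2 → ℝ) :=
      (MeasurableEquiv.toLp 2 (Fin 3 → ℝ)).symm.trans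
        (MeasurableEquiv.piFinSuccAbove (fun _ : Fin 3 => ℝ) k)
    have he : MeasurePreserving e volume volume :=
      (EuclideanSpace.volume_preserving_symm_measurableEquiv_toLp (Fin 3)).trans
        (volume_preserving_piFinSuccAbove (fun _ : Fin 3 => ℝ) k)
    have hcone : e ⁻¹' S ⊆ Ioo (0 : ℝ) 1 • A := by
      intro x hx
      have hx1 : 1 / 6 < σ * x k ∧ σ * x k < 1 / 3 := hx.1
      have hx2 : (x k)⁻¹ • (fun j => x (k.succAbove j)) ∈ B := hx.2
      set y : Fin 2 → ℝ := (x k)⁻¹ • (fun j => x (k.succAbove j)) with hy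
      have hk0 : x k ≠ 0 := by
        rintro h
        have := hx1.1
        rw [h] at this; norm_num at this
      have hxy : x = x k • faceLift k y := by
        ext i
        refine Fin.succAboveCases k ?_ (fun j => ?_) i
        · simp [faceLift_self]
        · simp [faceLift_succAbove, hy, hk0]
      have hn1 := one_le_norm_faceLift k y
      have hn3 : ‖faceLift k y‖ ≤ 3 := by
        have h := sq_norm_eq_succAbove k (faceLift k y)
        rw [faceLift_self, faceLift_succAbove, faceLift_succAbove] at h
        have hb : ‖y‖ ≤ 2 := by simpa using hx2.2
        have h0 : |y 0| ≤ 2 := (norm_le_pi_norm y 0).trans hb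
        have h1 : |y 1| ≤ 2 := (norm_le_pi_norm y 1).trans hb
        have h0' := sq_le_sq' (neg_le_of_abs_le h0) (le_of_abs_le h0)
        have h1' := sq_le_sq' (neg_le_of_abs_le h1) (le_of_abs_le h1)
        nlinarith [norm_nonneg (faceLift k y)]
      refine ⟨σ * x k * ‖faceLift k y‖, ⟨?_, ?_⟩, faceMap k σ y, hx2.1, ?_⟩
      · have := hx1.1; positivity
      · nlinarith [hx1.1, hx1.2]
      · change (σ * x k * ‖faceLift k y‖) • faceMap k σ y = x
        rw [faceMap, smul_smul, smul_smul]
        conv_rhs => rw [hxy]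
        congr 1
        field_simp
        linarith
    have hvol : volume B * (36 : ℝ≥0∞)⁻¹ * 6⁻¹ ≤ volume S := by
      rw [Measure.volume_eq_prod, Measure.prod_apply hSm]
      have hI : volume I = (6 : ℝ≥0∞)⁻¹ := by
        rw [Real.volume_preimage_mul_left (by rintro rfl; simp at hσ), Real.volume_Ioo,
          abs_inv, hσ]
        norm_num
        rw [one_div, ENNReal.ofReal_inv_of_pos (by norm_num)]
        norm_num
      rw [← hI, ← setLIntegral_const]
      refine (setLIntegral_mono' hIm ?_).trans (setLIntegral_le_lintegral I _)
      · intro z hz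
        have hset : Prod.mk z ⁻¹' S = (fun y : Fin 2 → ℝ => z⁻¹ • y) ⁻¹' B := by
          ext y
          exact ⟨fun h => h.2, fun h => ⟨hz, h⟩⟩
        have hz0 : z ≠ 0 := by
          rintro rfl
          have := hz.1
          norm_num at this
        rw [hset, Measure.addHaar_preimage_smul volume (inv_ne_zero hz0), mul_comm]
        gcongr
        have h36 : (36 : ℝ≥0∞)⁻¹ = ENNReal.ofReal (1 / 36) := by
          rw [one_div, ENNReal.ofReal_inv_of_pos (by norm_num)]
          norm_num
        rw [h36]
        apply ENNReal.ofReal_le_ofReal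
        simp only [Module.finrank_fin_fun, inv_pow, inv_inv]
        have : σ * z * (σ * z) = z ^ 2 := by linear_combination hσ2 * z ^ 2
        rw [abs_of_nonneg (sq_nonneg z)]
        nlinarith [hz.1, hz.2]
    have hle : volume B * (36 : ℝ≥0∞)⁻¹ * 6⁻¹ ≤ volume (Ioo (0 : ℝ) 1 • A) := by
      refine hvol.trans ?_
      rw [← he.measure_preimage hSm.nullMeasurableSet]
      exact measure_mono hcone
    calc volume B = 216 * (volume B * (36 : ℝ≥0∞)⁻¹ * 6⁻¹) := by
          rw [mul_assoc, mul_left_comm]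
          have : (216 : ℝ≥0∞) * (36⁻¹ * 6⁻¹) = 1 := by
            rw [← ENNReal.mul_inv (by norm_num) (by norm_num)]
            norm_num
            exact ENNReal.mul_inv_cancel (by norm_num) (by norm_num)
          rw [this, mul_one]
      _ ≤ _ := by gcongr
  calc _ ≤ _ := hH
    _ ≤ 16 * (216 * volume (Ioo (0 : ℝ) 1 • A)) := by gcongr
    _ = _ := by rw [← mul_assoc]; norm_num

lemma hausdorff_le_cone {A : Set E3} (hA : MeasurableSet A) (hS : A ⊆ sphere 0 1) :
    μH[2] A ≤ 20736 * volume (Ioo (0 : ℝ) 1 • A) := by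
  have hcov : A ⊆ ⋃ k : Fin 3, ((A ∩ {ω | 1 / 2 ≤ (1 : ℝ) * ω k}) ∪
      (A ∩ {ω | 1 / 2 ≤ (-1 : ℝ) * ω k})) := by
    intro ω hω
    have hn : ‖ω‖ = 1 := by simpa using hS hω
    have h := EuclideanSpace.norm_sq_eq ω
    rw [hn, Fin.sum_univ_three] at h
    simp only [Real.norm_eq_abs, sq_abs] at h
    by_contra hcon
    simp only [mem_iUnion, mem_union, mem_inter_iff, hω, true_and, mem_ofPred_eq, not_exists,
      not_or, not_le] at hcon
    have h0 := hcon 0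
    have h1 := hcon 1
    have h2 := hcon 2
    nlinarith
  calc μH[2] A ≤ _ := measure_mono hcov
    _ ≤ ∑ k : Fin 3, μH[2] ((A ∩ {ω | 1 / 2 ≤ (1 : ℝ) * ω k}) ∪
      (A ∩ {ω | 1 / 2 ≤ (-1 : ℝ) * ω k})) := measure_iUnion_fintype_le _ _
    _ ≤ ∑ k : Fin 3, (3456 * volume (Ioo (0 : ℝ) 1 • A) + 3456 * volume (Ioo (0 : ℝ) 1 • A)) := by
        gcongr with k
        refine (measure_union_le _ _).trans ?_
        gcongr
        · exact hausdorff_face_le_cone k (by simp) hA hS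
        · exact hausdorff_face_le_cone k (by simp) hA hS
    _ = _ := by
        rw [Finset.sum_const, ← add_mul, ← smul_mul_assoc]
        norm_num

/-- Surface measure on the unit sphere, as a measure on `E3`. -/
def sphM : Measure E3 := (μH[2] : Measure E3).restrict (sphere 0 1)

lemma sphLInt_eq (f : E3 → ℝ≥0∞) : sphLInt f = ∫⁻ ω, f ω ∂sphM := rfl

lemma sphM_le : sphM ≤ (20736 : ℝ≥0∞) •
    (Measure.map ((↑) : sphere (0 : E3) 1 → E3) (volume : Measure E3).toSphere) := by
  refine Measure.le_iff.2 fun A hA => ?_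
  rw [sphM, Measure.restrict_apply hA, Measure.smul_apply, smul_eq_mul,
    Measure.map_apply measurable_subtype_coe hA,
    Measure.toSphere_apply' _ (measurable_subtype_coe hA), Subtype.image_preimage_coe,
    inter_comm (sphere _ _)]
  have h := hausdorff_le_cone (hA.inter ((isClosed_sphere (x := (0 : E3)) (ε := 1)).measurableSet))
    inter_subset_right
  refine h.trans ?_
  gcongr
  have : Module.finrank ℝ E3 = 3 := by simp
  rw [this]
  refine le_mul_of_one_le_left (zero_le) ?_
  norm_num

instance : IsFiniteMeasure sphM := by
  refine ⟨(Measure.le_iff.1 sphM_le univ .univ).trans_lt ?_⟩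
  rw [Measure.smul_apply, smul_eq_mul]
  exact ENNReal.mul_lt_top (by norm_num) (measure_lt_top _ _)

lemma ae_sphM_norm : ∀ᵐ ω ∂sphM, ‖ω‖ = 1 := by
  filter_upwards [ae_restrict_mem ((isClosed_sphere (x := (0 : E3)) (ε := 1)).measurableSet)] with ω hω
  simpa using hω

lemma polar_le {F : E3 → ℝ≥0∞} (hF : Measurable F) :
    ∫⁻ r in Ioi (0 : ℝ), ENNReal.ofReal (r ^ 2) * ∫⁻ ω, F (r • ω) ∂sphM ≤
      20736 * ∫⁻ x, F x := by
  have hm : Measurable fun q : E3 × ℝ => F (q.2 • q.1) :=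
    hF.comp (measurable_snd.smul measurable_fst)
  have h1 : ∀ r : ℝ, ∫⁻ ω, F (r • ω) ∂sphM ≤
      20736 * ∫⁻ ω : sphere (0 : E3) 1, F (r • (ω : E3)) ∂(volume : Measure E3).toSphere := by
    intro r
    have hr : Measurable fun ω : E3 => F (r • ω) := hF.comp (measurable_const_smul r)
    calc _ ≤ _ := lintegral_mono' sphM_le le_rfl
      _ = _ := by
        rw [lintegral_smul_measure, lintegral_map hr measurable_subtype_coe, smul_eq_mul]
  have h2 : ∫⁻ x, F x = ∫⁻ r in Ioi (0 : ℝ), ENNReal.ofReal (r ^ 2) *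
      ∫⁻ ω : sphere (0 : E3) 1, F (r • (ω : E3)) ∂(volume : Measure E3).toSphere := by
    have e := (volume : Measure E3).measurePreserving_homeomorphUnitSphereProd
    have h3 : ∫⁻ x, F x = ∫⁻ x : ({0}ᶜ : Set E3), F x ∂(volume.comap ((↑) : ({0}ᶜ : Set E3) → E3)) := by
      rw [lintegral_subtype_comap (measurableSet_singleton _).compl,
        restrict_compl_singleton]
    have hF' : Measurable fun q : sphere (0 : E3) 1 × Ioi (0 : ℝ) =>
        F ((q.2 : ℝ) • (q.1 : E3)) :=
      hm.comp ((measurable_subtype_coe.comp measurable_fst).prodMk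
        (measurable_subtype_coe.comp measurable_snd))
    have h4 : ∀ x : ({0}ᶜ : Set E3), F x =
        (fun q : sphere (0 : E3) 1 × Ioi (0 : ℝ) => F ((q.2 : ℝ) • (q.1 : E3)))
          (homeomorphUnitSphereProd E3 x) := by
      intro x
      have hx : ‖(x : E3)‖ ≠ 0 := norm_ne_zero_iff.2 x.2
      simp [smul_smul, hx]
    rw [h3, lintegral_congr h4, e.lintegral_comp hF', lintegral_prod_symm' _ hF',
      Measure.volumeIoiPow, lintegral_withDensity_eq_lintegral_mul]
    · have : Module.finrank ℝ E3 = 3 := by simp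
      simp only [this]
      exact lintegral_subtype_comap measurableSet_Ioi (fun r : ℝ => ENNReal.ofReal (r ^ 2) *
      ∫⁻ ω : sphere (0 : E3) 1, F (r • (ω : E3)) ∂(volume : Measure E3).toSphere)
    · fun_prop
    · exact Measurable.lintegral_prod_left' hF'
  rw [h2, ← lintegral_const_mul' _ _ (by norm_num)]
  refine lintegral_mono fun r => ?_
  rw [mul_left_comm]
  exact mul_le_mul_right (h1 r) _

lemma pt_eq_stp (t r : ℝ) (ω : E3) : pt t r ω = stp t (r • ω) := by
  simp [pt, stp]

lemma continuous_stp : Continuous fun q : ℝ × E3 => stp q.1 q.2 := by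
  unfold stp
  fun_prop

lemma continuous_pt : Continuous fun q : ℝ × ℝ × E3 => pt q.1 q.2.1 q.2.2 := by
  unfold pt
  fun_prop

lemma lintegral_stp {F : V → ℝ≥0∞} (hF : Measurable F) :
    ∫⁻ t : ℝ, ∫⁻ x : E3, F (stp t x) = ∫⁻ p, F p := by
  have he := (volume_preserving_piFinSuccAbove (fun _ : Fin 4 => ℝ) 0).symm
  have ho := EuclideanSpace.volume_preserving_symm_measurableEquiv_toLp (Fin 3)
  rw [← he.lintegral_comp hF, Measure.volume_eq_prod, lintegral_prod]
  · refine lintegral_congr fun t => ?_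
    rw [← ho.lintegral_comp]
    · refine lintegral_congr fun x => ?_
      congr 1
      ext i
      refine Fin.cases ?_ (fun j => ?_) i
      · simp [stp, MeasurableEquiv.piFinSuccAbove]
      · simp [stp, MeasurableEquiv.piFinSuccAbove]
        fin_cases j <;> rfl
    · exact hF.comp ((MeasurableEquiv.measurable _).comp (measurable_const.prodMk measurable_id))
  · exact (hF.comp (MeasurableEquiv.measurable _)).aemeasurable

lemma polar_V_le {F : V → ℝ≥0∞} (hF : Measurable F) :
    ∫⁻ t : ℝ, ∫⁻ r in Ioi (0 : ℝ), ENNReal.ofReal (r ^ 2) * ∫⁻ ω, F (pt t r ω) ∂sphM ≤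
      20736 * ∫⁻ p, F p := by
  rw [← lintegral_stp hF, ← lintegral_const_mul' _ _ (by norm_num)]
  refine lintegral_mono fun t => ?_
  simp only [pt_eq_stp]
  exact polar_le (hF.comp (continuous_stp.comp (Continuous.prodMk_right t)).measurable)

lemma sphM_restrict_sphere : sphM.restrict (sphere 0 1) = sphM := by
  rw [sphM, Measure.restrict_restrict isClosed_sphere.measurableSet, inter_self]

lemma integrable_sphM {f : E3 → ℝ} (hf : Continuous f) : Integrable f sphM := by
  have := hf.continuousOn.integrableOn_compact (μ := sphM) (isCompact_sphere (0 : E3) 1)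
  rwa [IntegrableOn, sphM_restrict_sphere] at this

lemma continuous_integral_sphM {X : Type*} [TopologicalSpace X] [FirstCountableTopology X]
    [LocallyCompactSpace X] {f : X → E3 → ℝ} (hf : Continuous (Function.uncurry f)) :
    Continuous fun x => ∫ ω, f x ω ∂sphM := by
  have := continuous_parametric_integral_of_continuous (μ := sphM) hf (isCompact_sphere (0 : E3) 1)
  rwa [sphM_restrict_sphere] at this

lemma hasDerivAt_integral_sphM {f f' : ℝ → E3 → ℝ} (hf : Continuous (Function.uncurry f))
    (hf' : Continuous (Function.uncurry f'))
    (h : ∀ s ω, HasDerivAt (fun s => f s ω) (f' s ω) s) (s₀ : ℝ) :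
    HasDerivAt (fun s => ∫ ω, f s ω ∂sphM) (∫ ω, f' s₀ ω ∂sphM) s₀ := by
  obtain ⟨C, hC⟩ := ((isCompact_closedBall s₀ 1).prod
    (isCompact_sphere (0 : E3) 1)).exists_bound_of_continuousOn hf'.continuousOn
  refine (hasDerivAt_integral_of_dominated_loc_of_deriv_le (bound := fun _ => C)
    (F := f) (F' := f') (ball_mem_nhds s₀ one_pos)
    (Filter.Eventually.of_forall fun s => ?_) ?_ ?_ ?_ (integrable_const C) ?_).2
  · exact (hf.comp (Continuous.prodMk_right s)).aestronglyMeasurable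
  · exact integrable_sphM (hf.comp (Continuous.prodMk_right s₀))
  · exact (hf'.comp (Continuous.prodMk_right s₀)).aestronglyMeasurable
  · filter_upwards [ae_sphM_norm] with ω hω s hs
    exact hC (s, ω) ⟨ball_subset_closedBall hs, by simpa using hω⟩
  · filter_upwards with ω s _ using h s ω

/-- The generator `ω_i e_j - ω_j e_i` of the rotations in the `(i, j)`-plane. -/
def rotGen (i j : Fin 3) (ω : E3) : E3 :=
  ω i • EuclideanSpace.single j 1 - ω j • EuclideanSpace.single i 1

/-- The rotation by the angle `s` in the `(i, j)`-plane. -/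
def rotMap (i j : Fin 3) (s : ℝ) : E3 →ₗ[ℝ] E3 where
  toFun ω := ω + (Real.cos s - 1) • (ω i • EuclideanSpace.single i 1 +
    ω j • EuclideanSpace.single j 1) + Real.sin s • rotGen i j ω
  map_add' x y := by
    simp only [rotGen, PiLp.add_apply]
    module
  map_smul' c x := by
    simp only [rotGen, PiLp.smul_apply, RingHom.id_apply, smul_eq_mul]
    module

lemma norm_rotMap {i j : Fin 3} (hij : i ≠ j) (s : ℝ) (ω : E3) : ‖rotMap i j s ω‖ = ‖ω‖ := by
  rw [← sq_eq_sq₀ (norm_nonneg _) (norm_nonneg _), EuclideanSpace.norm_sq_eq,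
    EuclideanSpace.norm_sq_eq, Fin.sum_univ_three, Fin.sum_univ_three]
  simp only [Real.norm_eq_abs, sq_abs, rotMap, rotGen, LinearMap.coe_mk, AddHom.coe_mk]
  fin_cases i <;> fin_cases j <;> first | exact absurd rfl hij | skip
  · simp; linear_combination (ω 0 ^ 2 + ω 1 ^ 2) * Real.sin_sq_add_cos_sq s
  · simp; linear_combination (ω 0 ^ 2 + ω 2 ^ 2) * Real.sin_sq_add_cos_sq s
  · simp; linear_combination (ω 0 ^ 2 + ω 1 ^ 2) * Real.sin_sq_add_cos_sq s
  · simp; linear_combination (ω 1 ^ 2 + ω 2 ^ 2) * Real.sin_sq_add_cos_sq s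
  · simp; linear_combination (ω 0 ^ 2 + ω 2 ^ 2) * Real.sin_sq_add_cos_sq s
  · simp; linear_combination (ω 1 ^ 2 + ω 2 ^ 2) * Real.sin_sq_add_cos_sq s

lemma measurePreserving_rotMap {i j : Fin 3} (hij : i ≠ j) (s : ℝ) :
    MeasurePreserving (rotMap i j s) sphM sphM := by
  let e := (LinearIsometry.mk (rotMap i j s) (norm_rotMap hij s)).toLinearIsometryEquiv rfl
  have h : MeasurePreserving e (μH[2]) (μH[2]) :=
    e.toIsometryEquiv.measurePreserving_hausdorffMeasure 2
  have h2 := h.restrict_preimage (s := sphere 0 1) isClosed_sphere.measurableSet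
  have h3 : e ⁻¹' sphere 0 1 = sphere 0 1 := by
    ext x; simp
  rw [h3] at h2
  exact h2

lemma integral_comp_rotMap {i j : Fin 3} (hij : i ≠ j) (s : ℝ) {f : E3 → ℝ} (hf : Continuous f) :
    ∫ ω, f (rotMap i j s ω) ∂sphM = ∫ ω, f ω ∂sphM := by
  have h := measurePreserving_rotMap hij s
  conv_rhs => rw [← h.map_eq]
  rw [integral_map h.measurable.aemeasurable hf.aestronglyMeasurable]

lemma hasDerivAt_rotMap (i j : Fin 3) (ω : E3) (s : ℝ) :
    HasDerivAt (fun s => rotMap i j s ω) ((-Real.sin s) • (ω i • EuclideanSpace.single i (1 : ℝ) +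
    ω j • EuclideanSpace.single j 1) + Real.cos s • rotGen i j ω) s := by
  have h1 := ((Real.hasDerivAt_cos s).sub_const 1).smul_const
    (ω i • EuclideanSpace.single i (1 : ℝ) + ω j • EuclideanSpace.single j 1)
  have h2 := (Real.hasDerivAt_sin s).smul_const (rotGen i j ω)
  exact (h1.const_add ω).add h2

lemma continuous_rotGen (i j : Fin 3) : Continuous (rotGen i j) := by
  unfold rotGen
  fun_prop

/-- Rotational derivatives integrate to zero over the unit sphere. -/
lemma integral_fderiv_rotGen {i j : Fin 3} (hij : i ≠ j) {f : E3 → ℝ} (hf : ContDiff ℝ 1 f) :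
    ∫ ω, fderiv ℝ f ω (rotGen i j ω) ∂sphM = 0 := by
  have hrot : Continuous fun q : ℝ × E3 => rotMap i j q.1 q.2 := by
    change Continuous fun q : ℝ × E3 => q.2 + (Real.cos q.1 - 1) • (q.2 i • EuclideanSpace.single i 1 +
      q.2 j • EuclideanSpace.single j 1) + Real.sin q.1 • rotGen i j q.2
    have := (continuous_rotGen i j).comp (continuous_snd (X := ℝ) (Y := E3))
    fun_prop
  have hX : Continuous fun q : ℝ × E3 => (-Real.sin q.1) • (q.2 i • EuclideanSpace.single i (1 : ℝ) +
      q.2 j • EuclideanSpace.single j 1) + Real.cos q.1 • rotGen i j q.2 := by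
    have := (continuous_rotGen i j).comp (continuous_snd (X := ℝ) (Y := E3))
    fun_prop
  have h := hasDerivAt_integral_sphM (f := fun s ω => f (rotMap i j s ω))
    (f' := fun s ω => fderiv ℝ f (rotMap i j s ω)
      ((-Real.sin s) • (ω i • EuclideanSpace.single i (1 : ℝ) +
    ω j • EuclideanSpace.single j 1) + Real.cos s • rotGen i j ω))
    (hf.continuous.comp hrot)
    (((hf.continuous_fderiv one_ne_zero).comp hrot).clm_apply hX)
    (fun s ω => ((hf.differentiable one_ne_zero _).hasFDerivAt).comp_hasDerivAt s
      (hasDerivAt_rotMap i j ω s)) 0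
  simp only [integral_comp_rotMap hij _ hf.continuous] at h
  have h0 := h.unique (hasDerivAt_const (0 : ℝ) _)
  rw [← h0]
  refine integral_congr_ae (Filter.Eventually.of_forall fun ω => ?_)
  simp [rotMap]

section Commutator

variable {A : V → Fin 4 → ℝ} {φ f : V → ℂ}

lemma fderiv_apply_eq_sum (f : V → ℂ) (p X : V) :
    fderiv ℝ f p X = ∑ μ, (X μ : ℂ) * pdC μ f p := by
  have h := (fderiv ℝ f p).toLinearMap.pi_apply_eq_sum_univ X
  simp only [ContinuousLinearMap.coe_coe] at h
  rw [h]
  refine Finset.sum_congr rfl fun μ _ => ?_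
  rw [Complex.real_smul, pdC]
  congr 3
  ext ν
  simp [Pi.single_apply, eq_comm]

lemma contDiff_component (hA : ContDiff ℝ (⊤ : ℕ∞) A) (μ : Fin 4) :
    ContDiff ℝ (⊤ : ℕ∞) fun p => A p μ :=
  contDiff_pi.1 hA μ

lemma contDiff_pdC (hf : ContDiff ℝ (⊤ : ℕ∞) f) (μ : Fin 4) : ContDiff ℝ (⊤ : ℕ∞) (pdC μ f) :=
  (hf.fderiv_right (m := (⊤ : ℕ∞)) (by simp)).clm_apply contDiff_const

lemma contDiff_covD (hA : ContDiff ℝ (⊤ : ℕ∞) A) (hf : ContDiff ℝ (⊤ : ℕ∞) f) (μ : Fin 4) :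
    ContDiff ℝ (⊤ : ℕ∞) (covD A μ f) :=
  (contDiff_pdC hf μ).add
    ((contDiff_const.mul (Complex.ofRealCLM.contDiff.comp (contDiff_component hA μ))).mul hf)

lemma covD2_sub_covD2 (hA : ContDiff ℝ (⊤ : ℕ∞) A) (hφ : ContDiff ℝ (⊤ : ℕ∞) φ)
    (μ ν : Fin 4) (p : V) :
    covD2 A μ ν φ p - covD2 A ν μ φ p = Complex.I * curv A p μ ν * φ p := by
  have hd : ∀ {g : V → ℂ}, ContDiff ℝ (⊤ : ℕ∞) g → HasFDerivAt g (fderiv ℝ g p) p :=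
    fun hg => (hg.differentiable (by simp) p).hasFDerivAt
  have key : ∀ μ ν, pdC μ (covD A ν φ) p = pdC μ (pdC ν φ) p +
      (Complex.I * pd μ (fun q => A q ν) p * φ p + Complex.I * A p ν * pdC μ φ p) := by
    intro μ ν
    have hAν : HasFDerivAt (fun q => A q ν) (fderiv ℝ (fun q => A q ν) p) p :=
      ((contDiff_component hA ν).differentiable (by simp) p).hasFDerivAt
    have h1 := (hd (contDiff_pdC hφ ν)).add
      (((Complex.ofRealCLM.hasFDerivAt.comp p hAν).const_mul Complex.I).mul (hd hφ))
    have h2 : HasFDerivAt (covD A ν φ) _ p := h1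
    simp only [pdC, pd]
    rw [h2.fderiv]
    simp
    ring
  have hsymm : pdC μ (pdC ν φ) p = pdC ν (pdC μ φ) p := by
    have hs : IsSymmSndFDerivAt ℝ φ p :=
      hφ.contDiffAt.isSymmSndFDerivAt (by
        rw [minSmoothness_of_isRCLikeNormedField]
        exact WithTop.coe_le_coe.2 (le_top : (2 : ℕ∞) ≤ ⊤))
    have h3 : ∀ μ ν, pdC μ (pdC ν φ) p =
        fderiv ℝ (fderiv ℝ φ) p (Pi.single μ 1) (Pi.single ν 1) := by
      intro μ ν
      have hd2 : DifferentiableAt ℝ (fderiv ℝ φ) p :=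
        ((hφ.fderiv_right (m := (⊤ : ℕ∞)) (by simp)).differentiable (by simp)) p
      have h4 := hd2.hasFDerivAt.clm_apply (hasFDerivAt_const (Pi.single ν (1 : ℝ) : V) p)
      have h5 : HasFDerivAt (pdC ν φ) _ p := h4
      rw [pdC, h5.fderiv]
      simp
    rw [h3, h3]
    exact hs _ _
  simp only [covD2, key, curv, covD, hsymm]
  push_cast
  ring

/-- The derivative along a curve, split into its covariant part and a connection term. -/
lemma hasDerivAt_comp_curve (A : V → Fin 4 → ℝ) (hf : ContDiff ℝ (⊤ : ℕ∞) f)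
    {c : ℝ → V} {X p : V} {s : ℝ} (hc : HasDerivAt c X s) (hp : c s = p) :
    HasDerivAt (fun s => f (c s))
      (∑ μ, (X μ : ℂ) * covD A μ f p - Complex.I * ((∑ μ, X μ * A p μ : ℝ) : ℂ) * f p) s := by
  subst hp
  have h := ((hf.differentiable (by simp) (c s)).hasFDerivAt).comp_hasDerivAt s hc
  refine h.congr_deriv ?_
  rw [fderiv_apply_eq_sum]
  simp only [covD, mul_add, Finset.sum_add_distrib]
  push_cast
  simp only [Fin.sum_univ_four]
  ring

end Commutator

/-- The real inner product on `ℂ`. -/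
def ip (z w : ℂ) : ℝ := z.re * w.re + z.im * w.im

lemma ip_self (z : ℂ) : ip z z = ‖z‖ ^ 2 := by
  rw [← Complex.normSq_eq_norm_sq, Complex.normSq_apply, ip]

lemma contDiff_ip {E : Type*} [NormedAddCommGroup E] [NormedSpace ℝ E] {n : WithTop ℕ∞}
    {f g : E → ℂ} (hf : ContDiff ℝ n f) (hg : ContDiff ℝ n g) :
    ContDiff ℝ n fun x => ip (f x) (g x) :=
  ((Complex.reCLM.contDiff.comp hf).mul (Complex.reCLM.contDiff.comp hg)).add
    ((Complex.imCLM.contDiff.comp hf).mul (Complex.imCLM.contDiff.comp hg))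

/-- The inner product is parallel for unitary connections. -/
lemma hasDerivAt_ip {f g : ℝ → ℂ} {f₁ g₁ : ℂ} {α s : ℝ}
    (hf : HasDerivAt f (f₁ - Complex.I * α * f s) s)
    (hg : HasDerivAt g (g₁ - Complex.I * α * g s) s) :
    HasDerivAt (fun s => ip (f s) (g s)) (ip (g s) f₁ + ip (f s) g₁) s := by
  have hre : ∀ {k : ℝ → ℂ} {k' : ℂ}, HasDerivAt k k' s → HasDerivAt (fun s => (k s).re) k'.re s :=
    fun h => Complex.reCLM.hasFDerivAt.comp_hasDerivAt s h
  have him : ∀ {k : ℝ → ℂ} {k' : ℂ}, HasDerivAt k k' s → HasDerivAt (fun s => (k s).im) k'.im s :=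
    fun h => Complex.imCLM.hasFDerivAt.comp_hasDerivAt s h
  refine (((hre hf).mul (hre hg)).add ((him hf).mul (him hg))).congr_deriv ?_
  simp [ip]
  ring

/-- The outgoing null vector in the direction `ω`. -/
def outV (ω : E3) : V := ![1, ω 0, ω 1, ω 2]
/-- The incoming null vector in the direction `ω`. -/
def incV (ω : E3) : V := ![1, -ω 0, -ω 1, -ω 2]
/-- A spatial vector as a spacetime vector. -/
def spV (y : E3) : V := ![0, y 0, y 1, y 2]

/-- The second covariant derivative evaluated on two vectors. -/
def hessD (A : V → Fin 4 → ℝ) (φ : V → ℂ) (p X Y : V) : ℂ :=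
  ∑ μ, ∑ ν, (X μ : ℂ) * (Y ν : ℂ) * covD2 A μ ν φ p

/-- The connection form evaluated on a vector. -/
def conn (A : V → Fin 4 → ℝ) (p X : V) : ℝ := ∑ μ, X μ * A p μ

/-- `D_L (r φ)` in polar coordinates. -/
def radD (A : V → Fin 4 → ℝ) (φ : V → ℂ) (t r : ℝ) (ω : E3) : ℂ :=
  r * dirD A (outV ω) φ (pt t r ω) + φ (pt t r ω)

/-- `D_{Ω_ij} (r φ)` in polar coordinates. -/
def angD (A : V → Fin 4 → ℝ) (φ : V → ℂ) (i j : Fin 3) (t r : ℝ) (ω : E3) : ℂ :=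
  r ^ 2 * dirD A (spV (rotGen i j ω)) φ (pt t r ω)

/-- Sum over the three pairs `i < j`. -/
def pairSum {M : Type*} [Add M] (f : Fin 3 → Fin 3 → M) : M := f 0 1 + f 0 2 + f 1 2

section Curves

variable {A : V → Fin 4 → ℝ} {φ : V → ℂ}

lemma hasDerivAt_dirD (hA : ContDiff ℝ (⊤ : ℕ∞) A) (hφ : ContDiff ℝ (⊤ : ℕ∞) φ)
    {c Y : ℝ → V} {X Y' p : V} {s : ℝ} (hc : HasDerivAt c X s) (hY : HasDerivAt Y Y' s)
    (hp : c s = p) :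
    HasDerivAt (fun s => dirD A (Y s) φ (c s))
      (hessD A φ p X (Y s) + dirD A Y' φ p - Complex.I * conn A p X * dirD A (Y s) φ (c s)) s := by
  have h1 : ∀ ν, HasDerivAt (fun s => (Y s ν : ℂ)) (Y' ν : ℂ) s := fun ν =>
    ((hasDerivAt_pi.1 hY ν).ofReal_comp)
  have h2 := fun ν => (h1 ν).mul (hasDerivAt_comp_curve A (contDiff_covD hA hφ ν) hc hp)
  have h3 := HasDerivAt.fun_sum (u := Finset.univ) fun ν _ => h2 ν
  refine h3.congr_deriv ?_
  subst hp
  simp only [hessD, dirD, conn, Fin.sum_univ_four, covD2, covD]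
  push_cast
  ring

lemma hasDerivAt_pt_u (u v : ℝ) (ω : E3) :
    HasDerivAt (fun u => pt (u + v) (v - u) ω) (incV ω) u := by
  refine hasDerivAt_pi.2 fun i => ?_
  have h0 := (hasDerivAt_id u).add_const v
  have h1 := fun k : Fin 3 => ((hasDerivAt_id u).const_sub v).mul_const (ω k)
  fin_cases i
  · exact h0
  · simpa [pt, incV] using h1 0
  · simpa [pt, incV] using h1 1
  · simpa [pt, incV] using h1 2

lemma hasDerivAt_pt_v (u v : ℝ) (ω : E3) :
    HasDerivAt (fun v => pt (u + v) (v - u) ω) (outV ω) v := by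
  refine hasDerivAt_pi.2 fun i => ?_
  have h0 := (hasDerivAt_id v).const_add u
  have h1 := fun k : Fin 3 => ((hasDerivAt_id v).sub_const u).mul_const (ω k)
  fin_cases i
  · exact h0
  · simpa [pt, outV] using h1 0
  · simpa [pt, outV] using h1 1
  · simpa [pt, outV] using h1 2

lemma hasDerivAt_line (ω Z : E3) (k : Fin 3) :
    HasDerivAt (fun s : ℝ => (ω + s • Z) k) (Z k) 0 := by
  have := ((hasDerivAt_id (0 : ℝ)).mul_const (Z k)).const_add (ω k)
  simpa using this

lemma hasDerivAt_pt_ω (t r : ℝ) (ω Z : E3) :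
    HasDerivAt (fun s : ℝ => pt t r (ω + s • Z)) (r • spV Z) 0 := by
  refine hasDerivAt_pi.2 fun i => ?_
  have h1 := fun k : Fin 3 => (hasDerivAt_line ω Z k).const_mul r
  fin_cases i
  · simpa [pt, spV] using hasDerivAt_const (0 : ℝ) t
  · exact h1 0
  · exact h1 1
  · exact h1 2

lemma hasDerivAt_outV (ω Z : E3) : HasDerivAt (fun s : ℝ => outV (ω + s • Z)) (spV Z) 0 := by
  refine hasDerivAt_pi.2 fun i => ?_
  fin_cases i
  · exact hasDerivAt_const (0 : ℝ) (1 : ℝ)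
  · exact hasDerivAt_line ω Z 0
  · exact hasDerivAt_line ω Z 1
  · exact hasDerivAt_line ω Z 2

lemma hasDerivAt_spV_rotGen (i j : Fin 3) (ω Z : E3) :
    HasDerivAt (fun s : ℝ => spV (rotGen i j (ω + s • Z))) (spV (rotGen i j Z)) 0 := by
  have h : ∀ s : ℝ, rotGen i j (ω + s • Z) = rotGen i j ω + s • rotGen i j Z := by
    intro s
    simp only [rotGen, PiLp.add_apply, PiLp.smul_apply, smul_eq_mul]
    module
  simp only [h]
  refine hasDerivAt_pi.2 fun k => ?_
  fin_cases k
  · exact hasDerivAt_const (0 : ℝ) (0 : ℝ)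
  · exact hasDerivAt_line _ _ 0
  · exact hasDerivAt_line _ _ 1
  · exact hasDerivAt_line _ _ 2

lemma hasDerivAt_radD_u (hA : ContDiff ℝ (⊤ : ℕ∞) A) (hφ : ContDiff ℝ (⊤ : ℕ∞) φ)
    (u v : ℝ) (ω : E3) :
    HasDerivAt (fun u => radD A φ (u + v) (v - u) ω)
      ((((v - u : ℝ) : ℂ) * hessD A φ (pt (u + v) (v - u) ω) (incV ω) (outV ω)
        - dirD A (outV ω) φ (pt (u + v) (v - u) ω) + dirD A (incV ω) φ (pt (u + v) (v - u) ω))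
      - Complex.I * conn A (pt (u + v) (v - u) ω) (incV ω) * radD A φ (u + v) (v - u) ω) u := by
  have hr : HasDerivAt (fun u : ℝ => ((v - u : ℝ) : ℂ)) ((-1 : ℝ) : ℂ) u := by
    simpa using ((hasDerivAt_id u).const_sub v).ofReal_comp
  have h1 := hasDerivAt_dirD hA hφ (hasDerivAt_pt_u u v ω) (hasDerivAt_const u (outV ω)) rfl
  have h2 := hasDerivAt_comp_curve A hφ (hasDerivAt_pt_u u v ω) rfl
  refine ((hr.mul h1).add h2).congr_deriv ?_
  have h0 : dirD A 0 φ (pt (u + v) (v - u) ω) = 0 := by simp [dirD]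
  rw [h0]
  simp only [radD, conn, dirD]
  push_cast
  ring

lemma hasDerivAt_angD_v (hA : ContDiff ℝ (⊤ : ℕ∞) A) (hφ : ContDiff ℝ (⊤ : ℕ∞) φ)
    (i j : Fin 3) (u v : ℝ) (ω : E3) :
    HasDerivAt (fun v => angD A φ i j (u + v) (v - u) ω)
      ((2 * ((v - u : ℝ) : ℂ) * dirD A (spV (rotGen i j ω)) φ (pt (u + v) (v - u) ω)
        + ((v - u : ℝ) : ℂ) ^ 2 *
          hessD A φ (pt (u + v) (v - u) ω) (outV ω) (spV (rotGen i j ω)))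
      - Complex.I * conn A (pt (u + v) (v - u) ω) (outV ω) *
        angD A φ i j (u + v) (v - u) ω) v := by
  have hr : HasDerivAt (fun v : ℝ => ((v - u : ℝ) : ℂ)) ((1 : ℝ) : ℂ) v := by
    simpa using ((hasDerivAt_id v).sub_const u).ofReal_comp
  have h1 := hasDerivAt_dirD hA hφ (hasDerivAt_pt_v u v ω)
    (hasDerivAt_const v (spV (rotGen i j ω))) rfl
  refine ((hr.fun_pow 2).mul h1).congr_deriv ?_
  have h0 : dirD A 0 φ (pt (u + v) (v - u) ω) = 0 := by simp [dirD]
  rw [h0]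
  simp only [angD]
  push_cast
  ring

lemma hessD_smul_left (A : V → Fin 4 → ℝ) (φ : V → ℂ) (p X Y : V) (r : ℝ) :
    hessD A φ p (r • X) Y = r * hessD A φ p X Y := by
  simp only [hessD, Finset.mul_sum, Pi.smul_apply, smul_eq_mul, Complex.ofReal_mul, mul_assoc]

lemma dirD_smul (A : V → Fin 4 → ℝ) (φ : V → ℂ) (p X : V) (r : ℝ) :
    dirD A (r • X) φ p = r * dirD A X φ p := by
  simp only [dirD, Finset.mul_sum, Pi.smul_apply, smul_eq_mul, Complex.ofReal_mul, mul_assoc]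

lemma hasDerivAt_radD_ω (hA : ContDiff ℝ (⊤ : ℕ∞) A) (hφ : ContDiff ℝ (⊤ : ℕ∞) φ)
    (t r : ℝ) (ω Z : E3) :
    HasDerivAt (fun s : ℝ => radD A φ t r (ω + s • Z))
      (((r : ℂ) ^ 2 * hessD A φ (pt t r ω) (spV Z) (outV ω)
        + 2 * r * dirD A (spV Z) φ (pt t r ω))
      - Complex.I * conn A (pt t r ω) (r • spV Z) * radD A φ t r (ω + (0 : ℝ) • Z)) 0 := by
  have hz : pt t r (ω + (0 : ℝ) • Z) = pt t r ω := by simp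
  have h1 := hasDerivAt_dirD hA hφ (hasDerivAt_pt_ω t r ω Z) (hasDerivAt_outV ω Z) hz
  have h2 := hasDerivAt_comp_curve A hφ (hasDerivAt_pt_ω t r ω Z) hz
  refine ((h1.const_mul (r : ℂ)).add h2).congr_deriv ?_
  have h3 : ∑ μ, ((r • spV Z) μ : ℂ) * covD A μ φ (pt t r ω) =
    r * dirD A (spV Z) φ (pt t r ω) := dirD_smul ..
  simp only [zero_smul, add_zero, h3, hessD_smul_left]
  rw [show ∑ μ, (r • spV Z) μ * A (pt t r ω) μ = conn A (pt t r ω) (r • spV Z) from rfl]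
  simp only [radD]
  ring

lemma hasDerivAt_angD_ω (hA : ContDiff ℝ (⊤ : ℕ∞) A) (hφ : ContDiff ℝ (⊤ : ℕ∞) φ)
    (i j : Fin 3) (t r : ℝ) (ω Z : E3) :
    HasDerivAt (fun s : ℝ => angD A φ i j t r (ω + s • Z))
      (((r : ℂ) ^ 3 * hessD A φ (pt t r ω) (spV Z) (spV (rotGen i j ω))
        + (r : ℂ) ^ 2 * dirD A (spV (rotGen i j Z)) φ (pt t r ω))
      - Complex.I * conn A (pt t r ω) (r • spV Z) * angD A φ i j t r (ω + (0 : ℝ) • Z)) 0 := by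
  have hz : pt t r (ω + (0 : ℝ) • Z) = pt t r ω := by simp
  have h1 := hasDerivAt_dirD hA hφ (hasDerivAt_pt_ω t r ω Z) (hasDerivAt_spV_rotGen i j ω Z) hz
  refine (h1.const_mul ((r : ℂ) ^ 2)).congr_deriv ?_
  simp only [zero_smul, add_zero, hessD_smul_left, angD]
  ring

end Curves

/-- The contraction `X^μ F_{μν} J^ν` for a fixed vector `X`. -/
def contrFJ (A : V → Fin 4 → ℝ) (φ : V → ℂ) (p X : V) : ℝ :=
  ∑ ν, (∑ μ, X μ * curv A p μ ν) * (eta ν * Jsf A φ p ν)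

/-- Flux density of the weighted `D_L ψ` energy through outgoing cones. -/
def fluxP (A : V → Fin 4 → ℝ) (φ : V → ℂ) (g q : ℝ → ℝ) (u v : ℝ) (ω : E3) : ℝ :=
  g u * ((v - u) ^ 2 * q (v - u)) *
    ip (radD A φ (u + v) (v - u) ω) (radD A φ (u + v) (v - u) ω)

/-- Flux density of the weighted angular energy through incoming cones. -/
def fluxQ (A : V → Fin 4 → ℝ) (φ : V → ℂ) (g q : ℝ → ℝ) (u v : ℝ) (ω : E3) : ℝ :=
  g u * q (v - u) * pairSum fun i j =>
    ip (angD A φ i j (u + v) (v - u) ω) (angD A φ i j (u + v) (v - u) ω)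

/-- The angular component of the weighted current. -/
def fluxY (A : V → Fin 4 → ℝ) (φ : V → ℂ) (g q : ℝ → ℝ) (i j : Fin 3) (u v : ℝ) (ω : E3) : ℝ :=
  g u * q (v - u) * ip (radD A φ (u + v) (v - u) ω) (angD A φ i j (u + v) (v - u) ω)

/-- The source density of the weighted current, up to rotational derivatives. -/
def srcS (A : V → Fin 4 → ℝ) (φ : V → ℂ) (g g' q q' : ℝ → ℝ) (u v : ℝ) (ω : E3) : ℝ :=
  (g' u * ((v - u) ^ 2 * q (v - u)) - g u * (2 * (v - u) * q (v - u) + (v - u) ^ 2 * q' (v - u))) *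
      ip (radD A φ (u + v) (v - u) ω) (radD A φ (u + v) (v - u) ω)
    + g u * q' (v - u) * (pairSum fun i j =>
      ip (angD A φ i j (u + v) (v - u) ω) (angD A φ i j (u + v) (v - u) ω))
    - 2 * (g u * q (v - u) * (v - u) ^ 3 *
      ip (radD A φ (u + v) (v - u) ω) (boxA A φ (pt (u + v) (v - u) ω)))
    - 2 * (g u * q (v - u) * (v - u) ^ 4 *
      contrFJ A φ (pt (u + v) (v - u) ω) (outV ω))

section Algebra

variable {A : V → Fin 4 → ℝ} {φ : V → ℂ}

lemma curv_antisymm (A : V → Fin 4 → ℝ) (p : V) (μ ν : Fin 4) : curv A p μ ν = -curv A p ν μ := by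
  simp [curv]

lemma ip_add_right (z w w' : ℂ) : ip z (w + w') = ip z w + ip z w' := by
  simp [ip]; ring

lemma ip_sub_right (z w w' : ℂ) : ip z (w - w') = ip z w - ip z w' := by
  simp [ip]; ring

lemma ip_comm (z w : ℂ) : ip z w = ip w z := by
  simp [ip]; ring

lemma ip_real_mul_right (c : ℝ) (z w : ℂ) : ip z (c * w) = c * ip z w := by
  simp [ip]; ring

lemma ip_real_pow_mul_right (c : ℝ) (n : ℕ) (z w : ℂ) : ip z ((c : ℂ) ^ n * w) = c ^ n * ip z w := by
  rw [← Complex.ofReal_pow, ip_real_mul_right]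

lemma ip_two_mul_right (z w : ℂ) : ip z (2 * w) = 2 * ip z w := by
  simpa using ip_real_mul_right 2 z w

lemma sum_sq_eq_one {ω : E3} (hω : ‖ω‖ = 1) : ω 0 ^ 2 + ω 1 ^ 2 + ω 2 ^ 2 = 1 := by
  have h := EuclideanSpace.norm_sq_eq ω
  rw [hω, Fin.sum_univ_three] at h
  simp only [Real.norm_eq_abs, sq_abs] at h
  linarith

/-- Mixed radial component of the curvature. -/
def curvR (A : V → Fin 4 → ℝ) (p : V) (ω : E3) : ℝ :=
  ω 0 * curv A p 0 1 + ω 1 * curv A p 0 2 + ω 2 * curv A p 0 3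

/-- Curvature evaluated on the outgoing vector and a spatial vector. -/
def curvA (A : V → Fin 4 → ℝ) (p : V) (ω Z : E3) : ℝ :=
  ∑ μ, ∑ ν, outV ω μ * spV Z ν * curv A p μ ν

lemma rotGen_01 (ω : E3) : spV (rotGen 0 1 ω) = ![0, -ω 1, ω 0, 0] := by
  simp [spV, rotGen]
lemma rotGen_02 (ω : E3) : spV (rotGen 0 2 ω) = ![0, -ω 2, 0, ω 0] := by
  simp [spV, rotGen]
lemma rotGen_12 (ω : E3) : spV (rotGen 1 2 ω) = ![0, 0, -ω 2, ω 1] := by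
  simp [spV, rotGen]
lemma rotGen_rotGen_01 (ω : E3) : spV (rotGen 0 1 (rotGen 0 1 ω)) = ![0, -ω 0, -ω 1, 0] := by
  simp [spV, rotGen]
lemma rotGen_rotGen_02 (ω : E3) : spV (rotGen 0 2 (rotGen 0 2 ω)) = ![0, -ω 0, 0, -ω 2] := by
  simp [spV, rotGen]
lemma rotGen_rotGen_12 (ω : E3) : spV (rotGen 1 2 (rotGen 1 2 ω)) = ![0, 0, -ω 1, -ω 2] := by
  simp [spV, rotGen]

/-- The wave operator in polar null coordinates. -/
lemma wave_polar (hA : ContDiff ℝ (⊤ : ℕ∞) A) (hφ : ContDiff ℝ (⊤ : ℕ∞) φ)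
    (p : V) (r : ℝ) {ω : E3} (hω : ‖ω‖ = 1) :
    (r : ℂ) ^ 2 * (r * hessD A φ p (incV ω) (outV ω) - dirD A (outV ω) φ p + dirD A (incV ω) φ p)
      - pairSum (fun i j => (r : ℂ) ^ 3 * hessD A φ p (spV (rotGen i j ω)) (spV (rotGen i j ω))
        + (r : ℂ) ^ 2 * dirD A (spV (rotGen i j (rotGen i j ω))) φ p)
      = ((-r ^ 3 : ℝ) : ℂ) * boxA A φ p + ((r ^ 3 * curvR A p ω : ℝ) : ℂ) * (Complex.I * φ p) := by
  have h1 := covD2_sub_covD2 hA hφ 0 1 p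
  have h2 := covD2_sub_covD2 hA hφ 0 2 p
  have h3 := covD2_sub_covD2 hA hφ 0 3 p
  have hs : (ω 0 : ℂ) ^ 2 + (ω 1 : ℂ) ^ 2 + (ω 2 : ℂ) ^ 2 = 1 := by
    have := congrArg Complex.ofReal (sum_sq_eq_one hω)
    push_cast at this
    exact this
  simp only [pairSum, rotGen_rotGen_01, rotGen_rotGen_02, rotGen_rotGen_12]
  simp only [rotGen_01, rotGen_02, rotGen_12, hessD, dirD, boxA, Fin.sum_univ_four, outV, incV, curvR, eta]
  simp
  linear_combination (r : ℂ) ^ 3 * (ω 0 * h1 + ω 1 * h2 + ω 2 * h3)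
    - (r : ℂ) ^ 3 * (covD2 A 1 1 φ p + covD2 A 2 2 φ p + covD2 A 3 3 φ p) * hs

lemma hessD_comm (hA : ContDiff ℝ (⊤ : ℕ∞) A) (hφ : ContDiff ℝ (⊤ : ℕ∞) φ)
    (p : V) (ω Z : E3) :
    hessD A φ p (outV ω) (spV Z) - hessD A φ p (spV Z) (outV ω) =
      (curvA A p ω Z : ℂ) * (Complex.I * φ p) := by
  have h := fun μ ν => covD2_sub_covD2 hA hφ μ ν p
  rw [hessD, hessD, Finset.sum_comm (f := fun μ ν => (spV Z μ : ℂ) * (outV ω ν : ℂ) *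
    covD2 A μ ν φ p), ← Finset.sum_sub_distrib]
  simp only [← Finset.sum_sub_distrib]
  rw [curvA]
  push_cast
  simp only [Finset.sum_mul]
  refine Finset.sum_congr rfl fun μ _ => Finset.sum_congr rfl fun ν _ => ?_
  linear_combination (outV ω μ : ℂ) * (spV Z ν : ℂ) * h μ ν

lemma ip_covD_I (A : V → Fin 4 → ℝ) (φ : V → ℂ) (p : V) (μ : Fin 4) :
    ip (covD A μ φ p) (Complex.I * φ p) = -Jsf A φ p μ := by
  simp [ip, Jsf]
  ring

lemma ip_dirD_I (A : V → Fin 4 → ℝ) (φ : V → ℂ) (p X : V) :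
    ip (dirD A X φ p) (Complex.I * φ p) = -∑ μ, X μ * Jsf A φ p μ := by
  have h := fun μ => ip_covD_I A φ p μ
  simp only [ip] at h
  simp only [ip, dirD, Complex.re_sum, Complex.im_sum, Complex.re_ofReal_mul,
    Complex.im_ofReal_mul, Finset.sum_mul, ← Finset.sum_add_distrib, ← Finset.sum_neg_distrib]
  refine Finset.sum_congr rfl fun μ _ => ?_
  linear_combination X μ * h μ

lemma curvature_terms (A : V → Fin 4 → ℝ) (φ : V → ℂ) (t r : ℝ) {ω : E3} (hω : ‖ω‖ = 1) :
    r ^ 3 * curvR A (pt t r ω) ω * ip (radD A φ t r ω) (Complex.I * φ (pt t r ω))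
      + pairSum (fun i j => r ^ 2 * curvA A (pt t r ω) ω (rotGen i j ω) *
        ip (angD A φ i j t r ω) (Complex.I * φ (pt t r ω)))
      = -(r ^ 4 * contrFJ A φ (pt t r ω) (outV ω)) := by
  set p := pt t r ω
  have h1 : ip (radD A φ t r ω) (Complex.I * φ p) = -(r * ∑ μ, outV ω μ * Jsf A φ p μ) := by
    rw [radD, ip_comm, ip_add_right, ip_real_mul_right, ip_comm, ip_dirD_I]
    simp [ip]; ring
  have h2 : ∀ i j, ip (angD A φ i j t r ω) (Complex.I * φ p) =
      -(r ^ 2 * ∑ μ, spV (rotGen i j ω) μ * Jsf A φ p μ) := by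
    intro i j
    rw [angD, ip_comm, ip_real_pow_mul_right, ip_comm, ip_dirD_I]
    ring
  have hs := sum_sq_eq_one hω
  have c00 : ∀ μ, curv A p μ μ = 0 := fun μ => by simp [curv]
  simp only [h1, h2, pairSum, contrFJ, curvA, curvR, rotGen_01, rotGen_02, rotGen_12,
    Fin.sum_univ_four, outV, eta, c00, curv_antisymm A p 1 0, curv_antisymm A p 2 0,
    curv_antisymm A p 3 0, curv_antisymm A p 2 1, curv_antisymm A p 3 1, curv_antisymm A p 3 2]
  generalize Jsf A φ p 0 = J0, Jsf A φ p 1 = J1, Jsf A φ p 2 = J2, Jsf A φ p 3 = J3,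
    curv A p 0 1 = F01, curv A p 0 2 = F02, curv A p 0 3 = F03, curv A p 1 2 = F12,
    curv A p 1 3 = F13, curv A p 2 3 = F23
  simp
  linear_combination (-r ^ 4 * (J1 * F01 + J2 * F02 + J3 * F03
    + J1 * (- ω 1 * F12 - ω 2 * F13) + J2 * (ω 0 * F12 - ω 2 * F23)
    + J3 * (ω 0 * F13 + ω 1 * F23))) * hs

end Algebra

section Divergence

variable {A : V → Fin 4 → ℝ} {φ : V → ℂ} {g g' q q' : ℝ → ℝ}

/-- The divergence identity for the weighted `D_L ψ` current. -/
lemma divergence_identity (hA : ContDiff ℝ (⊤ : ℕ∞) A) (hφ : ContDiff ℝ (⊤ : ℕ∞) φ)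
    (hg : ∀ x, HasDerivAt g (g' x) x) (hq : ∀ x, HasDerivAt q (q' x) x)
    (u v : ℝ) {ω : E3} (hω : ‖ω‖ = 1) :
    deriv (fun u => fluxP A φ g q u v ω) u + deriv (fun v => fluxQ A φ g q u v ω) v =
      2 * (pairSum fun i j =>
        deriv (fun s : ℝ => fluxY A φ g q i j u v (ω + s • rotGen i j ω)) 0)
      + srcS A φ g g' q q' u v ω := by
  have hN := hasDerivAt_radD_u hA hφ u v ω
  have hNN := hasDerivAt_ip hN hN
  have hru : HasDerivAt (fun u : ℝ => v - u) (-1) u := (hasDerivAt_id u).const_sub v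
  have hrv : HasDerivAt (fun v : ℝ => v - u) 1 v := (hasDerivAt_id v).sub_const u
  have hqu : HasDerivAt (fun u : ℝ => q (v - u)) (q' (v - u) * -1) u := (hq (v - u)).comp u hru
  have hqv : HasDerivAt (fun v : ℝ => q (v - u)) (q' (v - u) * 1) v := (hq (v - u)).comp v hrv
  have hP := ((hg u).fun_mul ((hru.fun_pow 2).fun_mul hqu)).fun_mul hNN
  have hT := fun i j => hasDerivAt_angD_v hA hφ i j u v ω
  have hTT := fun i j => hasDerivAt_ip (hT i j) (hT i j)
  have hQ := (hqv.const_mul (g u)).fun_mul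
    (((hTT 0 1).fun_add (hTT 0 2)).fun_add (hTT 1 2))
  have hY := fun i j => (hasDerivAt_ip (hasDerivAt_radD_ω hA hφ (u + v) (v - u) ω (rotGen i j ω))
    (hasDerivAt_angD_ω hA hφ i j (u + v) (v - u) ω (rotGen i j ω))).const_mul (g u * q (v - u))
  have eP := HasDerivAt.deriv (f := fun u => fluxP A φ g q u v ω) hP
  have eQ := HasDerivAt.deriv (f := fun v => fluxQ A φ g q u v ω) hQ
  have eY := fun i j => HasDerivAt.deriv
    (f := fun s : ℝ => fluxY A φ g q i j u v (ω + s • rotGen i j ω)) (hY i j)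
  rw [eP, eQ]
  simp only [pairSum, eY, srcS]
  have hW := congrArg (ip (radD A φ (u + v) (v - u) ω))
    (wave_polar hA hφ (pt (u + v) (v - u) ω) (v - u) hω)
  have hK := curvature_terms A φ (u + v) (v - u) hω
  have hC := fun i j => congrArg (fun z => (v - u) ^ 2 * ip (angD A φ i j (u + v) (v - u) ω) z)
    (hessD_comm hA hφ (pt (u + v) (v - u) ω) ω (rotGen i j ω))
  have hC01 := hC 0 1
  have hC02 := hC 0 2
  have hC12 := hC 1 2
  clear hC hY hQ hP hNN hN hTT hT eP eQ eY hqu hqv hru hrv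
  simp only [zero_smul, add_zero]
  simp only [pairSum] at hW hK
  generalize hr : v - u = r at *
  simp only [ip_add_right, ip_sub_right, ip_real_mul_right, ip_real_pow_mul_right,
    ip_two_mul_right, mul_assoc] at hW hK hC01 hC02 hC12 ⊢
  linear_combination 2 * g u * q r * (hW + hK + hC01 + hC02 + hC12)

end Divergence

section ParametricSphere

lemma contDiff_integral_sphM {f : ℝ × ℝ → E3 → ℝ} (hf : ContDiff ℝ 1 (Function.uncurry f)) :
    ContDiff ℝ 1 fun x => ∫ ω, f x ω ∂sphM := by
  set f' : ℝ × ℝ → E3 → (ℝ × ℝ →L[ℝ] ℝ) := fun x ω =>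
    (fderiv ℝ (Function.uncurry f) (x, ω)).comp (ContinuousLinearMap.inl ℝ (ℝ × ℝ) E3) with hf'
  have hc : Continuous (Function.uncurry f') :=
    (hf.continuous_fderiv one_ne_zero).clm_comp continuous_const
  have hd : ∀ x ω, HasFDerivAt (fun x => f x ω) (f' x ω) x := fun x ω =>
    HasFDerivAt.comp (g := Function.uncurry f) (f := fun e => (e, ω)) x
      (hf.differentiable one_ne_zero (x, ω)).hasFDerivAt (hasFDerivAt_prodMk_left x ω)
  have hD : ∀ x₀, HasFDerivAt (fun x => ∫ ω, f x ω ∂sphM) (∫ ω, f' x₀ ω ∂sphM) x₀ := by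
    intro x₀
    obtain ⟨C, hC⟩ := ((isCompact_closedBall x₀ 1).prod
      (isCompact_sphere (0 : E3) 1)).exists_bound_of_continuousOn hc.continuousOn
    refine hasFDerivAt_integral_of_dominated_of_fderiv_le (bound := fun _ => C)
      (F := f) (F' := f') (ball_mem_nhds x₀ one_pos)
      (Filter.Eventually.of_forall fun s => ?_) ?_ ?_ ?_ (integrable_const C) ?_
    · exact (hf.continuous.comp (Continuous.prodMk_right s)).aestronglyMeasurable
    · exact integrable_sphM (hf.continuous.comp (Continuous.prodMk_right x₀))
    · exact (hc.comp (Continuous.prodMk_right x₀)).aestronglyMeasurable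
    · filter_upwards [ae_sphM_norm] with ω hω s hs
      exact hC (s, ω) ⟨ball_subset_closedBall hs, by simpa using hω⟩
    · filter_upwards with ω s _ using hd s ω
  refine contDiff_one_iff_hasFDerivAt.2 ⟨_, ?_, hD⟩
  have := continuous_parametric_integral_of_continuous (μ := sphM) hc
    (isCompact_sphere (0 : E3) 1)
  rwa [sphM_restrict_sphere] at this

end ParametricSphere

section Smoothness

variable {A : V → Fin 4 → ℝ} {φ : V → ℂ} {F : Type*} [NormedAddCommGroup F] [NormedSpace ℝ F]

lemma contDiff_dirD (hA : ContDiff ℝ (⊤ : ℕ∞) A) (hφ : ContDiff ℝ (⊤ : ℕ∞) φ) {X c : F → V}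
    (hX : ContDiff ℝ (⊤ : ℕ∞) X) (hc : ContDiff ℝ (⊤ : ℕ∞) c) :
    ContDiff ℝ (⊤ : ℕ∞) fun z => dirD A (X z) φ (c z) :=
  ContDiff.sum fun μ _ => (Complex.ofRealCLM.contDiff.comp (contDiff_pi.1 hX μ)).mul
    ((contDiff_covD hA hφ μ).comp hc)

lemma contDiff_coord {ω : F → E3} (hω : ContDiff ℝ (⊤ : ℕ∞) ω) (i : Fin 3) :
    ContDiff ℝ (⊤ : ℕ∞) fun z => ω z i :=
  (EuclideanSpace.proj (𝕜 := ℝ) i).contDiff.comp hω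

lemma contDiff_pt {t r : F → ℝ} {ω : F → E3} (ht : ContDiff ℝ (⊤ : ℕ∞) t)
    (hr : ContDiff ℝ (⊤ : ℕ∞) r) (hω : ContDiff ℝ (⊤ : ℕ∞) ω) :
    ContDiff ℝ (⊤ : ℕ∞) fun z => pt (t z) (r z) (ω z) := by
  refine contDiff_pi.2 fun i => ?_
  fin_cases i
  · exact ht
  · exact hr.mul (contDiff_coord hω 0)
  · exact hr.mul (contDiff_coord hω 1)
  · exact hr.mul (contDiff_coord hω 2)

lemma contDiff_outV {ω : F → E3} (hω : ContDiff ℝ (⊤ : ℕ∞) ω) :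
    ContDiff ℝ (⊤ : ℕ∞) fun z => outV (ω z) := by
  refine contDiff_pi.2 fun i => ?_
  fin_cases i
  · exact contDiff_const
  · exact contDiff_coord hω 0
  · exact contDiff_coord hω 1
  · exact contDiff_coord hω 2

lemma contDiff_spV {ω : F → E3} (hω : ContDiff ℝ (⊤ : ℕ∞) ω) :
    ContDiff ℝ (⊤ : ℕ∞) fun z => spV (ω z) := by
  refine contDiff_pi.2 fun i => ?_
  fin_cases i
  · exact contDiff_const
  · exact contDiff_coord hω 0
  · exact contDiff_coord hω 1
  · exact contDiff_coord hω 2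

lemma contDiff_rotGen {ω : F → E3} (hω : ContDiff ℝ (⊤ : ℕ∞) ω) (i j : Fin 3) :
    ContDiff ℝ (⊤ : ℕ∞) fun z => rotGen i j (ω z) :=
  ((contDiff_coord hω i).smul contDiff_const).sub ((contDiff_coord hω j).smul contDiff_const)

lemma contDiff_radD (hA : ContDiff ℝ (⊤ : ℕ∞) A) (hφ : ContDiff ℝ (⊤ : ℕ∞) φ)
    {t r : F → ℝ} {ω : F → E3} (ht : ContDiff ℝ (⊤ : ℕ∞) t)
    (hr : ContDiff ℝ (⊤ : ℕ∞) r) (hω : ContDiff ℝ (⊤ : ℕ∞) ω) :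
    ContDiff ℝ (⊤ : ℕ∞) fun z => radD A φ (t z) (r z) (ω z) :=
  ((Complex.ofRealCLM.contDiff.comp hr).mul
    (contDiff_dirD hA hφ (contDiff_outV hω) (contDiff_pt ht hr hω))).add
    (hφ.comp (contDiff_pt ht hr hω))

lemma contDiff_angD (hA : ContDiff ℝ (⊤ : ℕ∞) A) (hφ : ContDiff ℝ (⊤ : ℕ∞) φ) (i j : Fin 3)
    {t r : F → ℝ} {ω : F → E3} (ht : ContDiff ℝ (⊤ : ℕ∞) t)
    (hr : ContDiff ℝ (⊤ : ℕ∞) r) (hω : ContDiff ℝ (⊤ : ℕ∞) ω) :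
    ContDiff ℝ (⊤ : ℕ∞) fun z => angD A φ i j (t z) (r z) (ω z) :=
  ((Complex.ofRealCLM.contDiff.comp hr).pow 2).mul
    (contDiff_dirD hA hφ (contDiff_spV (contDiff_rotGen hω i j)) (contDiff_pt ht hr hω))

variable {g g' q q' : ℝ → ℝ} {u v : F → ℝ} {ω : F → E3}

lemma contDiff_fluxP (hA : ContDiff ℝ (⊤ : ℕ∞) A) (hφ : ContDiff ℝ (⊤ : ℕ∞) φ)
    (hg : ContDiff ℝ (⊤ : ℕ∞) g) (hq : ContDiff ℝ (⊤ : ℕ∞) q) (hu : ContDiff ℝ (⊤ : ℕ∞) u)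
    (hv : ContDiff ℝ (⊤ : ℕ∞) v) (hω : ContDiff ℝ (⊤ : ℕ∞) ω) :
    ContDiff ℝ (⊤ : ℕ∞) fun z => fluxP A φ g q (u z) (v z) (ω z) :=
  have h := contDiff_radD hA hφ (hu.add hv) (hv.sub hu) hω
  ((hg.comp hu).mul (((hv.sub hu).pow 2).mul (hq.comp (hv.sub hu)))).mul (contDiff_ip h h)

lemma contDiff_fluxQ (hA : ContDiff ℝ (⊤ : ℕ∞) A) (hφ : ContDiff ℝ (⊤ : ℕ∞) φ)
    (hg : ContDiff ℝ (⊤ : ℕ∞) g) (hq : ContDiff ℝ (⊤ : ℕ∞) q) (hu : ContDiff ℝ (⊤ : ℕ∞) u)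
    (hv : ContDiff ℝ (⊤ : ℕ∞) v) (hω : ContDiff ℝ (⊤ : ℕ∞) ω) :
    ContDiff ℝ (⊤ : ℕ∞) fun z => fluxQ A φ g q (u z) (v z) (ω z) :=
  have h := fun i j => contDiff_angD hA hφ i j (hu.add hv) (hv.sub hu) hω
  ((hg.comp hu).mul (hq.comp (hv.sub hu))).mul
    (((contDiff_ip (h 0 1) (h 0 1)).add (contDiff_ip (h 0 2) (h 0 2))).add
      (contDiff_ip (h 1 2) (h 1 2)))

lemma contDiff_fluxY (hA : ContDiff ℝ (⊤ : ℕ∞) A) (hφ : ContDiff ℝ (⊤ : ℕ∞) φ)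
    (hg : ContDiff ℝ (⊤ : ℕ∞) g) (hq : ContDiff ℝ (⊤ : ℕ∞) q) (i j : Fin 3)
    (hu : ContDiff ℝ (⊤ : ℕ∞) u) (hv : ContDiff ℝ (⊤ : ℕ∞) v) (hω : ContDiff ℝ (⊤ : ℕ∞) ω) :
    ContDiff ℝ (⊤ : ℕ∞) fun z => fluxY A φ g q i j (u z) (v z) (ω z) :=
  ((hg.comp hu).mul (hq.comp (hv.sub hu))).mul
    (contDiff_ip (contDiff_radD hA hφ (hu.add hv) (hv.sub hu) hω)
      (contDiff_angD hA hφ i j (hu.add hv) (hv.sub hu) hω))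

lemma continuous_boxA (hA : ContDiff ℝ (⊤ : ℕ∞) A) (hφ : ContDiff ℝ (⊤ : ℕ∞) φ) :
    Continuous (boxA A φ) := by
  refine continuous_finsetSum _ fun μ _ => continuous_const.mul ?_
  exact ((contDiff_pdC (contDiff_covD hA hφ μ) μ).continuous).add
    ((continuous_const.mul (Complex.continuous_ofReal.comp
      (contDiff_component hA μ).continuous)).mul (contDiff_covD hA hφ μ).continuous)

lemma continuous_curv (hA : ContDiff ℝ (⊤ : ℕ∞) A) (μ ν : Fin 4) :
    Continuous fun p => curv A p μ ν := by
  have h : ∀ μ ν, Continuous fun p => pd μ (fun q => A q ν) p := fun μ ν =>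
    ((contDiff_component hA ν).continuous_fderiv (by simp)).clm_apply continuous_const
  exact (h μ ν).sub (h ν μ)

lemma continuous_Jsf (hA : ContDiff ℝ (⊤ : ℕ∞) A) (hφ : ContDiff ℝ (⊤ : ℕ∞) φ) (μ : Fin 4) :
    Continuous fun p => Jsf A φ p μ :=
  Complex.continuous_im.comp
    (hφ.continuous.mul (Complex.continuous_conj.comp (contDiff_covD hA hφ μ).continuous))

lemma continuous_contrFJ (hA : ContDiff ℝ (⊤ : ℕ∞) A) (hφ : ContDiff ℝ (⊤ : ℕ∞) φ)
    {Z : Type*} [TopologicalSpace Z] {c X : Z → V} (hc : Continuous c) (hX : Continuous X) :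
    Continuous fun z => contrFJ A φ (c z) (X z) := by
  refine continuous_finsetSum _ fun ν _ => ?_
  exact (continuous_finsetSum _ fun μ _ => ((continuous_pi_iff.1 hX μ).mul
    ((continuous_curv hA μ ν).comp hc))).mul
    (continuous_const.mul ((continuous_Jsf hA hφ ν).comp hc))

lemma continuous_srcS (hA : ContDiff ℝ (⊤ : ℕ∞) A) (hφ : ContDiff ℝ (⊤ : ℕ∞) φ)
    (hg : Continuous g) (hg' : Continuous g') (hq : Continuous q) (hq' : Continuous q') :
    Continuous fun z : (ℝ × ℝ) × E3 => srcS A φ g g' q q' z.1.1 z.1.2 z.2 := by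
  have hu : ContDiff ℝ (⊤ : ℕ∞) fun z : (ℝ × ℝ) × E3 => z.1.1 := contDiff_fst.fst
  have hv : ContDiff ℝ (⊤ : ℕ∞) fun z : (ℝ × ℝ) × E3 => z.1.2 := contDiff_snd.comp contDiff_fst
  have hω : ContDiff ℝ (⊤ : ℕ∞) fun z : (ℝ × ℝ) × E3 => z.2 := contDiff_snd
  have hN := contDiff_radD hA hφ (hu.add hv) (hv.sub hu) hω
  have hNN := (contDiff_ip hN hN).continuous
  have h := fun i j => contDiff_angD hA hφ i j (hu.add hv) (hv.sub hu) hω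
  have hTT := fun i j => (contDiff_ip (h i j) (h i j)).continuous
  have hp := (contDiff_pt (hu.add hv) (hv.sub hu) hω).continuous
  have hB := (continuous_boxA hA hφ).comp hp
  have hF := continuous_contrFJ hA hφ hp (contDiff_outV hω).continuous
  have hNB : Continuous fun z : (ℝ × ℝ) × E3 => ip (radD A φ (z.1.1 + z.1.2) (z.1.2 - z.1.1) z.2)
      (boxA A φ (pt (z.1.1 + z.1.2) (z.1.2 - z.1.1) z.2)) :=
    ((Complex.continuous_re.comp hN.continuous).mul (Complex.continuous_re.comp hB)).add
      ((Complex.continuous_im.comp hN.continuous).mul (Complex.continuous_im.comp hB))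
  have hTs := ((hTT 0 1).add (hTT 0 2)).add (hTT 1 2)
  unfold srcS pairSum
  fun_prop

end Smoothness

section SphereAverage

variable {A : V → Fin 4 → ℝ} {φ : V → ℂ} {g g' q q' : ℝ → ℝ}

/-- The sphere integral of a density in double null coordinates. -/
def sphAv (f : ℝ → ℝ → E3 → ℝ) (z : ℝ × ℝ) : ℝ := ∫ ω, f z.1 z.2 ω ∂sphM

lemma contDiff_sphAv {f : ℝ → ℝ → E3 → ℝ}
    (hf : ContDiff ℝ (⊤ : ℕ∞) fun z : (ℝ × ℝ) × E3 => f z.1.1 z.1.2 z.2) :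
    ContDiff ℝ 1 (sphAv f) :=
  contDiff_integral_sphM (f := fun z ω => f z.1 z.2 ω)
    (hf.of_le (by simp))

lemma hasDerivAt_sphAv_line {f : ℝ → ℝ → E3 → ℝ}
    (hf : ContDiff ℝ (⊤ : ℕ∞) fun z : (ℝ × ℝ) × E3 => f z.1.1 z.1.2 z.2) (z w : ℝ × ℝ) :
    HasDerivAt (fun s : ℝ => sphAv f (z + s • w))
      (∫ ω, deriv (fun s : ℝ => f (z + s • w).1 (z + s • w).2 ω) 0 ∂sphM) 0 ∧
    Continuous fun ω => deriv (fun s : ℝ => f (z + s • w).1 (z + s • w).2 ω) 0 := by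
  set h : ℝ × E3 → ℝ := fun y => f (z + y.1 • w).1 (z + y.1 • w).2 y.2 with hh
  have hs : ContDiff ℝ (⊤ : ℕ∞) h := by
    have : ContDiff ℝ (⊤ : ℕ∞) fun y : ℝ × E3 => ((z + y.1 • w, y.2) : (ℝ × ℝ) × E3) :=
      (contDiff_const.add (contDiff_fst.smul contDiff_const)).prodMk contDiff_snd
    exact hf.comp this
  have hd : ∀ s ω, HasDerivAt (fun s => h (s, ω)) (fderiv ℝ h (s, ω) (1, 0)) s := by
    intro s ω
    have h1 := (hs.differentiable (by simp) (s, ω)).hasFDerivAt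
    exact h1.comp_hasDerivAt s ((hasDerivAt_id s).prodMk (hasDerivAt_const s ω))
  have hc : Continuous fun y : ℝ × E3 => fderiv ℝ h y (1, 0) :=
    (hs.continuous_fderiv (by simp)).clm_apply continuous_const
  have e : ∀ ω, deriv (fun s : ℝ => f (z + s • w).1 (z + s • w).2 ω) 0 =
    fderiv ℝ h (0, ω) (1, 0) := fun ω => (hd 0 ω).deriv
  simp only [e]
  exact ⟨hasDerivAt_integral_sphM (f := fun s ω => h (s, ω))
    (f' := fun s ω => fderiv ℝ h (s, ω) (1, 0)) hs.continuous hc hd 0,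
    hc.comp (Continuous.prodMk_right 0)⟩

/-- The integrated divergence identity. -/
lemma fderiv_sphAv_flux (hA : ContDiff ℝ (⊤ : ℕ∞) A) (hφ : ContDiff ℝ (⊤ : ℕ∞) φ)
    (hg : ContDiff ℝ (⊤ : ℕ∞) g) (hq : ContDiff ℝ (⊤ : ℕ∞) q)
    (hg' : Continuous g') (hq' : Continuous q')
    (hgd : ∀ x, HasDerivAt g (g' x) x) (hqd : ∀ x, HasDerivAt q (q' x) x) (z : ℝ × ℝ) :
    fderiv ℝ (sphAv (fluxP A φ g q)) z (1, 0) + fderiv ℝ (sphAv (fluxQ A φ g q)) z (0, 1)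
      = sphAv (srcS A φ g g' q q') z := by
  have hu : ContDiff ℝ (⊤ : ℕ∞) fun z : (ℝ × ℝ) × E3 => z.1.1 := contDiff_fst.fst
  have hv : ContDiff ℝ (⊤ : ℕ∞) fun z : (ℝ × ℝ) × E3 => z.1.2 := contDiff_snd.comp contDiff_fst
  have hω : ContDiff ℝ (⊤ : ℕ∞) fun z : (ℝ × ℝ) × E3 => z.2 := contDiff_snd
  have sP := contDiff_fluxP hA hφ hg hq hu hv hω
  have sQ := contDiff_fluxQ hA hφ hg hq hu hv hω
  have key : ∀ {f : ℝ → ℝ → E3 → ℝ},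
      ContDiff ℝ (⊤ : ℕ∞) (fun z : (ℝ × ℝ) × E3 => f z.1.1 z.1.2 z.2) → ∀ w : ℝ × ℝ,
      fderiv ℝ (sphAv f) z w = ∫ ω, deriv (fun s : ℝ => f (z + s • w).1 (z + s • w).2 ω) 0 ∂sphM := by
    intro f hf w
    have h1 := ((contDiff_sphAv hf).differentiable one_ne_zero z).hasFDerivAt
    have h2 : HasDerivAt (fun s : ℝ => z + s • w) w 0 := by
      simpa using ((hasDerivAt_id (0 : ℝ)).smul_const w).const_add z
    have h3 := HasFDerivAt.comp_hasDerivAt_of_eq (0 : ℝ) h1 h2 (by simp)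
    exact h3.unique (hasDerivAt_sphAv_line hf z w).1
  have cP := (hasDerivAt_sphAv_line sP z (1, 0)).2
  have cQ := (hasDerivAt_sphAv_line sQ z (0, 1)).2
  rw [key sP, key sQ, ← integral_add (integrable_sphM cP) (integrable_sphM cQ)]
  have hY : ∀ i j, ContDiff ℝ (⊤ : ℕ∞) (fluxY A φ g q i j z.1 z.2) := fun i j =>
    contDiff_fluxY hA hφ hg hq i j contDiff_const contDiff_const contDiff_id
  have hYd : ∀ i j ω, deriv (fun s : ℝ => fluxY A φ g q i j z.1 z.2 (ω + s • rotGen i j ω)) 0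
      = fderiv ℝ (fluxY A φ g q i j z.1 z.2) ω (rotGen i j ω) := by
    intro i j ω
    have h1 := ((hY i j).differentiable (by simp) ω).hasFDerivAt
    have h2 : HasDerivAt (fun s : ℝ => ω + s • rotGen i j ω) (rotGen i j ω) 0 := by
      simpa using ((hasDerivAt_id (0 : ℝ)).smul_const (rotGen i j ω)).const_add ω
    exact (HasFDerivAt.comp_hasDerivAt_of_eq (0 : ℝ) h1 h2 (by simp)).deriv
  have hYi : ∀ i j, Integrable (fun ω => fderiv ℝ (fluxY A φ g q i j z.1 z.2) ω (rotGen i j ω))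
      sphM := fun i j => integrable_sphM
    (((hY i j).continuous_fderiv (by simp)).clm_apply (continuous_rotGen i j))
  have hS : Integrable (srcS A φ g g' q q' z.1 z.2) sphM := integrable_sphM
    ((continuous_srcS hA hφ hg.continuous hg' hq.continuous hq').comp
      (Continuous.prodMk_right z))
  have hae : ∀ᵐ ω ∂sphM, deriv (fun s : ℝ => fluxP A φ g q (z + s • (1, 0)).1 (z + s • (1, 0)).2 ω) 0
      + deriv (fun s : ℝ => fluxQ A φ g q (z + s • (0, 1)).1 (z + s • (0, 1)).2 ω) 0
      = 2 * (fderiv ℝ (fluxY A φ g q 0 1 z.1 z.2) ω (rotGen 0 1 ω)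
        + fderiv ℝ (fluxY A φ g q 0 2 z.1 z.2) ω (rotGen 0 2 ω)
        + fderiv ℝ (fluxY A φ g q 1 2 z.1 z.2) ω (rotGen 1 2 ω))
      + srcS A φ g g' q q' z.1 z.2 ω := by
    filter_upwards [ae_sphM_norm] with ω hω
    have h := divergence_identity hA hφ hgd hqd z.1 z.2 hω
    simp only [pairSum, hYd] at h
    rw [← h]
    have e1 := deriv_comp_const_add (f := fun u => fluxP A φ g q u z.2 ω) z.1 0
    have e2 := deriv_comp_const_add (f := fun v => fluxQ A φ g q z.1 v ω) z.2 0
    simp only [add_zero] at e1 e2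
    simp [← e1, ← e2]
  rw [integral_congr_ae hae, integral_add _ hS, integral_const_mul, integral_add, integral_add,
    integral_fderiv_rotGen, integral_fderiv_rotGen, integral_fderiv_rotGen]
  · simp [sphAv]
  all_goals first | decide | exact (hY _ _).of_le (by simp) | skip
  all_goals first | exact hYi _ _ | exact (hYi 0 1).add (hYi 0 2) |
    exact (((hYi 0 1).add (hYi 0 2)).add (hYi 1 2)).const_mul 2

end SphereAverage

section Weights

variable {ε p : ℝ}

/-- The bounded factor of the radial weight. -/
def kW (ε p r : ℝ) : ℝ := 1 + (2 - p) / (2 * (1 + ε)) * (1 - (1 + r ^ 2) ^ (-ε / 2))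

/-- The radial weight divided by `r ^ 2`. -/
def qW (ε p r : ℝ) : ℝ := (1 + r ^ 2) ^ (p / 2 - 1) * kW ε p r

/-- The derivative of `qW`. -/
def qW' (ε p r : ℝ) : ℝ :=
  -((2 - p) * r * (1 + r ^ 2) ^ (p / 2 - 2) *
    (kW ε p r - ε / (2 * (1 + ε)) * (1 + r ^ 2) ^ (-ε / 2)))

/-- The total mass of the retarded time density. -/
def massW (ε : ℝ) : ℝ := ∫ s : ℝ, (1 + s ^ 2) ^ (-(1 + ε) / 2)

/-- The bounded decreasing weight in retarded time. -/
def gW (ε u : ℝ) : ℝ := 1 + massW ε - ∫ s in (0 : ℝ)..u, (1 + s ^ 2) ^ (-(1 + ε) / 2)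

lemma one_add_sq_pos (r : ℝ) : 0 < 1 + r ^ 2 := by positivity

lemma contDiff_one_add_sq_rpow (a : ℝ) : ContDiff ℝ (⊤ : ℕ∞) fun r : ℝ => (1 + r ^ 2) ^ a :=
  (contDiff_const.add (contDiff_id.pow 2)).rpow_const_of_ne fun r => (one_add_sq_pos r).ne'

lemma hasDerivAt_one_add_sq_rpow (a r : ℝ) :
    HasDerivAt (fun r : ℝ => (1 + r ^ 2) ^ a) (2 * a * r * (1 + r ^ 2) ^ (a - 1)) r := by
  have h : HasDerivAt (fun r : ℝ => 1 + r ^ 2) (2 * r) r := by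
    simpa using ((hasDerivAt_id r).fun_pow 2).const_add 1
  exact (h.rpow_const (Or.inl (one_add_sq_pos r).ne')).congr_deriv (by ring)

lemma contDiff_kW : ContDiff ℝ (⊤ : ℕ∞) (kW ε p) :=
  contDiff_const.add (contDiff_const.mul (contDiff_const.sub (contDiff_one_add_sq_rpow _)))

lemma contDiff_qW : ContDiff ℝ (⊤ : ℕ∞) (qW ε p) :=
  (contDiff_one_add_sq_rpow _).mul contDiff_kW

lemma continuous_qW' : Continuous (qW' ε p) :=
  (((continuous_const.mul continuous_id).mul (contDiff_one_add_sq_rpow _).continuous).mul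
    (contDiff_kW.continuous.sub
      (continuous_const.mul (contDiff_one_add_sq_rpow _).continuous))).neg

lemma hasDerivAt_qW (hε : 0 < ε) (r : ℝ) : HasDerivAt (qW ε p) (qW' ε p r) r := by
  have h := (hasDerivAt_one_add_sq_rpow (p / 2 - 1) r).fun_mul
    ((((hasDerivAt_one_add_sq_rpow (-ε / 2) r).const_sub 1).const_mul
      ((2 - p) / (2 * (1 + ε)))).const_add 1)
  refine h.congr_deriv ?_
  have hs := one_add_sq_pos r
  have e1 : (1 + r ^ 2) ^ (p / 2 - 1 - 1) = (1 + r ^ 2) ^ (p / 2 - 2) := by congr 1; ring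
  have e2 : (1 + r ^ 2) ^ (p / 2 - 1) = (1 + r ^ 2) ^ (p / 2 - 2) * (1 + r ^ 2) := by
    rw [← Real.rpow_add_one hs.ne']; congr 1; ring
  have e3 : (1 + r ^ 2) ^ (-ε / 2) = (1 + r ^ 2) ^ (-ε / 2 - 1) * (1 + r ^ 2) := by
    rw [← Real.rpow_add_one hs.ne']; congr 1; ring
  rw [qW', kW, e1, e2, e3]
  field_simp
  ring

lemma rpow_neg_half_mem (hε : 0 < ε) (r : ℝ) :
    0 < (1 + r ^ 2) ^ (-ε / 2) ∧ (1 + r ^ 2) ^ (-ε / 2) ≤ 1 :=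
  ⟨Real.rpow_pos_of_pos (one_add_sq_pos r) _,
    Real.rpow_le_one_of_one_le_of_nonpos (by nlinarith [sq_nonneg r]) (by linarith)⟩

lemma kW_mem (hε : 0 < ε) (hp : 0 ≤ p) (hp2 : p ≤ 2) (r : ℝ) : 1 ≤ kW ε p r ∧ kW ε p r ≤ 2 := by
  obtain ⟨h0, h1⟩ := rpow_neg_half_mem hε r
  have hc : 0 ≤ (2 - p) / (2 * (1 + ε)) := div_nonneg (by linarith) (by linarith)
  have hc1 : (2 - p) / (2 * (1 + ε)) ≤ 1 := by rw [div_le_one (by linarith)]; linarith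
  unfold kW
  constructor <;> nlinarith

lemma eps_ratio_mem (hε : 0 < ε) : 0 < ε / (2 * (1 + ε)) ∧ ε / (2 * (1 + ε)) ≤ 1 / 2 := by
  refine ⟨by positivity, ?_⟩
  rw [div_le_div_iff₀ (by positivity) (by positivity)]; linarith

lemma qW_nonneg (hε : 0 < ε) (hp : 0 ≤ p) (hp2 : p ≤ 2) (r : ℝ) : 0 ≤ qW ε p r :=
  mul_nonneg (Real.rpow_nonneg (one_add_sq_pos r).le _) (by linarith [(kW_mem hε hp hp2 r).1])

lemma qW_le_two (hε : 0 < ε) (hp : 0 ≤ p) (hp2 : p ≤ 2) (r : ℝ) : qW ε p r ≤ 2 := by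
  have h1 : (1 + r ^ 2) ^ (p / 2 - 1) ≤ 1 :=
    Real.rpow_le_one_of_one_le_of_nonpos (by nlinarith [sq_nonneg r]) (by linarith)
  have h0 : 0 ≤ (1 + r ^ 2) ^ (p / 2 - 1) := Real.rpow_nonneg (one_add_sq_pos r).le _
  obtain ⟨h2, h3⟩ := kW_mem hε hp hp2 r
  unfold qW
  nlinarith

/-- Two-sided comparison of powers of `1 + r ^ 2` and of `r`. -/
lemma rpow_one_add_sq_bounds {r a : ℝ} (hr : 1 ≤ r) (ha : a ≤ 0) :
    (2 : ℝ) ^ a * r ^ (2 * a) ≤ (1 + r ^ 2) ^ a ∧ (1 + r ^ 2) ^ a ≤ r ^ (2 * a) := by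
  have hr0 : 0 < r := by linarith
  have e : r ^ (2 * a) = (r ^ 2) ^ a := by
    rw [← Real.rpow_natCast r 2, ← Real.rpow_mul hr0.le]; norm_num
  rw [e, ← Real.mul_rpow (by norm_num) (by positivity)]
  exact ⟨Real.rpow_le_rpow_of_nonpos (by positivity) (by nlinarith) ha,
    Real.rpow_le_rpow_of_nonpos (by positivity) (by linarith) ha⟩

lemma sq_mul_qW_bounds (hε : 0 < ε) (hp : 0 ≤ p) (hp2 : p ≤ 2) {r : ℝ} (hr : 1 ≤ r) :
    r ^ p ≤ 2 * (r ^ 2 * qW ε p r) ∧ r ^ 2 * qW ε p r ≤ 2 * r ^ p := by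
  have hr0 : 0 < r := by linarith
  obtain ⟨h1, h2⟩ := rpow_one_add_sq_bounds (a := p / 2 - 1) hr (by linarith)
  obtain ⟨k1, k2⟩ := kW_mem hε hp hp2 r
  have e : r ^ p = r ^ 2 * r ^ (2 * (p / 2 - 1)) := by
    rw [← Real.rpow_natCast r 2, ← Real.rpow_add hr0]; congr 1; push_cast; ring
  have h3 : (1 / 2 : ℝ) ≤ 2 ^ (p / 2 - 1) := by
    calc (1 / 2 : ℝ) = 2 ^ (-1 : ℝ) := by rw [Real.rpow_neg_one]; norm_num
      _ ≤ _ := Real.rpow_le_rpow_of_exponent_le (by norm_num) (by linarith)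
  have hx : 0 < r ^ (2 * (p / 2 - 1)) := Real.rpow_pos_of_pos hr0 _
  set x := r ^ (2 * (p / 2 - 1))
  set y := (1 + r ^ 2) ^ (p / 2 - 1) with hy
  have hy1 : x / 2 ≤ y := by nlinarith
  have hq : qW ε p r = y * kW ε p r := rfl
  rw [e, hq]
  have hr2 : 0 < r ^ 2 := by positivity
  constructor
  · have : x / 2 ≤ y * kW ε p r := by nlinarith
    nlinarith
  · have : y * kW ε p r ≤ 2 * x := by nlinarith
    nlinarith

lemma qW'_nonpos (hε : 0 < ε) (hp : 0 ≤ p) (hp2 : p ≤ 2) {r : ℝ} (hr : 0 ≤ r) :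
    qW' ε p r ≤ 0 := by
  obtain ⟨k1, k2⟩ := kW_mem hε hp hp2 r
  obtain ⟨h0, h1⟩ := rpow_neg_half_mem hε r
  obtain ⟨c0, c1⟩ := eps_ratio_mem hε
  have : 0 ≤ kW ε p r - ε / (2 * (1 + ε)) * (1 + r ^ 2) ^ (-ε / 2) := by nlinarith
  have h2 : 0 ≤ (1 + r ^ 2) ^ (p / 2 - 2) := Real.rpow_nonneg (one_add_sq_pos r).le _
  have h3 : 0 ≤ 2 - p := by linarith
  rw [qW', neg_nonpos]
  positivity

lemma qW'_lower (hε : 0 < ε) (hp : 0 ≤ p) (hp2 : p ≤ 2) {r : ℝ} (hr : 1 ≤ r) :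
    (2 - p) * r ^ (p - 1) ≤ 8 * (r ^ 2 * -qW' ε p r) := by
  have hr0 : 0 < r := by linarith
  obtain ⟨h1, -⟩ := rpow_one_add_sq_bounds (a := p / 2 - 2) hr (by linarith)
  obtain ⟨k1, k2⟩ := kW_mem hε hp hp2 r
  obtain ⟨l0, l1⟩ := rpow_neg_half_mem hε r
  obtain ⟨c0, c1⟩ := eps_ratio_mem hε
  have e : r ^ (p - 1) = r ^ 3 * r ^ (2 * (p / 2 - 2)) := by
    rw [← Real.rpow_natCast r 3, ← Real.rpow_add hr0]; congr 1; push_cast; ring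
  have h3 : (1 / 4 : ℝ) ≤ 2 ^ (p / 2 - 2) := by
    calc (1 / 4 : ℝ) = 2 ^ (-2 : ℝ) := by rw [Real.rpow_neg (by norm_num)]; norm_num
      _ ≤ _ := Real.rpow_le_rpow_of_exponent_le (by norm_num) (by linarith)
  have hx : 0 < r ^ (2 * (p / 2 - 2)) := Real.rpow_pos_of_pos hr0 _
  rw [qW', e]
  set x := r ^ (2 * (p / 2 - 2))
  set y := (1 + r ^ 2) ^ (p / 2 - 2) with hy
  set b := kW ε p r - ε / (2 * (1 + ε)) * (1 + r ^ 2) ^ (-ε / 2)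
  have hb : 1 / 2 ≤ b := by simp only [b]; nlinarith
  have hy1 : x / 4 ≤ y := by nlinarith
  have hyb : x / 8 ≤ y * b := by nlinarith
  have h5 : 0 ≤ (2 - p) * r ^ 3 := mul_nonneg (by linarith) (by positivity)
  calc (2 - p) * (r ^ 3 * x) = 8 * ((2 - p) * r ^ 3 * (x / 8)) := by ring
    _ ≤ 8 * ((2 - p) * r ^ 3 * (y * b)) := by gcongr
    _ = _ := by ring

/-- The derivative of the radial weight. -/
lemma deriv_weight_eq (r : ℝ) :
    2 * r * qW ε p r + r ^ 2 * qW' ε p r = r * (1 + r ^ 2) ^ (p / 2 - 2) *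
      ((2 + p * r ^ 2) * kW ε p r
        + (2 - p) * (ε / (2 * (1 + ε))) * (r ^ 2 * (1 + r ^ 2) ^ (-ε / 2))) := by
  have hs := one_add_sq_pos r
  have e2 : (1 + r ^ 2) ^ (p / 2 - 1) = (1 + r ^ 2) ^ (p / 2 - 2) * (1 + r ^ 2) := by
    rw [← Real.rpow_add_one hs.ne']; congr 1; ring
  rw [qW, qW', e2]
  ring

lemma deriv_weight_lower (hε : 0 < ε) (hp : 0 ≤ p) (hp2 : p ≤ 2) {r : ℝ} (hr : 0 ≤ r) :
    r * (1 + r ^ 2) ^ (p / 2 - 1) * p ≤ 2 * r * qW ε p r + r ^ 2 * qW' ε p r ∧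
    2 * (ε / (2 * (1 + ε))) * (r * (1 + r ^ 2) ^ (p / 2 - 1 - ε / 2)) ≤
      2 * r * qW ε p r + r ^ 2 * qW' ε p r := by
  have hs := one_add_sq_pos r
  obtain ⟨k1, k2⟩ := kW_mem hε hp hp2 r
  obtain ⟨l0, l1⟩ := rpow_neg_half_mem hε r
  obtain ⟨c0, c1⟩ := eps_ratio_mem hε
  rw [deriv_weight_eq]
  have e2 : (1 + r ^ 2) ^ (p / 2 - 1) = (1 + r ^ 2) ^ (p / 2 - 2) * (1 + r ^ 2) := by
    rw [← Real.rpow_add_one hs.ne']; congr 1; ring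
  have e3 : (1 + r ^ 2) ^ (p / 2 - 1 - ε / 2) =
      (1 + r ^ 2) ^ (p / 2 - 2) * ((1 + r ^ 2) * (1 + r ^ 2) ^ (-ε / 2)) := by
    rw [← mul_assoc, ← e2, ← Real.rpow_add hs]; congr 1; ring
  have hy : 0 ≤ r * (1 + r ^ 2) ^ (p / 2 - 2) :=
    mul_nonneg hr (Real.rpow_nonneg hs.le _)
  rw [e2, e3]
  set y := (1 + r ^ 2) ^ (p / 2 - 2)
  set σ := (1 + r ^ 2) ^ (-ε / 2)
  set c := ε / (2 * (1 + ε))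
  set k := kW ε p r
  have hA : 2 + p * r ^ 2 ≤ (2 + p * r ^ 2) * k := le_mul_of_one_le_right (by positivity) k1
  have hB : 0 ≤ (2 - p) * c * (r ^ 2 * σ) :=
    mul_nonneg (mul_nonneg (by linarith) c0.le) (by positivity)
  constructor
  · calc r * (y * (1 + r ^ 2)) * p = r * y * ((1 + r ^ 2) * p) := by ring
      _ ≤ _ := by gcongr; linarith
  · calc 2 * c * (r * (y * ((1 + r ^ 2) * σ))) = r * y * (2 * c * ((1 + r ^ 2) * σ)) := by ring
      _ ≤ _ := by
        gcongr
        have h1 : c * σ ≤ 1 := by nlinarith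
        have h2 : 0 ≤ p * r ^ 2 := by positivity
        nlinarith

lemma deriv_weight_lower_rpow (hε : 0 < ε) (hp : 0 ≤ p) (hp2 : p ≤ 2) {r : ℝ} (hr : 1 ≤ r) :
    p * r ^ (p - 1) ≤ 2 * (2 * r * qW ε p r + r ^ 2 * qW' ε p r) := by
  have hr0 : 0 < r := by linarith
  have h := (deriv_weight_lower hε hp hp2 hr0.le).1
  obtain ⟨h1, -⟩ := rpow_one_add_sq_bounds (a := p / 2 - 1) hr (by linarith)
  have e : r ^ (p - 1) = r * r ^ (2 * (p / 2 - 1)) := by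
    rw [mul_comm, ← Real.rpow_add_one hr0.ne']; congr 1; ring
  have h3 : (1 / 2 : ℝ) ≤ 2 ^ (p / 2 - 1) := by
    calc (1 / 2 : ℝ) = 2 ^ (-1 : ℝ) := by rw [Real.rpow_neg_one]; norm_num
      _ ≤ _ := Real.rpow_le_rpow_of_exponent_le (by norm_num) (by linarith)
  have hx : 0 < r ^ (2 * (p / 2 - 1)) := Real.rpow_pos_of_pos hr0 _
  have hy1 : r ^ (2 * (p / 2 - 1)) / 2 ≤ (1 + r ^ 2) ^ (p / 2 - 1) := by nlinarith
  rw [e]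
  refine le_trans ?_ (mul_le_mul_of_nonneg_left h zero_le_two)
  have : 0 ≤ p * r := by positivity
  nlinarith

end Weights

section TimeWeight

variable {ε : ℝ}

lemma integrable_time_density (hε : 0 < ε) :
    Integrable fun s : ℝ => (1 + s ^ 2) ^ (-(1 + ε) / 2) := by
  have := integrable_rpow_neg_one_add_norm_sq (E := ℝ) (μ := volume) (r := 1 + ε) (by simp [hε])
  simpa using this

lemma continuous_time_density : Continuous fun s : ℝ => (1 + s ^ 2) ^ (-(1 + ε) / 2) :=
  (contDiff_one_add_sq_rpow _).continuous

lemma hasDerivAt_gW (u : ℝ) : HasDerivAt (gW ε) (-(1 + u ^ 2) ^ (-(1 + ε) / 2)) u :=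
  (continuous_time_density.integral_hasStrictDerivAt 0 u).hasDerivAt.const_sub _

lemma contDiff_gW : ContDiff ℝ (⊤ : ℕ∞) (gW ε) := by
  refine contDiff_infty_iff_deriv.2 ⟨fun u => (hasDerivAt_gW u).differentiableAt, ?_⟩
  rw [show deriv (gW ε) = fun u => -(1 + u ^ 2) ^ (-(1 + ε) / 2) from
    funext fun u => (hasDerivAt_gW u).deriv]
  exact (contDiff_one_add_sq_rpow _).neg

lemma gW_mem (hε : 0 < ε) (u : ℝ) : 1 ≤ gW ε u ∧ gW ε u ≤ 1 + 2 * massW ε := by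
  have h : |∫ s in (0 : ℝ)..u, (1 + s ^ 2) ^ (-(1 + ε) / 2)| ≤ massW ε := by
    rw [← Real.norm_eq_abs, intervalIntegral.norm_intervalIntegral_eq]
    have h0 : ∀ s : ℝ, 0 ≤ (1 + s ^ 2) ^ (-(1 + ε) / 2) :=
      fun s => Real.rpow_nonneg (one_add_sq_pos s).le _
    rw [Real.norm_of_nonneg (integral_nonneg h0)]
    exact setIntegral_le_integral (integrable_time_density hε) (ae_of_all _ h0)
  rw [abs_le] at h
  unfold gW
  constructor <;> linarith

lemma massW_nonneg : 0 ≤ massW ε := integral_nonneg fun s => Real.rpow_nonneg (one_add_sq_pos s).le _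

end TimeWeight

section Source

variable {ε p : ℝ}

/-- The weight controlling the inhomogeneity. -/
def srcW (ε p u r : ℝ) : ℝ :=
  4 * (1 + 2 * massW ε) ^ 2 / (ε / (2 * (1 + ε))) *
    ((1 + |u|) ^ min (1 + ε) p * (1 + r) ^ max (1 + ε) p)

set_option maxHeartbeats 1000000 in
lemma source_weight_le (hε : 0 < ε) (hp : 0 ≤ p) (hp2 : p ≤ 2) (u : ℝ) {r : ℝ} (hr : 0 ≤ r) :
    2 * (gW ε u * (r ^ 2 * qW ε p r)) ^ 2 ≤
      ((1 + u ^ 2) ^ (-(1 + ε) / 2) * (r ^ 2 * qW ε p r)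
        + gW ε u * (2 * r * qW ε p r + r ^ 2 * qW' ε p r)) * srcW ε p u r := by
  obtain ⟨g1, g2⟩ := gW_mem hε u
  obtain ⟨k1, k2⟩ := kW_mem hε hp hp2 r
  obtain ⟨c0, c1⟩ := eps_ratio_mem hε
  obtain ⟨d1, d2⟩ := deriv_weight_lower hε hp hp2 hr
  have hs := one_add_sq_pos r
  have hG := massW_nonneg (ε := ε)
  have hq := qW_nonneg hε hp hp2 r
  set G := 1 + 2 * massW ε with hGdef
  set c := ε / (2 * (1 + ε))
  set h' := 2 * r * qW ε p r + r ^ 2 * qW' ε p r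
  have hh' : 0 ≤ h' := le_trans (by positivity) d1
  set h := r ^ 2 * qW ε p r with hh
  have hh0 : 0 ≤ h := by positivity
  set X := 1 + r with hX
  set U := 1 + |u| with hU
  have hX1 : 1 ≤ X := by linarith
  have hU1 : 1 ≤ U := by linarith [abs_nonneg u]
  have hsX : ∀ b : ℝ, 0 ≤ b → (1 + r ^ 2) ^ b ≤ X ^ (2 * b) := by
    intro b hb
    rw [Real.rpow_mul (by linarith)]
    exact Real.rpow_le_rpow hs.le (by norm_num; nlinarith) hb
  set D := (1 + u ^ 2) ^ (-(1 + ε) / 2) with hD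
  have hDU : 1 ≤ D * U ^ (1 + ε) := by
    have h1 : (1 + u ^ 2) ^ ((1 + ε) / 2) ≤ U ^ (1 + ε) := by
      have : U ^ (1 + ε) = (U ^ (2 : ℝ)) ^ ((1 + ε) / 2) := by
        rw [← Real.rpow_mul (by linarith)]; congr 1; ring
      rw [this]
      refine Real.rpow_le_rpow (one_add_sq_pos u).le ?_ (by linarith)
      norm_num
      nlinarith [abs_nonneg u, sq_abs u]
    calc (1 : ℝ) = D * (1 + u ^ 2) ^ ((1 + ε) / 2) := by
          rw [hD, ← Real.rpow_add (one_add_sq_pos u)]; ring_nf; simp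
      _ ≤ _ := by gcongr
  have hD0 : 0 < D := Real.rpow_pos_of_pos (one_add_sq_pos u) _
  have hgG : (gW ε u) ^ 2 ≤ G ^ 2 := by gcongr
  have hlhs : 2 * (gW ε u * h) ^ 2 ≤ 2 * G ^ 2 * h ^ 2 := by
    rw [mul_pow, ← mul_assoc]; gcongr
  have hW : srcW ε p u r = 4 * G ^ 2 / c * (U ^ min (1 + ε) p * X ^ max (1 + ε) p) := rfl
  set Z := U ^ min (1 + ε) p * X ^ max (1 + ε) p with hZ
  have hZ0 : 0 < Z := by positivity
  have hbig : 4 * G ^ 2 * Z ≤ srcW ε p u r := by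
    rw [hW, div_mul_eq_mul_div, le_div_iff₀ c0]
    exact mul_le_of_le_one_right (by positivity) (by linarith)
  have hW0 : 0 ≤ srcW ε p u r := le_trans (by positivity) hbig
  have caseA : X ^ p * U ^ (1 + ε) ≤ Z → 2 * (gW ε u * h) ^ 2 ≤
      (D * h + gW ε u * h') * srcW ε p u r := by
    intro hA
    have hhX : h ≤ 2 * X ^ p := by
      have h1 : r ^ 2 * (1 + r ^ 2) ^ (p / 2 - 1) ≤ X ^ p := by
        calc r ^ 2 * (1 + r ^ 2) ^ (p / 2 - 1) ≤ (1 + r ^ 2) * (1 + r ^ 2) ^ (p / 2 - 1) := by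
              gcongr; linarith
          _ = (1 + r ^ 2) ^ (p / 2) := by
              rw [mul_comm, ← Real.rpow_add_one hs.ne']; congr 1; ring
          _ ≤ X ^ (2 * (p / 2)) := hsX _ (by linarith)
          _ = X ^ p := by congr 1; ring
      have h2 : h = r ^ 2 * (1 + r ^ 2) ^ (p / 2 - 1) * kW ε p r := by rw [hh, qW]; ring
      rw [h2]
      have h3 : 0 ≤ r ^ 2 * (1 + r ^ 2) ^ (p / 2 - 1) := by positivity
      nlinarith
    calc 2 * (gW ε u * h) ^ 2 ≤ 2 * G ^ 2 * h ^ 2 := hlhs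
      _ = h * (2 * G ^ 2 * h) * 1 := by ring
      _ ≤ h * (2 * G ^ 2 * (2 * X ^ p)) * (D * U ^ (1 + ε)) := by gcongr
      _ = D * h * (4 * G ^ 2 * (X ^ p * U ^ (1 + ε))) := by ring
      _ ≤ D * h * (4 * G ^ 2 * Z) := by gcongr
      _ ≤ D * h * srcW ε p u r := by gcongr
      _ ≤ _ := by gcongr; nlinarith
  rcases le_or_gt (1 + ε) p with hpe | hpe
  · refine caseA (le_of_eq ?_)
    rw [hZ, min_eq_left hpe, max_eq_right hpe, mul_comm]
  · rw [min_eq_right hpe.le, max_eq_left hpe.le] at hZ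
    rcases le_or_gt U X with hUX | hUX
    · refine caseA ?_
      have e1 : U ^ (1 + ε) = U ^ p * U ^ (1 + ε - p) := by
        rw [← Real.rpow_add (by linarith)]; congr 1; ring
      have e2 : X ^ (1 + ε) = X ^ p * X ^ (1 + ε - p) := by
        rw [← Real.rpow_add (by linarith)]; congr 1; ring
      rw [hZ, e1, e2]
      have : U ^ (1 + ε - p) ≤ X ^ (1 + ε - p) := Real.rpow_le_rpow (by linarith) hUX (by linarith)
      calc X ^ p * (U ^ p * U ^ (1 + ε - p)) ≤ X ^ p * (U ^ p * X ^ (1 + ε - p)) := by gcongr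
        _ = _ := by ring
    · have hr3 : r ^ 3 ≤ (1 + r ^ 2) ^ (3 / 2 : ℝ) := by
        have : r ^ 3 = (r ^ 2) ^ (3 / 2 : ℝ) := by
          rw [← Real.rpow_natCast r 2, ← Real.rpow_mul hr, ← Real.rpow_natCast r 3]; norm_num
        rw [this]
        exact Real.rpow_le_rpow (by positivity) (by linarith) (by norm_num)
      have hmain : r ^ 3 * (1 + r ^ 2) ^ (p / 2 - 1 + ε / 2) ≤ Z := by
        calc r ^ 3 * (1 + r ^ 2) ^ (p / 2 - 1 + ε / 2)
            ≤ (1 + r ^ 2) ^ (3 / 2 : ℝ) * (1 + r ^ 2) ^ (p / 2 - 1 + ε / 2) := by gcongr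
          _ = (1 + r ^ 2) ^ ((p + 1 + ε) / 2) := by rw [← Real.rpow_add hs]; congr 1; ring
          _ ≤ X ^ (2 * ((p + 1 + ε) / 2)) := hsX _ (by linarith)
          _ = X ^ p * X ^ (1 + ε) := by rw [← Real.rpow_add (by linarith)]; congr 1; ring
          _ ≤ U ^ p * X ^ (1 + ε) := by gcongr
          _ = Z := hZ.symm
      have hh2 : h ^ 2 ≤ 4 * r ^ 4 * ((1 + r ^ 2) ^ (p / 2 - 1)) ^ 2 := by
        have h2 : h = r ^ 2 * (1 + r ^ 2) ^ (p / 2 - 1) * kW ε p r := by rw [hh, qW]; ring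
        have h3 : (kW ε p r) ^ 2 ≤ 4 := by nlinarith
        rw [h2]
        have h4 : 0 ≤ (r ^ 2 * (1 + r ^ 2) ^ (p / 2 - 1)) ^ 2 := by positivity
        nlinarith
      have e5 : ((1 + r ^ 2) ^ (p / 2 - 1)) ^ 2 =
          (1 + r ^ 2) ^ (p / 2 - 1 - ε / 2) * (1 + r ^ 2) ^ (p / 2 - 1 + ε / 2) := by
        rw [← Real.rpow_add hs, sq, ← Real.rpow_add hs]; congr 1; ring
      calc 2 * (gW ε u * h) ^ 2 ≤ 2 * G ^ 2 * h ^ 2 := hlhs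
        _ ≤ 2 * G ^ 2 * (4 * r ^ 4 * ((1 + r ^ 2) ^ (p / 2 - 1)) ^ 2) := by gcongr
        _ = 2 * c * (r * (1 + r ^ 2) ^ (p / 2 - 1 - ε / 2)) *
            (4 * G ^ 2 / c * (r ^ 3 * (1 + r ^ 2) ^ (p / 2 - 1 + ε / 2))) := by
          rw [e5]; field_simp
        _ ≤ h' * (4 * G ^ 2 / c * Z) := by gcongr
        _ = h' * srcW ε p u r := by rw [hW]
        _ ≤ _ := by gcongr; nlinarith [mul_nonneg hD0.le hh0]

end Source

section PlaneIdentities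

variable {P Q S : ℝ × ℝ → ℝ}

lemma hasDerivAt_comp_plane (hP : ContDiff ℝ 1 P) {c d : ℝ → ℝ} {c' d' x : ℝ}
    (hc : HasDerivAt c c' x) (hd : HasDerivAt d d' x) :
    HasDerivAt (fun x => P (c x, d x))
      (c' * fderiv ℝ P (c x, d x) (1, 0) + d' * fderiv ℝ P (c x, d x) (0, 1)) x := by
  have h := (hP.differentiable one_ne_zero (c x, d x)).hasFDerivAt.comp_hasDerivAt x (hc.prodMk hd)
  refine h.congr_deriv ?_
  have e : ((c', d') : ℝ × ℝ) = c' • (1, 0) + d' • (0, 1) := by simp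
  rw [e, map_add, map_smul, map_smul, smul_eq_mul, smul_eq_mul]

/-- The divergence theorem on a rectangle in terms of partial derivatives. -/
lemma integral_rect_divergence {a b a₁ b₂ : ℝ × ℝ → ℝ} (ha : ContDiff ℝ 1 a) (hb : ContDiff ℝ 1 b)
    (ha₁ : ∀ x y, HasDerivAt (fun x => a (x, y)) (a₁ (x, y)) x)
    (hb₂ : ∀ x y, HasDerivAt (fun y => b (x, y)) (b₂ (x, y)) y) (x₁ x₂ y₁ y₂ : ℝ) :
    ∫ x in x₁..x₂, ∫ y in y₁..y₂, a₁ (x, y) + b₂ (x, y) =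
      (∫ x in x₁..x₂, b (x, y₂)) - (∫ x in x₁..x₂, b (x, y₁)) + (∫ y in y₁..y₂, a (x₂, y))
        - ∫ y in y₁..y₂, a (x₁, y) := by
  have e1 : ∀ z, a₁ z = fderiv ℝ a z (1, 0) := fun z => (ha₁ z.1 z.2).unique <| by
    simpa using hasDerivAt_comp_plane ha (hasDerivAt_id z.1) (hasDerivAt_const z.1 z.2)
  have e2 : ∀ z, b₂ z = fderiv ℝ b z (0, 1) := fun z => (hb₂ z.1 z.2).unique <| by
    simpa using hasDerivAt_comp_plane hb (hasDerivAt_const z.2 z.1) (hasDerivAt_id z.2)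
  simp only [e1, e2]
  refine integral2_divergence_prod_of_hasFDerivAt a b (fderiv ℝ a) (fderiv ℝ b) x₁ y₁ x₂ y₂
    ha.continuous.continuousOn hb.continuous.continuousOn
    (fun z _ => (ha.differentiable one_ne_zero z).hasFDerivAt)
    (fun z _ => (hb.differentiable one_ne_zero z).hasFDerivAt) ?_
  have hc : Continuous fun z => fderiv ℝ a z (1, 0) + fderiv ℝ b z (0, 1) :=
    ((ha.continuous_fderiv one_ne_zero).clm_apply continuous_const).add
      ((hb.continuous_fderiv one_ne_zero).clm_apply continuous_const)
  exact hc.continuousOn.integrableOn_compact (isCompact_uIcc.prod isCompact_uIcc)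

/-- The flux identity in a cylinder `{ρ₁ ≤ r ≤ ρ₂, τ₁ ≤ t ≤ τ₂}`. -/
lemma cylinder_identity (hP : ContDiff ℝ 1 P) (hQ : ContDiff ℝ 1 Q)
    (hS : ∀ z, fderiv ℝ P z (1, 0) + fderiv ℝ Q z (0, 1) = S z) (τ₁ τ₂ ρ₁ ρ₂ : ℝ) :
    ∫ t in τ₁..τ₂, ∫ r in ρ₁..ρ₂, S ((t - r) / 2, (t + r) / 2) =
      (∫ t in τ₁..τ₂, (Q ((t - ρ₂) / 2, (t + ρ₂) / 2) - P ((t - ρ₂) / 2, (t + ρ₂) / 2)))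
      - (∫ t in τ₁..τ₂, (Q ((t - ρ₁) / 2, (t + ρ₁) / 2) - P ((t - ρ₁) / 2, (t + ρ₁) / 2)))
      + (∫ r in ρ₁..ρ₂, (P ((τ₂ - r) / 2, (τ₂ + r) / 2) + Q ((τ₂ - r) / 2, (τ₂ + r) / 2)))
      - ∫ r in ρ₁..ρ₂, (P ((τ₁ - r) / 2, (τ₁ + r) / 2) + Q ((τ₁ - r) / 2, (τ₁ + r) / 2)) := by
  have hL : ContDiff ℝ 1 fun z : ℝ × ℝ => ((z.1 - z.2) / 2, (z.1 + z.2) / 2) := by fun_prop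
  have h1 : ∀ x y : ℝ, HasDerivAt (fun x => (x - y) / 2) (1 / 2) x := fun x y => by
    simpa using ((hasDerivAt_id x).sub_const y).div_const 2
  have h2 : ∀ x y : ℝ, HasDerivAt (fun x => (x + y) / 2) (1 / 2) x := fun x y => by
    simpa using ((hasDerivAt_id x).add_const y).div_const 2
  have h3 : ∀ x y : ℝ, HasDerivAt (fun y => (x - y) / 2) (-1 / 2) y := fun x y => by
    simpa using ((hasDerivAt_id y).const_sub x).div_const 2
  have h4 : ∀ x y : ℝ, HasDerivAt (fun y => (x + y) / 2) (1 / 2) y := fun x y => by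
    simpa using ((hasDerivAt_id y).const_add x).div_const 2
  have key := integral_rect_divergence (((hP.comp hL).add (hQ.comp hL)))
    ((hQ.comp hL).sub (hP.comp hL))
    (a₁ := fun z => (1 / 2 * fderiv ℝ P ((z.1 - z.2) / 2, (z.1 + z.2) / 2) (1, 0)
        + 1 / 2 * fderiv ℝ P ((z.1 - z.2) / 2, (z.1 + z.2) / 2) (0, 1))
      + (1 / 2 * fderiv ℝ Q ((z.1 - z.2) / 2, (z.1 + z.2) / 2) (1, 0)
        + 1 / 2 * fderiv ℝ Q ((z.1 - z.2) / 2, (z.1 + z.2) / 2) (0, 1)))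
    (b₂ := fun z => (-1 / 2 * fderiv ℝ Q ((z.1 - z.2) / 2, (z.1 + z.2) / 2) (1, 0)
        + 1 / 2 * fderiv ℝ Q ((z.1 - z.2) / 2, (z.1 + z.2) / 2) (0, 1))
      - (-1 / 2 * fderiv ℝ P ((z.1 - z.2) / 2, (z.1 + z.2) / 2) (1, 0)
        + 1 / 2 * fderiv ℝ P ((z.1 - z.2) / 2, (z.1 + z.2) / 2) (0, 1)))
    (fun x y => (hasDerivAt_comp_plane hP (h1 x y) (h2 x y)).add
      (hasDerivAt_comp_plane hQ (h1 x y) (h2 x y)))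
    (fun x y => (hasDerivAt_comp_plane hQ (h3 x y) (h4 x y)).sub
      (hasDerivAt_comp_plane hP (h3 x y) (h4 x y))) τ₁ τ₂ ρ₁ ρ₂
  simp only [Function.comp] at key
  rw [← key]
  refine intervalIntegral.integral_congr fun t _ => intervalIntegral.integral_congr fun r _ => ?_
  simp only [← hS]
  ring

/-- The flux identity in a null trapezoid `{σ u + c ≤ v ≤ V, u₁ ≤ u ≤ u₂}`. -/
lemma trapezoid_identity (hP : ContDiff ℝ 1 P) (hQ : ContDiff ℝ 1 Q)
    (hS : ∀ z, fderiv ℝ P z (1, 0) + fderiv ℝ Q z (0, 1) = S z) (σ c W u₁ u₂ : ℝ) :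
    ∫ u in u₁..u₂, ∫ v in (σ * u + c)..W, S (u, v) =
      (∫ u in u₁..u₂, Q (u, W)) - (∫ u in u₁..u₂, (Q (u, σ * u + c) - σ * P (u, σ * u + c)))
      + (∫ v in (σ * u₂ + c)..W, P (u₂, v)) - ∫ v in (σ * u₁ + c)..W, P (u₁, v) := by
  set y : ℝ → ℝ → ℝ := fun u θ => (σ * u + c) + (W - (σ * u + c)) * θ with hy
  have hsub : ∀ (F : ℝ × ℝ → ℝ) (u : ℝ), ∫ θ in (0 : ℝ)..1, (W - (σ * u + c)) * F (u, y u θ) =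
      ∫ v in (σ * u + c)..W, F (u, v) := by
    intro F u
    rw [intervalIntegral.integral_const_mul]
    have := intervalIntegral.smul_integral_comp_add_mul (a := 0) (b := 1) (fun v => F (u, v))
      (W - (σ * u + c)) (σ * u + c)
    simpa using this
  have hΦ : ContDiff ℝ 1 fun z : ℝ × ℝ => (z.1, y z.1 z.2) := by
    simp only [hy]; fun_prop
  have hl : ContDiff ℝ 1 fun z : ℝ × ℝ => W - (σ * z.1 + c) := by fun_prop
  have hm : ContDiff ℝ 1 fun z : ℝ × ℝ => σ * (1 - z.2) := by fun_prop
  have d1 : ∀ u : ℝ, HasDerivAt (fun u => σ * u + c) σ u := fun u => by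
    simpa using ((hasDerivAt_id u).const_mul σ).add_const c
  have d2 : ∀ u : ℝ, HasDerivAt (fun u => W - (σ * u + c)) (-σ) u := fun u => (d1 u).const_sub W
  have d3 : ∀ u θ : ℝ, HasDerivAt (fun u => y u θ) (σ * (1 - θ)) u := fun u θ =>
    ((d1 u).fun_add ((d2 u).mul_const θ)).congr_deriv (by ring)
  have d4 : ∀ u θ : ℝ, HasDerivAt (fun θ => y u θ) (W - (σ * u + c)) θ := fun u θ =>
    (((hasDerivAt_id θ).const_mul (W - (σ * u + c))).const_add (σ * u + c)).congr_deriv (by simp)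
  have d5 : ∀ θ : ℝ, HasDerivAt (fun θ : ℝ => σ * (1 - θ)) (-σ) θ := fun θ => by
    simpa using ((hasDerivAt_id θ).const_sub 1).const_mul σ
  have key := integral_rect_divergence (hl.mul (hP.comp hΦ))
    ((hQ.comp hΦ).sub (hm.mul (hP.comp hΦ)))
    (fun u θ => (d2 u).mul (hasDerivAt_comp_plane hP (hasDerivAt_id u) (d3 u θ)))
    (fun u θ => (hasDerivAt_comp_plane hQ (hasDerivAt_const θ u) (d4 u θ)).sub
      ((d5 θ).mul (hasDerivAt_comp_plane hP (hasDerivAt_const θ u) (d4 u θ)))) u₁ u₂ 0 1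
    (a₁ := fun z => -σ * P (z.1, y z.1 z.2) + (W - (σ * z.1 + c)) *
      (1 * fderiv ℝ P (z.1, y z.1 z.2) (1, 0)
        + σ * (1 - z.2) * fderiv ℝ P (z.1, y z.1 z.2) (0, 1)))
    (b₂ := fun z => (0 * fderiv ℝ Q (z.1, y z.1 z.2) (1, 0)
        + (W - (σ * z.1 + c)) * fderiv ℝ Q (z.1, y z.1 z.2) (0, 1))
      - (-σ * P (z.1, y z.1 z.2) + σ * (1 - z.2) * (0 * fderiv ℝ P (z.1, y z.1 z.2) (1, 0)
        + (W - (σ * z.1 + c)) * fderiv ℝ P (z.1, y z.1 z.2) (0, 1))))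
  simp only [Function.comp] at key
  have y1 : ∀ u, y u 1 = W := fun u => by simp [hy]
  have y0 : ∀ u, y u 0 = σ * u + c := fun u => by simp [hy]
  simp only [hsub, y1, y0, sub_self, mul_zero, zero_mul, sub_zero, mul_one] at key
  rw [← key]
  refine intervalIntegral.integral_congr fun u _ => (hsub S u).symm.trans ?_
  refine intervalIntegral.integral_congr fun θ _ => ?_
  simp only [← hS]
  ring

/-- The flux identity in the interior region, in the foliation parameter `τ`. -/
lemma interior_identity (hP : ContDiff ℝ 1 P) (hQ : ContDiff ℝ 1 Q)
    (hS : ∀ z, fderiv ℝ P z (1, 0) + fderiv ℝ Q z (0, 1) = S z)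
    (hP0 : ∀ u, P (u, u) = 0) (hQ0 : ∀ u, Q (u, u) = 0) (R τ₁ τ₂ W : ℝ) :
    (∫ r in (0 : ℝ)..R, (P ((τ₂ - r) / 2, (τ₂ + r) / 2) + Q ((τ₂ - r) / 2, (τ₂ + r) / 2)))
      + 2 * (∫ v in ((τ₂ + R) / 2)..W, P ((τ₂ - R) / 2, v))
      + 2 * (∫ u in ((τ₁ - R) / 2)..((τ₂ - R) / 2), Q (u, W)) =
    (∫ r in (0 : ℝ)..R, (P ((τ₁ - r) / 2, (τ₁ + r) / 2) + Q ((τ₁ - r) / 2, (τ₁ + r) / 2)))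
      + 2 * (∫ v in ((τ₁ + R) / 2)..W, P ((τ₁ - R) / 2, v))
      + (∫ t in τ₁..τ₂, ∫ r in (0 : ℝ)..R, S ((t - r) / 2, (t + r) / 2))
      + ∫ t in τ₁..τ₂, ∫ v in ((t + R) / 2)..W, S ((t - R) / 2, v) := by
  have h1 := cylinder_identity hP hQ hS τ₁ τ₂ 0 R
  have h2 := trapezoid_identity hP hQ hS 1 R W ((τ₁ - R) / 2) ((τ₂ - R) / 2)
  have hsub : ∀ F : ℝ → ℝ, 2 * ∫ u in ((τ₁ - R) / 2)..((τ₂ - R) / 2), F u =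
      ∫ t in τ₁..τ₂, F ((t - R) / 2) := by
    intro F
    have := intervalIntegral.inv_smul_integral_comp_div_add (a := τ₁) (b := τ₂) F 2 (-R / 2)
    rw [show τ₁ / 2 + -R / 2 = (τ₁ - R) / 2 by ring,
      show τ₂ / 2 + -R / 2 = (τ₂ - R) / 2 by ring] at this
    have e' : ∀ t : ℝ, t / 2 + -R / 2 = (t - R) / 2 := fun t => by ring
    simp only [e'] at this
    rw [← this, smul_eq_mul, ← mul_assoc]
    norm_num
  have e : ∀ t : ℝ, (t - R) / 2 + R = (t + R) / 2 := fun t => by ring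
  have h3 := congrArg (fun x => 2 * x) h2
  simp only [mul_add, mul_sub, hsub, one_mul, e] at h3
  simp only [sub_zero, add_zero, hP0, hQ0, sub_self, intervalIntegral.integral_zero] at h1
  rw [hsub]
  linarith

/-- The flux identity in the exterior region. -/
lemma exterior_identity (hP : ContDiff ℝ 1 P) (hQ : ContDiff ℝ 1 Q)
    (hS : ∀ z, fderiv ℝ P z (1, 0) + fderiv ℝ Q z (0, 1) = S z) (u₁ u₂ : ℝ) :
    (∫ v in (-u₂)..(-u₁), P (u₂, v)) + (∫ u in u₁..u₂, Q (u, -u₁)) =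
      (∫ u in u₁..u₂, (Q (u, -u) + P (u, -u)))
      + ∫ u in u₁..u₂, ∫ v in (-u)..(-u₁), S (u, v) := by
  have h2 := trapezoid_identity hP hQ hS (-1) 0 (-u₁) u₁ u₂
  simp only [neg_mul, one_mul, add_zero, intervalIntegral.integral_same, sub_neg_eq_add] at h2
  linarith

end PlaneIdentities

section PlaneInequalities

lemma ofReal_intervalIntegral {f : ℝ → ℝ} {a b : ℝ} (hab : a ≤ b) (hf : Continuous f)
    (h0 : ∀ x ∈ Icc a b, 0 ≤ f x) :
    ENNReal.ofReal (∫ x in a..b, f x) = ∫⁻ x in Icc a b, ENNReal.ofReal (f x) := by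
  rw [intervalIntegral.integral_of_le hab, ← integral_Icc_eq_integral_Ioc]
  exact ofReal_integral_eq_lintegral_ofReal (hf.continuousOn.integrableOn_Icc)
    ((ae_restrict_iff' measurableSet_Icc).2 (Filter.Eventually.of_forall h0))

lemma continuous_integral_moving_lower {f : ℝ → ℝ → ℝ} {c : ℝ → ℝ} (b : ℝ)
    (hf : Continuous fun z : ℝ × ℝ => f z.1 z.2) (hc : Continuous c) :
    Continuous fun x => ∫ y in c x..b, f x y := by
  have h := (intervalIntegral.continuous_parametric_intervalIntegral_of_continuous (a₀ := b)
    (μ := volume) (f := f) hf hc).neg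
  exact h.congr fun x => (intervalIntegral.integral_symm _ _).symm

lemma ofReal_integral_integral {f : ℝ → ℝ → ℝ} {c : ℝ → ℝ} {a b W : ℝ} (hab : a ≤ b)
    (hf : Continuous fun z : ℝ × ℝ => f z.1 z.2) (hc : Continuous c)
    (hcW : ∀ x ∈ Icc a b, c x ≤ W) (h0 : ∀ x ∈ Icc a b, ∀ y ∈ Icc (c x) W, 0 ≤ f x y) :
    ENNReal.ofReal (∫ x in a..b, ∫ y in c x..W, f x y) =
      ∫⁻ x in Icc a b, ∫⁻ y in Icc (c x) W, ENNReal.ofReal (f x y) := by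
  rw [ofReal_intervalIntegral hab (continuous_integral_moving_lower W hf hc) fun x hx =>
    intervalIntegral.integral_nonneg (hcW x hx) (h0 x hx)]
  exact setLIntegral_congr_fun measurableSet_Icc fun x hx =>
    ofReal_intervalIntegral (hcW x hx) (by fun_prop) (h0 x hx)

lemma integral_integral_mono {f g : ℝ → ℝ → ℝ} {c : ℝ → ℝ} {a b W : ℝ} (hab : a ≤ b)
    (hf : Continuous fun z : ℝ × ℝ => f z.1 z.2) (hg : Continuous fun z : ℝ × ℝ => g z.1 z.2)
    (hc : Continuous c) (hcW : ∀ x ∈ Icc a b, c x ≤ W)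
    (h : ∀ x ∈ Icc a b, ∀ y ∈ Icc (c x) W, f x y ≤ g x y) :
    ∫ x in a..b, ∫ y in c x..W, f x y ≤ ∫ x in a..b, ∫ y in c x..W, g x y := by
  refine intervalIntegral.integral_mono_on hab
    ((continuous_integral_moving_lower W hf hc).intervalIntegrable _ _)
    ((continuous_integral_moving_lower W hg hc).intervalIntegrable _ _) fun x hx => ?_
  exact intervalIntegral.integral_mono_on (hcW x hx)
    ((by fun_prop : Continuous (f x)).intervalIntegrable _ _)
    ((by fun_prop : Continuous (g x)).intervalIntegrable _ _) (h x hx)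

lemma integral_integral_sub {f g : ℝ → ℝ → ℝ} {c : ℝ → ℝ} {a b W : ℝ}
    (hf : Continuous fun z : ℝ × ℝ => f z.1 z.2) (hg : Continuous fun z : ℝ × ℝ => g z.1 z.2)
    (hc : Continuous c) :
    ∫ x in a..b, ∫ y in c x..W, (g x y - f x y) =
      (∫ x in a..b, ∫ y in c x..W, g x y) - ∫ x in a..b, ∫ y in c x..W, f x y := by
  rw [← intervalIntegral.integral_sub
    ((continuous_integral_moving_lower W hg hc).intervalIntegrable _ _)
    ((continuous_integral_moving_lower W hf hc).intervalIntegrable _ _)]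
  refine intervalIntegral.integral_congr fun x _ => ?_
  exact intervalIntegral.integral_sub
    ((by fun_prop : Continuous (g x)).intervalIntegrable _ _)
    ((by fun_prop : Continuous (f x)).intervalIntegrable _ _)

lemma setLIntegral_Ici_le {f : ℝ → ℝ≥0∞} {a b : ℝ} {M : ℝ≥0∞}
    (h : ∀ W, b ≤ W → ∫⁻ x in Icc a W, f x ≤ M) : ∫⁻ x in Ici a, f x ≤ M := by
  have e : Ici a = ⋃ n : ℕ, Icc a (b + n) := by
    ext x
    simp only [mem_Ici, mem_iUnion, mem_Icc, exists_and_left, iff_self_and]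
    intro _
    obtain ⟨n, hn⟩ := exists_nat_ge (x - b)
    exact ⟨n, by linarith⟩
  rw [e, setLIntegral_iUnion_of_directed]
  · exact iSup_le fun n => h _ (by simp)
  · refine (Monotone.directed_le fun m n hmn => Icc_subset_Icc_right ?_)
    gcongr

lemma lintegral_setLIntegral_Ici_le {f : ℝ → ℝ → ℝ≥0∞} {c : ℝ → ℝ} {b : ℝ} {M : ℝ≥0∞} {s : Set ℝ}
    (hf : Measurable fun z : ℝ × ℝ => f z.1 z.2) (hc : Continuous c)
    (h : ∀ W, b ≤ W → ∫⁻ t in s, ∫⁻ x in Icc (c t) W, f t x ≤ M) :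
    ∫⁻ t in s, ∫⁻ x in Ici (c t), f t x ≤ M := by
  have e : ∀ t, ∫⁻ x in Ici (c t), f t x = ⨆ n : ℕ, ∫⁻ x in Icc (c t) (b + n), f t x := by
    intro t
    refine le_antisymm (setLIntegral_Ici_le (b := b) fun W _ => ?_)
      (iSup_le fun n => lintegral_mono_set Icc_subset_Ici_self)
    obtain ⟨n, hn⟩ := exists_nat_ge (W - b)
    have hn' : W ≤ b + n := by linarith
    exact (lintegral_mono_set (Icc_subset_Icc_right hn')).trans
      (le_iSup (fun n : ℕ => ∫⁻ x in Icc (c t) (b + n), f t x) n)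
  simp only [e]
  rw [lintegral_iSup]
  · exact iSup_le fun n => h _ (by simp)
  · intro n
    have : ∀ t, ∫⁻ x in Icc (c t) (b + n), f t x =
        ∫⁻ x, ({z : ℝ × ℝ | c z.1 ≤ z.2} ∩ {z : ℝ × ℝ | z.2 ≤ b + n}).indicator
          (fun z : ℝ × ℝ => f z.1 z.2) (t, x) := by
      intro t
      rw [← lintegral_indicator measurableSet_Icc]
      rfl
    simp only [this]
    refine Measurable.lintegral_prod_right' (f := ({z : ℝ × ℝ | c z.1 ≤ z.2} ∩
      {z : ℝ × ℝ | z.2 ≤ b + n}).indicator (fun z : ℝ × ℝ => f z.1 z.2)) (hf.indicator ?_)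
    exact (isClosed_le (by fun_prop) (by fun_prop)).measurableSet.inter
      (isClosed_le (by fun_prop) (by fun_prop)).measurableSet
  · intro m n hmn t
    refine lintegral_mono_set (Icc_subset_Icc_right ?_)
    gcongr

variable {P Q S B T : ℝ × ℝ → ℝ}

/-- The weighted energy inequality in a truncated interior region. -/
lemma interior_real_inequality (hP : ContDiff ℝ 1 P) (hQ : ContDiff ℝ 1 Q)
    (hS : ∀ z, fderiv ℝ P z (1, 0) + fderiv ℝ Q z (0, 1) = S z) (hSc : Continuous S)
    (hB : Continuous B) (hT : Continuous T) (hST : ∀ u v, u ≤ v → S (u, v) ≤ T (u, v) - B (u, v))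
    (hB0 : ∀ u v, u ≤ v → 0 ≤ B (u, v))
    (hP0 : ∀ u, P (u, u) = 0) (hQ0 : ∀ u, Q (u, u) = 0) {R τ₁ τ₂ W : ℝ} (hR : 0 ≤ R)
    (hτ : τ₁ ≤ τ₂) (hW : (τ₂ + R) / 2 ≤ W) :
    (∫ r in (0 : ℝ)..R, (P ((τ₂ - r) / 2, (τ₂ + r) / 2) + Q ((τ₂ - r) / 2, (τ₂ + r) / 2)))
      + 2 * (∫ v in ((τ₂ + R) / 2)..W, P ((τ₂ - R) / 2, v))
      + 2 * (∫ u in ((τ₁ - R) / 2)..((τ₂ - R) / 2), Q (u, W))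
      + (∫ t in τ₁..τ₂, ∫ v in ((t + R) / 2)..W, B ((t - R) / 2, v)) ≤
    (∫ r in (0 : ℝ)..R, (P ((τ₁ - r) / 2, (τ₁ + r) / 2) + Q ((τ₁ - r) / 2, (τ₁ + r) / 2)))
      + 2 * (∫ v in ((τ₁ + R) / 2)..W, P ((τ₁ - R) / 2, v))
      + (∫ t in τ₁..τ₂, ∫ r in (0 : ℝ)..R, T ((t - r) / 2, (t + r) / 2))
      + ∫ t in τ₁..τ₂, ∫ v in ((t + R) / 2)..W, T ((t - R) / 2, v) := by
  have h := interior_identity hP hQ hS hP0 hQ0 R τ₁ τ₂ W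
  have h1 : ∫ t in τ₁..τ₂, ∫ r in (0 : ℝ)..R, S ((t - r) / 2, (t + r) / 2) ≤
      ∫ t in τ₁..τ₂, ∫ r in (0 : ℝ)..R, T ((t - r) / 2, (t + r) / 2) := by
    refine integral_integral_mono (c := fun _ => 0)
      (f := fun t r => S ((t - r) / 2, (t + r) / 2)) (g := fun t r => T ((t - r) / 2, (t + r) / 2))
      hτ (by fun_prop) (by fun_prop) (by fun_prop) (fun _ _ => hR) fun t _ r hr => ?_
    have := hST ((t - r) / 2) ((t + r) / 2) (by linarith [hr.1])
    have := hB0 ((t - r) / 2) ((t + r) / 2) (by linarith [hr.1])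
    linarith
  have hcW : ∀ t ∈ Icc τ₁ τ₂, (t + R) / 2 ≤ W := fun t ht => by linarith [ht.2]
  have h2 : ∫ t in τ₁..τ₂, ∫ v in ((t + R) / 2)..W, S ((t - R) / 2, v) ≤
      ∫ t in τ₁..τ₂, ∫ v in ((t + R) / 2)..W, (T ((t - R) / 2, v) - B ((t - R) / 2, v)) :=
    integral_integral_mono (f := fun t v => S ((t - R) / 2, v))
      (g := fun t v => T ((t - R) / 2, v) - B ((t - R) / 2, v)) hτ (by fun_prop) (by fun_prop)
      (by fun_prop) hcW fun t _ v hv => hST _ _ (by linarith [hv.1])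
  rw [integral_integral_sub (f := fun t v => B ((t - R) / 2, v))
    (g := fun t v => T ((t - R) / 2, v)) (by fun_prop) (by fun_prop) (by fun_prop)] at h2
  linarith

/-- The right-hand side of the interior energy inequality. -/
def interiorRhs (P Q T : ℝ × ℝ → ℝ) (R τ₁ τ₂ : ℝ) : ℝ≥0∞ :=
  (∫⁻ r in Icc (0 : ℝ) R, ENNReal.ofReal
      (P ((τ₁ - r) / 2, (τ₁ + r) / 2) + Q ((τ₁ - r) / 2, (τ₁ + r) / 2)))
    + 2 * (∫⁻ v in Ici ((τ₁ + R) / 2), ENNReal.ofReal (P ((τ₁ - R) / 2, v)))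
    + (∫⁻ t in Icc τ₁ τ₂, ∫⁻ r in Icc (0 : ℝ) R, ENNReal.ofReal (T ((t - r) / 2, (t + r) / 2)))
    + ∫⁻ t in Icc τ₁ τ₂, ∫⁻ v in Ici ((t + R) / 2), ENNReal.ofReal (T ((t - R) / 2, v))

/-- The weighted energy inequality in the interior region. -/
lemma interior_inequality (hP : ContDiff ℝ 1 P) (hQ : ContDiff ℝ 1 Q)
    (hS : ∀ z, fderiv ℝ P z (1, 0) + fderiv ℝ Q z (0, 1) = S z) (hSc : Continuous S)
    (hB : Continuous B) (hT : Continuous T) (hST : ∀ u v, u ≤ v → S (u, v) ≤ T (u, v) - B (u, v))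
    (hB0 : ∀ u v, u ≤ v → 0 ≤ B (u, v)) (hT0 : ∀ u v, u ≤ v → 0 ≤ T (u, v))
    (hPn : ∀ u v, u ≤ v → 0 ≤ P (u, v)) (hQn : ∀ u v, u ≤ v → 0 ≤ Q (u, v))
    (hP0 : ∀ u, P (u, u) = 0) (hQ0 : ∀ u, Q (u, u) = 0) {R τ₁ τ₂ v₀ : ℝ} (hR : 0 ≤ R)
    (hτ : τ₁ ≤ τ₂) (hv₀ : (τ₂ + R) / 2 ≤ v₀) :
    ∫⁻ v in Ici ((τ₂ + R) / 2), ENNReal.ofReal (P ((τ₂ - R) / 2, v)) ≤ interiorRhs P Q T R τ₁ τ₂ ∧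
    ∫⁻ u in Icc ((τ₁ - R) / 2) ((τ₂ - R) / 2), ENNReal.ofReal (Q (u, v₀)) ≤
      interiorRhs P Q T R τ₁ τ₂ ∧
    ∫⁻ t in Icc τ₁ τ₂, ∫⁻ v in Ici ((t + R) / 2), ENNReal.ofReal (B ((t - R) / 2, v)) ≤
      interiorRhs P Q T R τ₁ τ₂ := by
  have hPc := hP.continuous
  have hQc := hQ.continuous
  have key : ∀ W, (τ₂ + R) / 2 ≤ W →
      (∫⁻ v in Icc ((τ₂ + R) / 2) W, ENNReal.ofReal (P ((τ₂ - R) / 2, v)))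
      + (∫⁻ u in Icc ((τ₁ - R) / 2) ((τ₂ - R) / 2), ENNReal.ofReal (Q (u, W)))
      + (∫⁻ t in Icc τ₁ τ₂, ∫⁻ v in Icc ((t + R) / 2) W, ENNReal.ofReal (B ((t - R) / 2, v))) ≤
      interiorRhs P Q T R τ₁ τ₂ := by
    intro W hW
    have hcW : ∀ t ∈ Icc τ₁ τ₂, (t + R) / 2 ≤ W := fun t ht => by linarith [ht.2]
    have h := interior_real_inequality hP hQ hS hSc hB hT hST hB0 hP0 hQ0 hR hτ hW
    have n1 : 0 ≤ ∫ r in (0 : ℝ)..R,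
        (P ((τ₂ - r) / 2, (τ₂ + r) / 2) + Q ((τ₂ - r) / 2, (τ₂ + r) / 2)) :=
      intervalIntegral.integral_nonneg hR fun r hr =>
        add_nonneg (hPn _ _ (by linarith [hr.1])) (hQn _ _ (by linarith [hr.1]))
    have n2 : 0 ≤ ∫ v in ((τ₂ + R) / 2)..W, P ((τ₂ - R) / 2, v) :=
      intervalIntegral.integral_nonneg hW fun v hv => hPn _ _ (by linarith [hv.1])
    have n3 : 0 ≤ ∫ u in ((τ₁ - R) / 2)..((τ₂ - R) / 2), Q (u, W) :=
      intervalIntegral.integral_nonneg (by linarith) fun u hu => hQn _ _ (by linarith [hu.2])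
    have n4 : 0 ≤ ∫ t in τ₁..τ₂, ∫ v in ((t + R) / 2)..W, B ((t - R) / 2, v) :=
      intervalIntegral.integral_nonneg hτ fun t ht =>
        intervalIntegral.integral_nonneg (hcW t ht) fun v hv => hB0 _ _ (by linarith [hv.1])
    rw [← ofReal_intervalIntegral hW (by fun_prop) (fun v hv => hPn _ _ (by linarith [hv.1])),
      ← ofReal_intervalIntegral (by linarith) (by fun_prop)
        (fun u hu => hQn _ _ (by linarith [hu.2])),
      ← ofReal_integral_integral (f := fun t v => B ((t - R) / 2, v)) hτ (by fun_prop)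
        (by fun_prop) hcW (fun t _ v hv => hB0 _ _ (by linarith [hv.1])),
      ← ENNReal.ofReal_add n2 n3, ← ENNReal.ofReal_add (add_nonneg n2 n3) n4]
    refine (ENNReal.ofReal_le_ofReal ((by linarith : _ ≤ _).trans h)).trans ?_
    refine ENNReal.ofReal_add_le.trans (add_le_add (ENNReal.ofReal_add_le.trans
      (add_le_add (ENNReal.ofReal_add_le.trans (add_le_add ?_ ?_)) ?_)) ?_)
    · exact (ofReal_intervalIntegral hR (by fun_prop) fun r hr =>
        add_nonneg (hPn _ _ (by linarith [hr.1])) (hQn _ _ (by linarith [hr.1]))).le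
    · rw [ENNReal.ofReal_mul zero_le_two, ENNReal.ofReal_ofNat,
        ofReal_intervalIntegral (by linarith) (by fun_prop)
          (fun v hv => hPn _ _ (by linarith [hv.1]))]
      gcongr
      exact Icc_subset_Ici_self
    · exact (ofReal_integral_integral (c := fun _ => 0)
        (f := fun t r => T ((t - r) / 2, (t + r) / 2)) hτ (by fun_prop) (by fun_prop)
        (fun _ _ => hR) (fun t _ r hr => hT0 _ _ (by linarith [hr.1]))).le
    · rw [ofReal_integral_integral (f := fun t v => T ((t - R) / 2, v)) hτ (by fun_prop)
        (by fun_prop) hcW (fun t _ v hv => hT0 _ _ (by linarith [hv.1]))]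
      gcongr
      exact Icc_subset_Ici_self
  refine ⟨setLIntegral_Ici_le (b := (τ₂ + R) / 2) fun W hW => ?_, ?_,
    lintegral_setLIntegral_Ici_le (b := (τ₂ + R) / 2)
      (f := fun t v => ENNReal.ofReal (B ((t - R) / 2, v))) ?_ (by fun_prop) fun W hW => ?_⟩
  · exact (le_add_right le_self_add).trans (key W hW)
  · exact (le_add_right le_add_self).trans (key v₀ hv₀)
  · exact (by fun_prop : Continuous fun z : ℝ × ℝ => B ((z.1 - R) / 2, z.2)).measurable.ennreal_ofReal
  · exact le_add_self.trans (key W hW)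

/-- The weighted energy inequality in the exterior region. -/
lemma exterior_inequality (hP : ContDiff ℝ 1 P) (hQ : ContDiff ℝ 1 Q)
    (hS : ∀ z, fderiv ℝ P z (1, 0) + fderiv ℝ Q z (0, 1) = S z) (hSc : Continuous S)
    (hB : Continuous B) (hT : Continuous T) (hST : ∀ u v, u ≤ v → S (u, v) ≤ T (u, v) - B (u, v))
    (hB0 : ∀ u v, u ≤ v → 0 ≤ B (u, v)) (hT0 : ∀ u v, u ≤ v → 0 ≤ T (u, v))
    (hPn : ∀ u v, u ≤ v → 0 ≤ P (u, v)) (hQn : ∀ u v, u ≤ v → 0 ≤ Q (u, v))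
    {u₁ u₂ : ℝ} (hu : u₁ ≤ u₂) (hu₂ : u₂ ≤ 0) :
    (∫⁻ v in Icc (-u₂) (-u₁), ENNReal.ofReal (P (u₂, v)))
      + (∫⁻ u in Icc u₁ u₂, ENNReal.ofReal (Q (u, -u₁)))
      + (∫⁻ u in Icc u₁ u₂, ∫⁻ v in Icc (-u) (-u₁), ENNReal.ofReal (B (u, v))) ≤
    (∫⁻ u in Icc u₁ u₂, ENNReal.ofReal (Q (u, -u) + P (u, -u)))
      + ∫⁻ u in Icc u₁ u₂, ∫⁻ v in Icc (-u) (-u₁), ENNReal.ofReal (T (u, v)) := by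
  have hPc := hP.continuous
  have hQc := hQ.continuous
  have hcW : ∀ u ∈ Icc u₁ u₂, -u ≤ -u₁ := fun u hu => by linarith [hu.1]
  have hr : ∀ u ∈ Icc u₁ u₂, ∀ v ∈ Icc (-u) (-u₁), u ≤ v := fun u hu v hv => by
    linarith [hv.1, hu.2]
  have h := exterior_identity hP hQ hS u₁ u₂
  have h2 : ∫ u in u₁..u₂, ∫ v in (-u)..(-u₁), S (u, v) ≤
      ∫ u in u₁..u₂, ∫ v in (-u)..(-u₁), (T (u, v) - B (u, v)) :=
    integral_integral_mono (f := fun u v => S (u, v)) (g := fun u v => T (u, v) - B (u, v)) hu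
      (by fun_prop) (by fun_prop) (by fun_prop) hcW fun u hu v hv => hST _ _ (hr u hu v hv)
  rw [integral_integral_sub (f := fun u v => B (u, v)) (g := fun u v => T (u, v)) (by fun_prop)
    (by fun_prop) (by fun_prop)] at h2
  have n2 : 0 ≤ ∫ v in (-u₂)..(-u₁), P (u₂, v) :=
    intervalIntegral.integral_nonneg (by linarith) fun v hv => hPn _ _ (by linarith [hv.1])
  have n3 : 0 ≤ ∫ u in u₁..u₂, Q (u, -u₁) :=
    intervalIntegral.integral_nonneg hu fun u hu => hQn _ _ (by linarith [hu.2, hu.1])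
  have n4 : 0 ≤ ∫ u in u₁..u₂, ∫ v in (-u)..(-u₁), B (u, v) :=
    intervalIntegral.integral_nonneg hu fun u hu =>
      intervalIntegral.integral_nonneg (hcW u hu) fun v hv => hB0 _ _ (hr u hu v hv)
  rw [← ofReal_intervalIntegral (by linarith) (by fun_prop)
      (fun v hv => hPn _ _ (by linarith [hv.1])),
    ← ofReal_intervalIntegral hu (by fun_prop) (fun u hu => hQn _ _ (by linarith [hu.2, hu.1])),
    ← ofReal_integral_integral (f := fun u v => B (u, v)) hu (by fun_prop) (by fun_prop) hcW
      (fun u hu v hv => hB0 _ _ (hr u hu v hv)),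
    ← ENNReal.ofReal_add n2 n3, ← ENNReal.ofReal_add (add_nonneg n2 n3) n4]
  refine (ENNReal.ofReal_le_ofReal (by linarith : _ ≤ (∫ u in u₁..u₂, (Q (u, -u) + P (u, -u))) +
    ∫ u in u₁..u₂, ∫ v in (-u)..(-u₁), T (u, v))).trans
    (ENNReal.ofReal_add_le.trans (add_le_add ?_ ?_))
  · exact (ofReal_intervalIntegral hu (by fun_prop) fun u hu =>
      add_nonneg (hQn _ _ (by linarith [hu.2])) (hPn _ _ (by linarith [hu.2]))).le
  · exact (ofReal_integral_integral (f := fun u v => T (u, v)) hu (by fun_prop) (by fun_prop) hcW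
      (fun u hu v hv => hT0 _ _ (hr u hu v hv))).le

end PlaneInequalities

section Source

variable {A : V → Fin 4 → ℝ} {φ : V → ℂ} {ε p : ℝ}

/-- Density of the positive bulk term controlled by the weighted energy estimate. -/
def bulkD (A : V → Fin 4 → ℝ) (φ : V → ℂ) (ε p u v : ℝ) (ω : E3) : ℝ :=
  1 / 2 * (gW ε u * (2 * (v - u) * qW ε p (v - u) + (v - u) ^ 2 * qW' ε p (v - u))) *
      ip (radD A φ (u + v) (v - u) ω) (radD A φ (u + v) (v - u) ω)
    + gW ε u * -qW' ε p (v - u) * (pairSum fun i j =>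
      ip (angD A φ i j (u + v) (v - u) ω) (angD A φ i j (u + v) (v - u) ω))

/-- Density of the error term in the weighted energy estimate. -/
def errD (A : V → Fin 4 → ℝ) (φ : V → ℂ) (ε p u v : ℝ) (ω : E3) : ℝ :=
  srcW ε p u |v - u| * ((v - u) ^ 2 * ‖boxA A φ (pt (u + v) (v - u) ω)‖ ^ 2)
    + 2 * (gW ε u * qW ε p (v - u) * (v - u) ^ 4 *
      |contrFJ A φ (pt (u + v) (v - u) ω) (outV ω)|)

lemma srcW_nonneg (hε : 0 < ε) (u : ℝ) {r : ℝ} (hr : 0 ≤ r) : 0 ≤ srcW ε p u r := by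
  have := massW_nonneg (ε := ε)
  unfold srcW
  positivity

lemma continuous_srcW : Continuous fun z : ℝ × ℝ => srcW ε p z.1 |z.2| := by
  refine continuous_const.mul (Continuous.mul ?_ ?_)
  · exact (by fun_prop : Continuous fun z : ℝ × ℝ => 1 + |z.1|).rpow_const
      fun z => Or.inl (by positivity)
  · exact (by fun_prop : Continuous fun z : ℝ × ℝ => 1 + |z.2|).rpow_const
      fun z => Or.inl (by positivity)

lemma ip_le_norm_mul_norm (z w : ℂ) : |ip z w| ≤ ‖z‖ * ‖w‖ := by
  refine abs_le_of_sq_le_sq ?_ (by positivity)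
  rw [mul_pow, ← ip_self, ← ip_self]
  simp only [ip]
  nlinarith [sq_nonneg (z.re * w.im - z.im * w.re)]

lemma pairSum_ip_self_nonneg (f : Fin 3 → Fin 3 → ℂ) : 0 ≤ pairSum fun i j => ip (f i j) (f i j) := by
  simp only [pairSum, ip_self]
  positivity

lemma two_mul_le_of_sq_le {a K W x y : ℝ} (hK : 0 ≤ K) (hW : 0 ≤ W)
    (h : 2 * a ^ 2 ≤ K * W) : 2 * (a * (x * y)) ≤ 1 / 2 * K * x ^ 2 + W * y ^ 2 := by
  refine le_of_abs_le (abs_le_of_sq_le_sq ?_ (by positivity))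
  nlinarith [sq_nonneg (1 / 2 * K * x ^ 2 - W * y ^ 2),
    mul_le_mul_of_nonneg_right h (by positivity : 0 ≤ x ^ 2 * y ^ 2)]

lemma bulkD_nonneg (hε : 0 < ε) (hp : 0 ≤ p) (hp2 : p ≤ 2) {u v : ℝ} (huv : u ≤ v) (ω : E3) :
    0 ≤ bulkD A φ ε p u v ω := by
  have hr : 0 ≤ v - u := by linarith
  have hg : 0 ≤ gW ε u := by linarith [(gW_mem hε u).1]
  have h1 : 0 ≤ 2 * (v - u) * qW ε p (v - u) + (v - u) ^ 2 * qW' ε p (v - u) :=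
    le_trans (by positivity) (deriv_weight_lower hε hp hp2 hr).1
  have h2 := qW'_nonpos hε hp hp2 hr
  refine add_nonneg (mul_nonneg (by positivity) (by rw [ip_self]; positivity))
    (mul_nonneg (mul_nonneg hg (by linarith)) (pairSum_ip_self_nonneg _))

lemma errD_nonneg (hε : 0 < ε) (hp : 0 ≤ p) (hp2 : p ≤ 2) (u v : ℝ) (ω : E3) :
    0 ≤ errD A φ ε p u v ω := by
  have h1 := srcW_nonneg (p := p) hε u (abs_nonneg (v - u))
  have hg : 0 ≤ gW ε u := by linarith [(gW_mem hε u).1]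
  have hq := qW_nonneg hε hp hp2 (v - u)
  unfold errD
  positivity

lemma fluxP_nonneg (hε : 0 < ε) (hp : 0 ≤ p) (hp2 : p ≤ 2) (u v : ℝ) (ω : E3) :
    0 ≤ fluxP A φ (gW ε) (qW ε p) u v ω := by
  have hg : 0 ≤ gW ε u := by linarith [(gW_mem hε u).1]
  have hq := qW_nonneg hε hp hp2 (v - u)
  unfold fluxP
  rw [ip_self]
  positivity

lemma fluxQ_nonneg (hε : 0 < ε) (hp : 0 ≤ p) (hp2 : p ≤ 2) (u v : ℝ) (ω : E3) :
    0 ≤ fluxQ A φ (gW ε) (qW ε p) u v ω := by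
  have hg : 0 ≤ gW ε u := by linarith [(gW_mem hε u).1]
  exact mul_nonneg (mul_nonneg hg (qW_nonneg hε hp hp2 (v - u))) (pairSum_ip_self_nonneg _)

/-- The source of the weighted current is absorbed by the bulk term up to the error density. -/
lemma srcS_le (hε : 0 < ε) (hp : 0 ≤ p) (hp2 : p ≤ 2) {u v : ℝ} (huv : u ≤ v) (ω : E3) :
    srcS A φ (gW ε) (fun u => -(1 + u ^ 2) ^ (-(1 + ε) / 2)) (qW ε p) (qW' ε p) u v ω ≤
      errD A φ ε p u v ω - bulkD A φ ε p u v ω := by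
  have hr : 0 ≤ v - u := by linarith
  have hw := source_weight_le hε hp hp2 u hr
  have hg : 0 ≤ gW ε u := by linarith [(gW_mem hε u).1]
  have hq := qW_nonneg hε hp hp2 (v - u)
  have h1 : 0 ≤ 2 * (v - u) * qW ε p (v - u) + (v - u) ^ 2 * qW' ε p (v - u) :=
    le_trans (by positivity) (deriv_weight_lower hε hp hp2 hr).1
  unfold srcS errD bulkD
  rw [abs_of_nonneg hr]
  set r := v - u
  set g := gW ε u
  set q := qW ε p r
  set q' := qW' ε p r
  set N := radD A φ (u + v) r ω
  set B := boxA A φ (pt (u + v) r ω)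
  set F := contrFJ A φ (pt (u + v) r ω) (outV ω)
  set d := (1 + u ^ 2) ^ (-(1 + ε) / 2)
  have hd : 0 ≤ d := Real.rpow_nonneg (by positivity) _
  have hK : g * (2 * r * q + r ^ 2 * q') ≤
      d * (r ^ 2 * q) + g * (2 * r * q + r ^ 2 * q') := le_add_of_nonneg_left (by positivity)
  have key := two_mul_le_of_sq_le (le_trans (by positivity) hK) (srcW_nonneg hε u hr)
    (x := ‖N‖) (y := r * ‖B‖) hw
  have hip : -(‖N‖ * ‖B‖) ≤ ip N B := (abs_le.1 (ip_le_norm_mul_norm N B)).1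
  have e1 := mul_le_mul_of_nonneg_left hip (by positivity : 0 ≤ g * q * r ^ 3)
  have e2 := mul_le_mul_of_nonneg_left (neg_abs_le F) (by positivity : 0 ≤ g * q * r ^ 4)
  have e3 := mul_le_mul_of_nonneg_right hK (sq_nonneg ‖N‖)
  rw [ip_self N]
  nlinarith

lemma continuous_bulkD (hA : ContDiff ℝ (⊤ : ℕ∞) A) (hφ : ContDiff ℝ (⊤ : ℕ∞) φ) :
    Continuous fun z : (ℝ × ℝ) × E3 => bulkD A φ ε p z.1.1 z.1.2 z.2 := by
  have hu : ContDiff ℝ (⊤ : ℕ∞) fun z : (ℝ × ℝ) × E3 => z.1.1 := contDiff_fst.fst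
  have hv : ContDiff ℝ (⊤ : ℕ∞) fun z : (ℝ × ℝ) × E3 => z.1.2 := contDiff_snd.comp contDiff_fst
  have hω : ContDiff ℝ (⊤ : ℕ∞) fun z : (ℝ × ℝ) × E3 => z.2 := contDiff_snd
  have hN := contDiff_radD hA hφ (hu.add hv) (hv.sub hu) hω
  have hΘ := fun i j => contDiff_angD hA hφ i j (hu.add hv) (hv.sub hu) hω
  have hNN := (contDiff_ip hN hN).continuous
  have hΘΘ := fun i j => (contDiff_ip (hΘ i j) (hΘ i j)).continuous
  have hr : Continuous fun z : (ℝ × ℝ) × E3 => z.1.2 - z.1.1 := (hv.sub hu).continuous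
  have hg : Continuous fun z : (ℝ × ℝ) × E3 => gW ε z.1.1 := contDiff_gW.continuous.comp hu.continuous
  have hq : Continuous fun z : (ℝ × ℝ) × E3 => qW ε p (z.1.2 - z.1.1) := contDiff_qW.continuous.comp hr
  have hq' : Continuous fun z : (ℝ × ℝ) × E3 => qW' ε p (z.1.2 - z.1.1) := continuous_qW'.comp hr
  refine ((continuous_const.mul (hg.mul (((continuous_const.mul hr).mul hq).add
    ((hr.pow 2).mul hq')))).mul hNN).add ((hg.mul hq'.neg).mul ?_)
  exact ((hΘΘ 0 1).add (hΘΘ 0 2)).add (hΘΘ 1 2)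

lemma continuous_errD (hA : ContDiff ℝ (⊤ : ℕ∞) A) (hφ : ContDiff ℝ (⊤ : ℕ∞) φ) :
    Continuous fun z : (ℝ × ℝ) × E3 => errD A φ ε p z.1.1 z.1.2 z.2 := by
  have hu : ContDiff ℝ (⊤ : ℕ∞) fun z : (ℝ × ℝ) × E3 => z.1.1 := contDiff_fst.fst
  have hv : ContDiff ℝ (⊤ : ℕ∞) fun z : (ℝ × ℝ) × E3 => z.1.2 := contDiff_snd.comp contDiff_fst
  have hω : ContDiff ℝ (⊤ : ℕ∞) fun z : (ℝ × ℝ) × E3 => z.2 := contDiff_snd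
  have hpt := (contDiff_pt (hu.add hv) (hv.sub hu) hω).continuous
  have hr : Continuous fun z : (ℝ × ℝ) × E3 => z.1.2 - z.1.1 := (hv.sub hu).continuous
  have hg : Continuous fun z : (ℝ × ℝ) × E3 => gW ε z.1.1 := contDiff_gW.continuous.comp hu.continuous
  have hq : Continuous fun z : (ℝ × ℝ) × E3 => qW ε p (z.1.2 - z.1.1) := contDiff_qW.continuous.comp hr
  have hF := (continuous_contrFJ hA hφ hpt (contDiff_outV hω).continuous).abs
  have hB := ((continuous_boxA hA hφ).comp hpt).norm.pow 2
  have hW : Continuous fun z : (ℝ × ℝ) × E3 => srcW ε p z.1.1 |z.1.2 - z.1.1| :=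
    continuous_srcW.comp (hu.continuous.prodMk hr)
  exact (hW.mul ((hr.pow 2).mul hB)).add (continuous_const.mul (((hg.mul hq).mul (hr.pow 4)).mul hF))

lemma continuous_sphAv {f : ℝ → ℝ → E3 → ℝ}
    (hf : Continuous fun z : (ℝ × ℝ) × E3 => f z.1.1 z.1.2 z.2) : Continuous (sphAv f) :=
  continuous_integral_sphM (f := fun (z : ℝ × ℝ) ω => f z.1 z.2 ω) hf

lemma sphAv_nonneg {f : ℝ → ℝ → E3 → ℝ} {u v : ℝ} (hf : ∀ ω, 0 ≤ f u v ω) : 0 ≤ sphAv f (u, v) :=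
  integral_nonneg hf

lemma ofReal_sphAv {f : ℝ → ℝ → E3 → ℝ} {u v : ℝ} (hf : Continuous (f u v))
    (h0 : ∀ ω, 0 ≤ f u v ω) :
    ENNReal.ofReal (sphAv f (u, v)) = ∫⁻ ω, ENNReal.ofReal (f u v ω) ∂sphM :=
  ofReal_integral_eq_lintegral_ofReal (integrable_sphM hf) (Filter.Eventually.of_forall h0)

end Source

section Cones

lemma measurable_sphere_lintegral {X : Type*} [MeasurableSpace X] {F : V → ℝ≥0∞} (hF : Measurable F)
    {t r : X → ℝ} (ht : Measurable t) (hr : Measurable r) :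
    Measurable fun x => ∫⁻ ω, F (pt (t x) (r x) ω) ∂sphM :=
  Measurable.lintegral_prod_right' (f := fun z : X × E3 => F (pt (t z.1) (r z.1) z.2))
    (hF.comp (continuous_pt.measurable.comp
      ((ht.comp measurable_fst).prodMk ((hr.comp measurable_fst).prodMk measurable_snd))))

/-- Integration over a family of outgoing cones is controlled by spacetime integration. -/
lemma polar_V_cone_le {F : V → ℝ≥0∞} (hF : Measurable F) :
    ∫⁻ τ : ℝ, ∫⁻ r in Ioi (0 : ℝ), ENNReal.ofReal (r ^ 2) * ∫⁻ ω, F (pt (τ + r) r ω) ∂sphM ≤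
      20736 * ∫⁻ p, F p := by
  refine le_trans (le_of_eq ?_) (polar_V_le hF)
  have hm1 : Measurable fun z : ℝ × ℝ => ENNReal.ofReal (z.2 ^ 2) *
      ∫⁻ ω, F (pt (z.1 + z.2) z.2 ω) ∂sphM :=
    ((measurable_snd.pow_const 2).ennreal_ofReal).mul
      (measurable_sphere_lintegral hF (measurable_fst.add measurable_snd) measurable_snd)
  have hm2 : Measurable fun z : ℝ × ℝ => ENNReal.ofReal (z.2 ^ 2) *
      ∫⁻ ω, F (pt z.1 z.2 ω) ∂sphM :=
    ((measurable_snd.pow_const 2).ennreal_ofReal).mul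
      (measurable_sphere_lintegral hF measurable_fst measurable_snd)
  refine (lintegral_lintegral_swap hm1.aemeasurable).trans
    ((lintegral_congr fun r => ?_).trans (lintegral_lintegral_swap hm2.aemeasurable).symm)
  exact lintegral_add_right_eq_self
    (fun t => ENNReal.ofReal (r ^ 2) * ∫⁻ ω, F (pt t r ω) ∂sphM) r

/-- The integral of a density over the outgoing cone with parameter `u`. -/
def coneI (F : V → ℝ≥0∞) (u : ℝ) : ℝ≥0∞ :=
  ∫⁻ v in Ioi u, ENNReal.ofReal ((v - u) ^ 2) * ∫⁻ ω, F (pt (u + v) (v - u) ω) ∂sphM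

lemma coneI_eq (F : V → ℝ≥0∞) (u : ℝ) : coneI F u =
    ∫⁻ r in Ioi (0 : ℝ), ENNReal.ofReal (r ^ 2) * ∫⁻ ω, F (pt (2 * u + r) r ω) ∂sphM := by
  rw [coneI, ← lintegral_indicator measurableSet_Ioi, ← lintegral_indicator measurableSet_Ioi,
    ← lintegral_add_left_eq_self _ u]
  refine lintegral_congr fun r => ?_
  simp only [indicator, mem_Ioi, lt_add_iff_pos_right, add_sub_cancel_left]
  rw [show u + (u + r) = 2 * u + r by ring]

lemma lintegral_coneI_div_le {F : V → ℝ≥0∞} (hF : Measurable F) (R : ℝ) :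
    ∫⁻ τ : ℝ, coneI F ((τ - R) / 2) ≤ 20736 * ∫⁻ p, F p := by
  rw [lintegral_sub_right_eq_self (fun τ => coneI F (τ / 2)) R]
  refine le_trans (le_of_eq (lintegral_congr fun τ => ?_)) (polar_V_cone_le hF)
  rw [coneI_eq, mul_div_cancel₀ _ two_ne_zero]

lemma lintegral_coneI_le {F : V → ℝ≥0∞} (hF : Measurable F) :
    ∫⁻ u : ℝ, coneI F u ≤ 20736 * ∫⁻ p, F p := by
  have h := lintegral_coneI_div_le hF 0
  have e : ∫⁻ u : ℝ, coneI F u ≤ ∫⁻ τ : ℝ, coneI F ((τ - 0) / 2) := by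
    have hv : ENNReal.ofReal |2| • Measure.map (Homeomorph.mulLeft₀ (2 : ℝ) two_ne_zero) volume =
      volume := Real.smul_map_volume_mul_left two_ne_zero
    conv_rhs => rw [← hv]
    rw [lintegral_smul_measure, (Homeomorph.mulLeft₀ (2 : ℝ) two_ne_zero).measurableEmbedding.lintegral_map]
    simp only [Homeomorph.coe_mulLeft₀, sub_zero, mul_div_cancel_left₀ _ (two_ne_zero (α := ℝ)),
      abs_two, ENNReal.ofReal_ofNat, smul_eq_mul]
    exact le_mul_of_one_le_left' one_le_two
  exact e.trans h

end Cones

section Coordinates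

lemma measurable_rad : Measurable rad := by
  unfold rad
  fun_prop

lemma measurable_tC : Measurable tC := measurable_pi_apply 0

lemma measurable_uC : Measurable uC := (measurable_tC.sub measurable_rad).div_const 2

lemma measurable_vC : Measurable vC := (measurable_tC.add measurable_rad).div_const 2

lemma measurable_sigP (R : ℝ) : Measurable (sigP R) :=
  Measurable.ite (measurable_rad measurableSet_Iic) measurable_tC
    ((measurable_uC.const_mul 2).add_const R)

lemma measurableSet_Dint (R τ₁ τ₂ : ℝ) : MeasurableSet (Dint R τ₁ τ₂) :=
  (measurable_tC measurableSet_Ici).inter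
    ((measurable_sigP R measurableSet_Ici).inter (measurable_sigP R measurableSet_Iic))

lemma measurableSet_DbarInt (R τ₁ τ₂ : ℝ) : MeasurableSet (DbarInt R τ₁ τ₂) :=
  (measurableSet_Dint R τ₁ τ₂).inter (measurable_rad measurableSet_Ici)

lemma measurableSet_Dext (R τ₁ τ₂ : ℝ) : MeasurableSet (Dext R τ₁ τ₂) :=
  (measurable_tC measurableSet_Ici).inter
    ((measurable_uC measurableSet_Iic).inter (measurable_vC measurableSet_Iic))

variable {t r : ℝ} {ω : E3}

lemma rad_pt (hω : ‖ω‖ = 1) (hr : 0 ≤ r) : rad (pt t r ω) = r := by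
  have h := sum_sq_eq_one hω
  have : ∑ i : Fin 3, (pt t r ω i.succ) ^ 2 = r ^ 2 := by
    simp [Fin.sum_univ_three, pt]
    linear_combination r ^ 2 * h
  rw [rad, this, Real.sqrt_sq hr]

lemma tC_pt : tC (pt t r ω) = t := rfl

lemma uC_pt (hω : ‖ω‖ = 1) (hr : 0 ≤ r) : uC (pt t r ω) = (t - r) / 2 := by
  rw [uC, rad_pt hω hr, tC_pt]

lemma vC_pt (hω : ‖ω‖ = 1) (hr : 0 ≤ r) : vC (pt t r ω) = (t + r) / 2 := by
  rw [vC, rad_pt hω hr, tC_pt]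

lemma Lv_pt (hω : ‖ω‖ = 1) (hr : 0 < r) : Lv (pt t r ω) = outV ω := by
  rw [Lv, rad_pt hω hr.le]
  ext i
  fin_cases i <;> simp [outV, pt, hr.ne']

lemma FJcontr_Lv_pt (A : V → Fin 4 → ℝ) (φ : V → ℂ) (hω : ‖ω‖ = 1) (hr : 0 < r) :
    FJcontr (curv A) A φ Lv (pt t r ω) = contrFJ A φ (pt t r ω) (outV ω) := by
  rw [FJcontr, Lv_pt hω hr, contrFJ]

end Coordinates

section Densities

variable {A : V → Fin 4 → ℝ} {φ : V → ℂ} {t r : ℝ} {ω : E3}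

lemma hasFDerivAt_rad {p : V} (hp : rad p ≠ 0) :
    HasFDerivAt rad ((1 / (2 * rad p)) •
      ∑ i : Fin 3, (2 * p i.succ) • (ContinuousLinearMap.proj i.succ : V →L[ℝ] ℝ)) p := by
  have h : ∀ i ∈ (Finset.univ : Finset (Fin 3)), HasFDerivAt (fun q : V => q i.succ ^ 2)
      ((2 * p i.succ) • (ContinuousLinearMap.proj i.succ : V →L[ℝ] ℝ)) p := fun i _ => by
    simpa using (ContinuousLinearMap.proj (R := ℝ) (φ := fun _ : Fin 4 => ℝ) i.succ).hasFDerivAt.pow 2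
  refine (HasFDerivAt.fun_sum h).sqrt fun h0 => hp ?_
  rw [rad, h0, Real.sqrt_zero]

lemma covD_psi {p : V} (hp : rad p ≠ 0) (hφ : DifferentiableAt ℝ φ p) (μ : Fin 4) :
    covD A μ (psi φ) p = rad p * covD A μ φ p + (rv p μ : ℂ) * φ p := by
  have h := ((Complex.ofRealCLM.hasFDerivAt.comp p (hasFDerivAt_rad hp)).mul
    hφ.hasFDerivAt).fderiv
  have e : (((⇑Complex.ofRealCLM ∘ rad) * φ : V → ℂ)) = psi φ := rfl
  rw [e] at h
  have h0 : (rad p : ℂ) ≠ 0 := by exact_mod_cast hp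
  have k : pdC μ (psi φ) p = rad p * pdC μ φ p + (rv p μ : ℂ) * φ p := by
    rw [pdC, h, pdC]
    fin_cases μ <;>
      simp [Fin.sum_univ_three, rv, Fin.succ, Fin.ext_iff] <;> field_simp
  rw [covD, k, covD, psi]
  ring

lemma dirD_psi {p X : V} (hp : rad p ≠ 0) (hφ : DifferentiableAt ℝ φ p) :
    dirD A X (psi φ) p = rad p * dirD A X φ p + ((∑ μ, X μ * rv p μ : ℝ) : ℂ) * φ p := by
  simp only [dirD, covD_psi hp hφ, mul_add, Finset.sum_add_distrib, Finset.mul_sum,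
    Complex.ofReal_sum, Complex.ofReal_mul, Finset.sum_mul]
  congr 1 <;> exact Finset.sum_congr rfl fun _ _ => by ring

lemma rv_pt (hω : ‖ω‖ = 1) (hr : 0 < r) : rv (pt t r ω) = spV ω := by
  rw [rv, rad_pt hω hr.le]
  ext i
  fin_cases i <;> simp [spV, pt, hr.ne']

lemma eDL_pt (hω : ‖ω‖ = 1) (hr : 0 < r) :
    eDL A φ (pt t r ω) = ‖dirD A (outV ω) φ (pt t r ω)‖ ^ 2 := by
  rw [eDL, Lv_pt hω hr]

lemma eDL_psi_pt (hφ : Differentiable ℝ φ) (hω : ‖ω‖ = 1) (hr : 0 < r) :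
    eDL A (psi φ) (pt t r ω) = ‖radD A φ t r ω‖ ^ 2 := by
  have h : ∑ μ, outV ω μ * spV ω μ = 1 := by
    simp [Fin.sum_univ_four, outV, spV]
    linear_combination sum_sq_eq_one hω
  rw [eDL_pt hω hr, dirD_psi (by rw [rad_pt hω hr.le]; exact hr.ne') (hφ _), rv_pt hω hr, h,
    rad_pt hω hr.le, radD, Complex.ofReal_one, one_mul]

lemma dirD_eq_ip (X : V) (p : V) : ‖dirD A X φ p‖ ^ 2 =
    (∑ μ, X μ * (covD A μ φ p).re) ^ 2 + (∑ μ, X μ * (covD A μ φ p).im) ^ 2 := by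
  rw [← Complex.normSq_eq_norm_sq, Complex.normSq_apply, dirD, Complex.re_sum, Complex.im_sum]
  simp only [Complex.re_ofReal_mul, Complex.im_ofReal_mul, sq]

lemma Pv_pt (hω : ‖ω‖ = 1) (hr : 0 < r) (j : Fin 3) (μ : Fin 4) :
    Pv (pt t r ω) j μ = if μ = 0 then 0 else (if μ = j.succ then 1 else 0) - ω j * spV ω μ := by
  rw [Pv, rad_pt hω hr.le]
  have := hr.ne'
  fin_cases μ <;> fin_cases j <;> simp [pt, spV, Fin.ext_iff] <;> field_simp

lemma eDslash_pt (hω : ‖ω‖ = 1) (hr : 0 < r) : eDslash A φ (pt t r ω) =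
    pairSum fun i j => ‖dirD A (spV (rotGen i j ω)) φ (pt t r ω)‖ ^ 2 := by
  have h := sum_sq_eq_one hω
  simp only [eDslash, pairSum, dirD_eq_ip, rotGen_01, rotGen_02, rotGen_12, Fin.sum_univ_three,
    Fin.sum_univ_four, Pv_pt hω hr]
  simp [spV, Fin.ext_iff]
  generalize (covD A 1 φ (pt t r ω)).re = a1
  generalize (covD A 2 φ (pt t r ω)).re = a2
  generalize (covD A 3 φ (pt t r ω)).re = a3
  generalize (covD A 1 φ (pt t r ω)).im = b1
  generalize (covD A 2 φ (pt t r ω)).im = b2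
  generalize (covD A 3 φ (pt t r ω)).im = b3
  generalize ω 0 = x at *
  generalize ω 1 = y at *
  generalize ω 2 = z at *
  linear_combination ((x * a1 + y * a2 + z * a3) ^ 2 - (a1 ^ 2 + a2 ^ 2 + a3 ^ 2)
    + ((x * b1 + y * b2 + z * b3) ^ 2 - (b1 ^ 2 + b2 ^ 2 + b3 ^ 2))) * h

lemma eDslash_psi_pt (hφ : Differentiable ℝ φ) (hω : ‖ω‖ = 1) (hr : 0 < r) :
    r ^ 2 * eDslash A (psi φ) (pt t r ω) =
      pairSum fun i j => ip (angD A φ i j t r ω) (angD A φ i j t r ω) := by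
  have hrad := rad_pt (t := t) hω hr.le
  have k : ∀ i j, dirD A (spV (rotGen i j ω)) (psi φ) (pt t r ω) =
      r * dirD A (spV (rotGen i j ω)) φ (pt t r ω) := fun i j => by
    have h : ∑ μ, spV (rotGen i j ω) μ * spV ω μ = 0 := by
      fin_cases i <;> fin_cases j <;> simp [Fin.sum_univ_four, rotGen, spV] <;> ring
    rw [dirD_psi (by rw [hrad]; exact hr.ne') (hφ _), rv_pt hω hr, h, hrad]
    simp
  rw [eDslash_pt hω hr]
  simp only [pairSum, k, ip_self, angD, norm_mul, norm_pow, Complex.norm_real, Real.norm_eq_abs,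
    mul_pow, sq_abs]
  ring

end Densities

section Comparison

variable {A : V → Fin 4 → ℝ} {φ : V → ℂ} {ε p u v : ℝ}

lemma sphI_le_sphAv {F : V → ℝ} {f : ℝ → ℝ → E3 → ℝ} {c : ℝ} (hf : Continuous (f u v))
    (h0 : ∀ ω, 0 ≤ f u v ω) (hc : 0 ≤ c)
    (h : ∀ ω, ‖ω‖ = 1 → F (pt (u + v) (v - u) ω) ≤ c * f u v ω) :
    sphI F (u + v) (v - u) ≤ ENNReal.ofReal c * ENNReal.ofReal (sphAv f (u, v)) := by
  rw [ofReal_sphAv hf h0, ← lintegral_const_mul' _ _ ENNReal.ofReal_ne_top, sphI, sphLInt_eq]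
  refine lintegral_mono_ae (ae_sphM_norm.mono fun ω hω => ?_)
  rw [← ENNReal.ofReal_mul hc]
  exact ENNReal.ofReal_le_ofReal (h ω hω)

lemma ofReal_sphAv_le {H : E3 → ℝ≥0∞} {f : ℝ → ℝ → E3 → ℝ} (hf : Continuous (f u v))
    (h0 : ∀ ω, 0 ≤ f u v ω) (h : ∀ ω, ‖ω‖ = 1 → ENNReal.ofReal (f u v ω) ≤ H ω) :
    ENNReal.ofReal (sphAv f (u, v)) ≤ ∫⁻ ω, H ω ∂sphM := by
  rw [ofReal_sphAv hf h0]
  exact lintegral_mono_ae (ae_sphM_norm.mono h)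

lemma ofReal_sphAv_le_sphI {F : V → ℝ} {f : ℝ → ℝ → E3 → ℝ} {c : ℝ} (hf : Continuous (f u v))
    (h0 : ∀ ω, 0 ≤ f u v ω) (hc : 0 ≤ c)
    (h : ∀ ω, ‖ω‖ = 1 → f u v ω ≤ c * F (pt (u + v) (v - u) ω)) :
    ENNReal.ofReal (sphAv f (u, v)) ≤ ENNReal.ofReal c * sphI F (u + v) (v - u) := by
  rw [sphI, sphLInt_eq, ← lintegral_const_mul' _ _ ENNReal.ofReal_ne_top]
  refine ofReal_sphAv_le hf h0 fun ω hω => ?_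
  rw [oR, ← ENNReal.ofReal_mul hc]
  exact ENNReal.ofReal_le_ofReal (h ω hω)

lemma rpow_mul_eDL_le (hε : 0 < ε) (hp : 0 ≤ p) (hp2 : p ≤ 2) (hφ : Differentiable ℝ φ)
    (hr : 1 ≤ v - u) {ω : E3} (hω : ‖ω‖ = 1) :
    rad (pt (u + v) (v - u) ω) ^ p * eDL A (psi φ) (pt (u + v) (v - u) ω) ≤
      2 * fluxP A φ (gW ε) (qW ε p) u v ω := by
  have hr0 : 0 < v - u := by linarith
  rw [eDL_psi_pt hφ hω hr0, rad_pt hω hr0.le, fluxP, ip_self]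
  have h1 := (sq_mul_qW_bounds hε hp hp2 hr).1
  have h2 : 0 ≤ (v - u) ^ 2 * qW ε p (v - u) := mul_nonneg (sq_nonneg _) (qW_nonneg hε hp hp2 _)
  have h3 := le_mul_of_one_le_left h2 (gW_mem hε u).1
  rw [← mul_assoc]
  exact mul_le_mul_of_nonneg_right (by linarith) (sq_nonneg _)

lemma rpow_mul_eDslash_le (hε : 0 < ε) (hp : 0 ≤ p) (hp2 : p ≤ 2) (hφ : Differentiable ℝ φ)
    (hr : 1 ≤ v - u) {ω : E3} (hω : ‖ω‖ = 1) :
    rad (pt (u + v) (v - u) ω) ^ p * eDslash A (psi φ) (pt (u + v) (v - u) ω) ≤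
      2 * fluxQ A φ (gW ε) (qW ε p) u v ω := by
  have hr0 : 0 < v - u := by linarith
  rw [rad_pt hω hr0.le, fluxQ, ← eDslash_psi_pt hφ hω hr0]
  have h1 := (sq_mul_qW_bounds hε hp hp2 hr).1
  have h2 : 0 ≤ (v - u) ^ 2 * qW ε p (v - u) := mul_nonneg (sq_nonneg _) (qW_nonneg hε hp hp2 _)
  have h3 := le_mul_of_one_le_left h2 (gW_mem hε u).1
  have h4 : 0 ≤ eDslash A (psi φ) (pt (u + v) (v - u) ω) := Finset.sum_nonneg fun _ _ => sq_nonneg _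
  have := mul_le_mul_of_nonneg_right (h1.trans (mul_le_mul_of_nonneg_left h3 zero_le_two)) h4
  linarith

lemma rpow_mul_bulk_le (hε : 0 < ε) (hp : 0 ≤ p) (hp2 : p ≤ 2) (hφ : Differentiable ℝ φ)
    (hr : 1 ≤ v - u) {ω : E3} (hω : ‖ω‖ = 1) :
    rad (pt (u + v) (v - u) ω) ^ (p - 1) * (p * eDL A (psi φ) (pt (u + v) (v - u) ω) +
      (2 - p) * eDslash A (psi φ) (pt (u + v) (v - u) ω)) ≤ 8 * bulkD A φ ε p u v ω := by
  have hr0 : 0 < v - u := by linarith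
  rw [rad_pt hω hr0.le, bulkD, ← eDslash_psi_pt hφ hω hr0, eDL_psi_pt hφ hω hr0, ip_self]
  have h1 := deriv_weight_lower_rpow hε hp hp2 hr
  have k1 := qW'_lower hε hp hp2 hr
  have hK : 0 ≤ 2 * (v - u) * qW ε p (v - u) + (v - u) ^ 2 * qW' ε p (v - u) :=
    le_trans (by positivity) (deriv_weight_lower hε hp hp2 hr0.le).1
  have hq : 0 ≤ (v - u) ^ 2 * -qW' ε p (v - u) :=
    mul_nonneg (sq_nonneg _) (by linarith [qW'_nonpos hε hp hp2 hr0.le])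
  have hg := (gW_mem hε u).1
  have e1 := le_mul_of_one_le_left hK hg
  have e2 := le_mul_of_one_le_left hq hg
  have h4 : 0 ≤ eDslash A (psi φ) (pt (u + v) (v - u) ω) := Finset.sum_nonneg fun _ _ => sq_nonneg _
  have f1 := mul_le_mul_of_nonneg_right (h1.trans (mul_le_mul_of_nonneg_left e1 zero_le_two))
    (sq_nonneg ‖radD A φ (u + v) (v - u) ω‖)
  have f2 := mul_le_mul_of_nonneg_right (k1.trans (mul_le_mul_of_nonneg_left e2 (by norm_num))) h4
  have f3 := mul_nonneg (mul_nonneg (zero_le_one.trans hg) hK)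
    (sq_nonneg ‖radD A φ (u + v) (v - u) ω‖)
  linarith

lemma fluxP_le (hε : 0 < ε) (hp : 0 ≤ p) (hp2 : p ≤ 2) (hφ : Differentiable ℝ φ)
    (hr : 1 ≤ v - u) {ω : E3} (hω : ‖ω‖ = 1) :
    fluxP A φ (gW ε) (qW ε p) u v ω ≤ 2 * (1 + 2 * massW ε) *
      (rad (pt (u + v) (v - u) ω) ^ p * eDL A (psi φ) (pt (u + v) (v - u) ω)) := by
  have hr0 : 0 < v - u := by linarith
  rw [eDL_psi_pt hφ hω hr0, rad_pt hω hr0.le, fluxP, ip_self]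
  have h1 := (sq_mul_qW_bounds hε hp hp2 hr).2
  have h2 : 0 ≤ (v - u) ^ 2 * qW ε p (v - u) := mul_nonneg (sq_nonneg _) (qW_nonneg hε hp hp2 _)
  have hm := massW_nonneg (ε := ε)
  have h3 := mul_le_mul (gW_mem hε u).2 h1 h2 (by linarith)
  have := mul_le_mul_of_nonneg_right h3 (sq_nonneg ‖radD A φ (u + v) (v - u) ω‖)
  linarith

lemma fluxQ_le (hε : 0 < ε) (hp : 0 ≤ p) (hp2 : p ≤ 2) (hφ : Differentiable ℝ φ)
    (hr : 1 ≤ v - u) {ω : E3} (hω : ‖ω‖ = 1) :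
    fluxQ A φ (gW ε) (qW ε p) u v ω ≤ 2 * (1 + 2 * massW ε) *
      (rad (pt (u + v) (v - u) ω) ^ p * eDslash A (psi φ) (pt (u + v) (v - u) ω)) := by
  have hr0 : 0 < v - u := by linarith
  rw [rad_pt hω hr0.le, fluxQ, ← eDslash_psi_pt hφ hω hr0]
  have h1 := (sq_mul_qW_bounds hε hp hp2 hr).2
  have h2 : 0 ≤ (v - u) ^ 2 * qW ε p (v - u) := mul_nonneg (sq_nonneg _) (qW_nonneg hε hp hp2 _)
  have hm := massW_nonneg (ε := ε)
  have h3 := mul_le_mul (gW_mem hε u).2 h1 h2 (by linarith)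
  have h4 : 0 ≤ eDslash A (psi φ) (pt (u + v) (v - u) ω) := Finset.sum_nonneg fun _ _ => sq_nonneg _
  have := mul_le_mul_of_nonneg_right h3 h4
  linarith

/-- Spacetime density dominating the error term, with weight `h` on the curvature contraction. -/
def majE (A : V → Fin 4 → ℝ) (φ : V → ℂ) (ε p : ℝ) (h : V → ℝ) (x : V) : ℝ :=
  4 * (1 + 2 * massW ε) ^ 2 / (ε / (2 * (1 + ε))) *
      (uplus x ^ min (1 + ε) p * rplus x ^ max (1 + ε) p * ‖boxA A φ x‖ ^ 2)
    + 4 * (1 + 2 * massW ε) * (h x * |FJcontr (curv A) A φ Lv x|)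

lemma errD_le_of_weight (hε : 0 < ε) {h : V → ℝ} (hr : 0 < v - u) {ω : E3} (hω : ‖ω‖ = 1)
    (hq0 : 0 ≤ qW ε p (v - u))
    (hq : (v - u) ^ 2 * qW ε p (v - u) ≤ 2 * h (pt (u + v) (v - u) ω)) :
    errD A φ ε p u v ω ≤ (v - u) ^ 2 * majE A φ ε p h (pt (u + v) (v - u) ω) := by
  have hu : uplus (pt (u + v) (v - u) ω) = 1 + |u| := by
    rw [uplus, uC_pt hω hr.le]; ring_nf
  rw [majE, rplus, hu, rad_pt hω hr.le, FJcontr_Lv_pt A φ hω hr, errD, abs_of_pos hr, srcW]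
  have hm := massW_nonneg (ε := ε)
  have h2 : 0 ≤ (v - u) ^ 2 * qW ε p (v - u) := mul_nonneg (sq_nonneg _) hq0
  have h3 := mul_le_mul (gW_mem hε u).2 hq h2 (by linarith)
  have := mul_le_mul_of_nonneg_right h3 (mul_nonneg (sq_nonneg (v - u))
    (abs_nonneg (contrFJ A φ (pt (u + v) (v - u) ω) (outV ω))))
  linarith

lemma errD_le_rpow (hε : 0 < ε) (hp : 0 ≤ p) (hp2 : p ≤ 2) (hr : 1 ≤ v - u) {ω : E3}
    (hω : ‖ω‖ = 1) : errD A φ ε p u v ω ≤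
      (v - u) ^ 2 * majE A φ ε p (fun x => rad x ^ p) (pt (u + v) (v - u) ω) := by
  have hr0 : 0 < v - u := by linarith
  refine errD_le_of_weight hε hr0 hω (qW_nonneg hε hp hp2 _) ?_
  rw [rad_pt hω hr0.le]
  exact (sq_mul_qW_bounds hε hp hp2 hr).2

lemma errD_le_const (hε : 0 < ε) (hp : 0 ≤ p) (hp2 : p ≤ 2) (hr0 : 0 < v - u) {R : ℝ}
    (hr : v - u ≤ R) {ω : E3} (hω : ‖ω‖ = 1) : errD A φ ε p u v ω ≤
      (v - u) ^ 2 * majE A φ ε p (fun _ => R ^ 2) (pt (u + v) (v - u) ω) := by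
  refine errD_le_of_weight hε hr0 hω (qW_nonneg hε hp hp2 _) ?_
  rw [mul_comm 2]
  exact mul_le_mul (pow_le_pow_left₀ hr0.le hr 2) (qW_le_two hε hp hp2 _)
    (qW_nonneg hε hp hp2 _) (sq_nonneg R)

lemma measurable_Lv : Measurable Lv := by
  have h := fun j : Fin 4 => (measurable_pi_apply (X := fun _ : Fin 4 => ℝ) j).div measurable_rad
  refine measurable_pi_iff.2 fun i => ?_
  match i with
  | 0 => exact measurable_const
  | 1 => exact h 1
  | 2 => exact h 2
  | 3 => exact h 3

lemma measurable_FJcontr_Lv (hA : ContDiff ℝ (⊤ : ℕ∞) A) (hφ : ContDiff ℝ (⊤ : ℕ∞) φ) :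
    Measurable (FJcontr (curv A) A φ Lv) := by
  have key : ∀ f : V → V → ℝ, (Measurable fun z : V × V => f z.1 z.2) →
      Measurable fun x => f x (Lv x) :=
    fun f hf => hf.comp (measurable_id.prodMk measurable_Lv)
  have hc : Continuous fun z : V × V => contrFJ A φ z.1 z.2 :=
    continuous_contrFJ hA hφ continuous_fst continuous_snd
  have e : FJcontr (curv A) A φ Lv = fun x => contrFJ A φ x (Lv x) := by
    funext x
    rw [FJcontr, contrFJ]
  rw [e]
  exact key (contrFJ A φ) hc.measurable

lemma measurable_majE (hA : ContDiff ℝ (⊤ : ℕ∞) A) (hφ : ContDiff ℝ (⊤ : ℕ∞) φ)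
    {h : V → ℝ} (hh : Measurable h) : Measurable (majE A φ ε p h) := by
  have hu : Measurable uplus := (measurable_uC.norm).const_add 1
  have hr : Measurable rplus := measurable_rad.const_add 1
  have hB := ((continuous_boxA hA hφ).norm.pow 2).measurable
  have hF : Measurable fun x => |FJcontr (curv A) A φ Lv x| := (measurable_FJcontr_Lv hA hφ).norm
  exact ((((hu.pow_const _).mul (hr.pow_const _)).mul hB).const_mul _).add
    ((hh.mul hF).const_mul _)

lemma setLIntegral_majE_le (hA : ContDiff ℝ (⊤ : ℕ∞) A) (hφ : ContDiff ℝ (⊤ : ℕ∞) φ) (hε : 0 < ε)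
    {h : V → ℝ} (D : Set V) :
    ∫⁻ x in D, ENNReal.ofReal (majE A φ ε p h x) ≤
      ENNReal.ofReal (4 * (1 + 2 * massW ε) ^ 2 / (ε / (2 * (1 + ε)))) *
        wI (max (1 + ε) p) (min (1 + ε) p) (fun x => ‖boxA A φ x‖ ^ 2) D +
      ENNReal.ofReal (4 * (1 + 2 * massW ε)) *
        ∫⁻ x in D, oR (h x * |FJcontr (curv A) A φ Lv x|) := by
  have hm := massW_nonneg (ε := ε)
  have hu : Measurable uplus := (measurable_uC.norm).const_add 1
  have hr : Measurable rplus := measurable_rad.const_add 1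
  have hB := ((continuous_boxA hA hφ).norm.pow 2).measurable
  rw [wI, ← lintegral_const_mul' _ _ ENNReal.ofReal_ne_top,
    ← lintegral_const_mul' _ _ ENNReal.ofReal_ne_top, ← lintegral_add_left]
  · refine lintegral_mono fun x => ?_
    dsimp only [oR]
    rw [← ENNReal.ofReal_mul (by positivity), ← ENNReal.ofReal_mul (by positivity)]
    exact ENNReal.ofReal_add_le
  · exact (((hu.pow_const _).mul (hr.pow_const _)).mul hB).ennreal_ofReal.const_mul _

end Comparison

section ErrorIntegrals

variable {A : V → Fin 4 → ℝ} {φ : V → ℂ} {ε p u v R τ₁ τ₂ : ℝ}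

lemma continuous_sphere_slice {f : ℝ → ℝ → E3 → ℝ}
    (hf : Continuous fun z : (ℝ × ℝ) × E3 => f z.1.1 z.1.2 z.2) (u v : ℝ) : Continuous (f u v) :=
  hf.comp (continuous_const.prodMk continuous_id : Continuous fun ω : E3 => ((u, v), ω))

lemma ofReal_sphAv_errD_le (hA : ContDiff ℝ (⊤ : ℕ∞) A) (hφ : ContDiff ℝ (⊤ : ℕ∞) φ)
    (hε : 0 < ε) (hp : 0 ≤ p) (hp2 : p ≤ 2) {D : Set V} {h : V → ℝ}
    (hD : ∀ ω, ‖ω‖ = 1 → pt (u + v) (v - u) ω ∈ D)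
    (hE : ∀ ω, ‖ω‖ = 1 → errD A φ ε p u v ω ≤
      (v - u) ^ 2 * majE A φ ε p h (pt (u + v) (v - u) ω)) :
    ENNReal.ofReal (sphAv (errD A φ ε p) (u, v)) ≤ ENNReal.ofReal ((v - u) ^ 2) *
      ∫⁻ ω, D.indicator (fun x => ENNReal.ofReal (majE A φ ε p h x))
        (pt (u + v) (v - u) ω) ∂sphM := by
  rw [← lintegral_const_mul' _ _ ENNReal.ofReal_ne_top]
  refine ofReal_sphAv_le (continuous_sphere_slice (continuous_errD hA hφ) u v)
    (errD_nonneg hε hp hp2 u v) fun ω hω => ?_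
  rw [indicator_of_mem (hD ω hω), ← ENNReal.ofReal_mul (sq_nonneg _)]
  exact ENNReal.ofReal_le_ofReal (hE ω hω)

lemma measurable_indicator_majE (hA : ContDiff ℝ (⊤ : ℕ∞) A) (hφ : ContDiff ℝ (⊤ : ℕ∞) φ)
    {h : V → ℝ} (hh : Measurable h) {D : Set V} (hD : MeasurableSet D) :
    Measurable (D.indicator fun x => ENNReal.ofReal (majE A φ ε p h x)) :=
  (measurable_majE hA hφ hh).ennreal_ofReal.indicator hD

lemma lintegral_errD_ball_le (hA : ContDiff ℝ (⊤ : ℕ∞) A) (hφ : ContDiff ℝ (⊤ : ℕ∞) φ)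
    (hε : 0 < ε) (hp : 0 ≤ p) (hp2 : p ≤ 2) (hτ₁ : 0 ≤ τ₁) :
    ∫⁻ t in Icc τ₁ τ₂, ∫⁻ r in Icc 0 R,
        ENNReal.ofReal (sphAv (errD A φ ε p) ((t - r) / 2, (t + r) / 2)) ≤
      20736 * ∫⁻ x in Dint R τ₁ τ₂, ENNReal.ofReal (majE A φ ε p (fun _ => R ^ 2) x) := by
  have hD := measurableSet_Dint R τ₁ τ₂
  rw [← lintegral_indicator hD]
  refine le_trans ?_ (polar_V_le (measurable_indicator_majE hA hφ measurable_const hD))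
  refine le_trans ?_ (setLIntegral_le_lintegral (Icc τ₁ τ₂) _)
  refine setLIntegral_mono' measurableSet_Icc fun t ht => ?_
  rw [setLIntegral_congr Ioc_ae_eq_Icc.symm]
  refine le_trans ?_ (lintegral_mono_set (Ioc_subset_Ioi_self : Ioc 0 R ⊆ Ioi 0))
  refine setLIntegral_mono' measurableSet_Ioc fun r hr => ?_
  have e1 : (t - r) / 2 + (t + r) / 2 = t := by ring
  have e2 : (t + r) / 2 - (t - r) / 2 = r := by ring
  have key := ofReal_sphAv_errD_le (u := (t - r) / 2) (v := (t + r) / 2) hA hφ hε hp hp2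
    (D := Dint R τ₁ τ₂) (h := fun _ => R ^ 2) (fun ω hω => ?_)
    fun ω hω => errD_le_const hε hp hp2 (by rw [e2]; exact hr.1) (by rw [e2]; exact hr.2) hω
  · rwa [e1, e2] at key
  · have hs : sigP R (pt t r ω) = t := by
      rw [sigP, rad_pt hω hr.1.le, if_pos hr.2, tC_pt]
    rw [e1, e2]
    exact ⟨hτ₁.trans ht.1, by rw [hs]; exact ht.1, by rw [hs]; exact ht.2⟩

lemma lintegral_errD_cones_le (hA : ContDiff ℝ (⊤ : ℕ∞) A) (hφ : ContDiff ℝ (⊤ : ℕ∞) φ)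
    (hε : 0 < ε) (hp : 0 ≤ p) (hp2 : p ≤ 2) (hR : 1 ≤ R) (hτ₁ : 0 ≤ τ₁) :
    ∫⁻ t in Icc τ₁ τ₂, ∫⁻ v in Ici ((t + R) / 2),
        ENNReal.ofReal (sphAv (errD A φ ε p) ((t - R) / 2, v)) ≤
      20736 * ∫⁻ x in DbarInt R τ₁ τ₂, ENNReal.ofReal (majE A φ ε p (fun x => rad x ^ p) x) := by
  have hD := measurableSet_DbarInt R τ₁ τ₂
  rw [← lintegral_indicator hD]
  refine le_trans ?_ (lintegral_coneI_div_le
    (measurable_indicator_majE hA hφ (measurable_rad.pow_const p) hD) R)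
  refine le_trans ?_ (setLIntegral_le_lintegral (Icc τ₁ τ₂) _)
  refine setLIntegral_mono' measurableSet_Icc fun t ht => ?_
  refine le_trans ?_ (lintegral_mono_set (Ici_subset_Ioi.2 (by linarith : (t - R) / 2 < (t + R) / 2)))
  refine setLIntegral_mono' measurableSet_Ici fun v hv => ?_
  have hr : R ≤ v - (t - R) / 2 := by linarith [mem_Ici.1 hv]
  have hr0 : 0 ≤ v - (t - R) / 2 := by linarith
  refine ofReal_sphAv_errD_le hA hφ hε hp hp2 (fun ω hω => ?_)
    fun ω hω => errD_le_rpow hε hp hp2 (hR.trans hr) hω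
  have hs : sigP R (pt ((t - R) / 2 + v) (v - (t - R) / 2) ω) = t := by
    rw [sigP, rad_pt hω hr0, uC_pt hω hr0, tC_pt]
    split_ifs with h
    · linarith
    · ring
  refine ⟨⟨?_, by rw [hs]; exact ht.1, by rw [hs]; exact ht.2⟩, by simpa [rad_pt hω hr0] using hr⟩
  rw [tC_pt]
  linarith [mem_Ici.1 hv, ht.1]

lemma lintegral_errD_ext_le (hA : ContDiff ℝ (⊤ : ℕ∞) A) (hφ : ContDiff ℝ (⊤ : ℕ∞) φ)
    (hε : 0 < ε) (hp : 0 ≤ p) (hp2 : p ≤ 2) (hR : 1 ≤ R) (hτ₁ : τ₁ ≤ 0) :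
    ∫⁻ u in Icc ((τ₂ - R) / 2) ((τ₁ - R) / 2), ∫⁻ v in Icc (-u) (-((τ₂ - R) / 2)),
        ENNReal.ofReal (sphAv (errD A φ ε p) (u, v)) ≤
      20736 * ∫⁻ x in Dext R τ₁ τ₂, ENNReal.ofReal (majE A φ ε p (fun x => rad x ^ p) x) := by
  have hD := measurableSet_Dext R τ₁ τ₂
  rw [← lintegral_indicator hD]
  refine le_trans ?_ (lintegral_coneI_le
    (measurable_indicator_majE hA hφ (measurable_rad.pow_const p) hD))
  refine le_trans ?_ (setLIntegral_le_lintegral (Icc ((τ₂ - R) / 2) ((τ₁ - R) / 2)) _)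
  refine setLIntegral_mono' measurableSet_Icc fun u hu => ?_
  have h0 : u ≤ -1 / 2 := by linarith [hu.2]
  refine le_trans ?_ (lintegral_mono_set (s := Icc (-u) (-((τ₂ - R) / 2)))
    fun v hv => mem_Ioi.2 (by linarith [hv.1]))
  refine setLIntegral_mono' measurableSet_Icc fun v hv => ?_
  have hr : 1 ≤ v - u := by linarith [hv.1]
  have hr0 : 0 ≤ v - u := by linarith
  refine ofReal_sphAv_errD_le hA hφ hε hp hp2 (fun ω hω => ?_)
    fun ω hω => errD_le_rpow hε hp hp2 hr hω
  refine ⟨?_, ?_, ?_⟩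
  · rw [tC_pt]; linarith [hv.1]
  · rw [uC_pt hω hr0]; linarith [hu.2]
  · rw [vC_pt hω hr0]; linarith [hv.2]

end ErrorIntegrals

section Hardy

lemma two_mul_abs_le_of_sq_le {a b d f D : ℝ} (hf : 0 ≤ f) (hD : 0 ≤ D)
    (hd : d ^ 2 ≤ f * D) : |2 * (a * b) * d| ≤ a ^ 2 * f + b ^ 2 * D := by
  refine abs_le_of_sq_le_sq ?_ (by positivity)
  nlinarith [sq_nonneg (a ^ 2 * f - b ^ 2 * D), mul_le_mul_of_nonneg_left hd (by positivity :
    0 ≤ 4 * (a * b) ^ 2)]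

/-- Weighted one-dimensional estimate of a function by its boundary value and derivative. -/
lemma two_mul_integral_sq_mul_le {f d D : ℝ → ℝ} {R : ℝ} (hR : 0 ≤ R)
    (hf : ∀ r, HasDerivAt f (2 * d r) r) (hdc : Continuous d) (hDc : Continuous D)
    (hf0 : ∀ r, 0 ≤ f r) (hD0 : ∀ r, 0 ≤ D r) (hd : ∀ r, d r ^ 2 ≤ f r * D r) :
    2 * ∫ r in (0 : ℝ)..R, r ^ 2 * f r ≤
      R ^ 3 * f R + R ^ 2 * ∫ r in (0 : ℝ)..R, r ^ 2 * D r := by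
  have hfc : Continuous f := continuous_iff_continuousAt.2 fun r => (hf r).continuousAt
  have hg : ∀ r, HasDerivAt (fun r => r ^ 3 * f r) (3 * r ^ 2 * f r + r ^ 3 * (2 * d r)) r :=
    fun r => by simpa using (hasDerivAt_pow 3 r).fun_mul (hf r)
  have hI := intervalIntegral.integral_eq_sub_of_hasDerivAt (a := 0) (b := R) (fun r _ => hg r)
    ((by fun_prop : Continuous fun r => 3 * r ^ 2 * f r + r ^ 3 * (2 * d r)).intervalIntegrable _ _)
  have hmono : ∫ r in (0 : ℝ)..R, (2 * (r ^ 2 * f r) - R ^ 2 * (r ^ 2 * D r)) ≤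
      ∫ r in (0 : ℝ)..R, (3 * r ^ 2 * f r + r ^ 3 * (2 * d r)) := by
    refine intervalIntegral.integral_mono_on hR (Continuous.intervalIntegrable (by fun_prop) _ _)
      (Continuous.intervalIntegrable (by fun_prop) _ _) fun r hr => ?_
    have h1 := (abs_le.1 (two_mul_abs_le_of_sq_le (a := r) (b := r ^ 2) (hf0 r) (hD0 r) (hd r))).1
    have h2 : r ^ 2 * (r ^ 2 * D r) ≤ R ^ 2 * (r ^ 2 * D r) :=
      mul_le_mul_of_nonneg_right (pow_le_pow_left₀ hr.1 hr.2 2)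
        (mul_nonneg (sq_nonneg r) (hD0 r))
    nlinarith
  rw [intervalIntegral.integral_sub (Continuous.intervalIntegrable (by fun_prop) _ _)
    (Continuous.intervalIntegrable (by fun_prop) _ _), intervalIntegral.integral_const_mul,
    intervalIntegral.integral_const_mul, hI] at hmono
  linarith

/-- Hardy inequality along a half-line, for functions vanishing at infinity. -/
lemma ofReal_boundary_le_lintegral {f d D : ℝ → ℝ} {u R : ℝ} (hR : 0 < R)
    (hf : ∀ v, HasDerivAt f (2 * d v) v) (hdc : Continuous d) (hDc : Continuous D)
    (hf0 : ∀ v, 0 ≤ f v) (hD0 : ∀ v, 0 ≤ D v) (hd : ∀ v, d v ^ 2 ≤ f v * D v)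
    (hlim : Filter.Tendsto f Filter.atTop (nhds 0)) :
    ENNReal.ofReal (R / 2 * f (u + R)) ≤
      ∫⁻ v in Ici (u + R), ENNReal.ofReal ((v - u) ^ 2 * D v) := by
  have hreal : ∀ W, u + R ≤ W → R / 2 * f (u + R) ≤
      R * f W + ∫ v in (u + R)..W, (v - u) ^ 2 * D v := fun W hW => by
    have hpos : ∀ v ∈ Icc (u + R) W, 0 < R + (v - u) := fun v hv => by linarith [hv.1]
    have hw : ∀ v ∈ Icc (u + R) W, HasDerivAt (fun v => R * (v - u) / (R + (v - u)) * f v)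
        (R ^ 2 / (R + (v - u)) ^ 2 * f v + R * (v - u) / (R + (v - u)) * (2 * d v)) v :=
      fun v hv => by
        have h0 := (hpos v hv).ne'
        have h1 : HasDerivAt (fun v => v - u) 1 v := (hasDerivAt_id v).sub_const u
        refine (((h1.const_mul R).fun_div (h1.const_add R) h0).fun_mul (hf v)).congr_deriv ?_
        field_simp
        ring
    have hfc : Continuous f := continuous_iff_continuousAt.2 fun r => (hf r).continuousAt
    have hcont : ContinuousOn (fun v => R ^ 2 / (R + (v - u)) ^ 2 * f v +
        R * (v - u) / (R + (v - u)) * (2 * d v)) (Icc (u + R) W) := by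
      refine ContinuousOn.add (ContinuousOn.mul (ContinuousOn.div (by fun_prop) (by fun_prop)
        fun v hv => pow_ne_zero 2 (hpos v hv).ne') (by fun_prop)) (ContinuousOn.mul
        (ContinuousOn.div (by fun_prop) (by fun_prop) fun v hv => (hpos v hv).ne') (by fun_prop))
    have hint : IntervalIntegrable (fun v => R ^ 2 / (R + (v - u)) ^ 2 * f v +
        R * (v - u) / (R + (v - u)) * (2 * d v)) volume (u + R) W :=
      ContinuousOn.intervalIntegrable (by rwa [uIcc_of_le hW])
    have hI := intervalIntegral.integral_eq_sub_of_hasDerivAt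
      (fun v hv => hw v (by rwa [uIcc_of_le hW] at hv)) hint
    have hmono : ∫ v in (u + R)..W, -((v - u) ^ 2 * D v) ≤ ∫ v in (u + R)..W,
        (R ^ 2 / (R + (v - u)) ^ 2 * f v + R * (v - u) / (R + (v - u)) * (2 * d v)) := by
      refine intervalIntegral.integral_mono_on hW (Continuous.intervalIntegrable (by fun_prop) _ _)
        hint fun v hv => ?_
      have hp := hpos v hv
      have h1 := (abs_le.1 (two_mul_abs_le_of_sq_le (a := R / (R + (v - u))) (b := v - u)
        (hf0 v) (hD0 v) (hd v))).1
      rw [div_pow] at h1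
      have e : 2 * (R / (R + (v - u)) * (v - u)) * d v =
        R * (v - u) / (R + (v - u)) * (2 * d v) := by ring
      linarith
    rw [intervalIntegral.integral_neg, hI] at hmono
    have e1 : R * (u + R - u) / (R + (u + R - u)) = R / 2 := by
      rw [add_sub_cancel_left]; field_simp; ring
    have e2 : R * (W - u) / (R + (W - u)) ≤ R := by
      rw [div_le_iff₀ (hpos W ⟨hW, le_rfl⟩)]; nlinarith
    have := mul_le_mul_of_nonneg_right e2 (hf0 W)
    rw [e1] at hmono
    linarith
  have hDD : Continuous fun v => (v - u) ^ 2 * D v := by fun_prop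
  have hlim' : Filter.Tendsto (fun W => ENNReal.ofReal (R * f W) +
      ∫⁻ v in Ici (u + R), ENNReal.ofReal ((v - u) ^ 2 * D v)) Filter.atTop
      (nhds (0 + ∫⁻ v in Ici (u + R), ENNReal.ofReal ((v - u) ^ 2 * D v))) := by
    refine Filter.Tendsto.add ?_ tendsto_const_nhds
    have := ENNReal.tendsto_ofReal (hlim.const_mul R)
    rwa [mul_zero, ENNReal.ofReal_zero] at this
  rw [zero_add] at hlim'
  refine ge_of_tendsto hlim' (Filter.eventually_atTop.2 ⟨u + R, fun W hW => ?_⟩)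
  refine (ENNReal.ofReal_le_ofReal (hreal W hW)).trans (ENNReal.ofReal_add_le.trans ?_)
  rw [ofReal_intervalIntegral hW hDD fun v _ => mul_nonneg (sq_nonneg _) (hD0 v)]
  exact add_le_add le_rfl (lintegral_mono_set Icc_subset_Ici_self)

end Hardy

section Curves

variable {A : V → Fin 4 → ℝ} {φ : V → ℂ}

lemma hasDerivAt_norm_sq_curve (A : V → Fin 4 → ℝ) (hφ : ContDiff ℝ (⊤ : ℕ∞) φ) {c : ℝ → V} {X : V}
    {s : ℝ} (hc : HasDerivAt c X s) :
    HasDerivAt (fun s => ‖φ (c s)‖ ^ 2) (2 * ip (φ (c s)) (dirD A X φ (c s))) s := by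
  have h := hasDerivAt_comp_curve A hφ hc rfl
  have h2 := hasDerivAt_ip h h
  simp only [ip_self] at h2
  exact h2.congr_deriv (by rw [dirD]; ring)

lemma ip_sq_le (z w : ℂ) : ip z w ^ 2 ≤ ‖z‖ ^ 2 * ‖w‖ ^ 2 := by
  rw [← mul_pow]
  exact sq_le_sq.2 ((ip_le_norm_mul_norm z w).trans (le_abs_self _))

lemma hasDerivAt_pt_r (t r : ℝ) (ω : E3) : HasDerivAt (fun r => pt t r ω) (spV ω) r := by
  refine hasDerivAt_pi.2 fun i => ?_
  have h1 := fun k : Fin 3 => (hasDerivAt_id r).mul_const (ω k)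
  fin_cases i
  · simpa [pt, spV] using hasDerivAt_const r t
  · simpa [pt, spV] using h1 0
  · simpa [pt, spV] using h1 1
  · simpa [pt, spV] using h1 2

/-- Weighted control of the field on a ball by the energy on the ball and on the cone above it. -/
lemma lintegral_sq_mul_norm_sq_le (hA : ContDiff ℝ (⊤ : ℕ∞) A) (hφ : ContDiff ℝ (⊤ : ℕ∞) φ)
    (hv : vanishNullInf φ) {R τ : ℝ} (hR : 0 < R) {ω : E3} (hω : ‖ω‖ = 1) :
    ∫⁻ r in Icc 0 R, ENNReal.ofReal (r ^ 2 * ‖φ (pt τ r ω)‖ ^ 2) ≤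
      ENNReal.ofReal (R ^ 2) * (∫⁻ v in Ici ((τ + R) / 2), ENNReal.ofReal ((v - (τ - R) / 2) ^ 2 *
          ‖dirD A (outV ω) φ (pt ((τ - R) / 2 + v) (v - (τ - R) / 2) ω)‖ ^ 2)) +
        ENNReal.ofReal (R ^ 2) * ∫⁻ r in Icc 0 R,
          ENNReal.ofReal (r ^ 2 * ‖dirD A (spV ω) φ (pt τ r ω)‖ ^ 2) := by
  set u := (τ - R) / 2
  have e0 : (τ + R) / 2 = u + R := by simp only [u]; ring
  have e1 : pt (u + (u + R)) (u + R - u) ω = pt τ R ω := by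
    congr 1 <;> simp only [u] <;> ring
  have hpt : Continuous fun r => pt τ r ω :=
    (contDiff_pt contDiff_const contDiff_id contDiff_const).continuous
  have hpv : Continuous fun v => pt (u + v) (v - u) ω := by
    refine (contDiff_pt ?_ ?_ contDiff_const).continuous <;> fun_prop
  have hdir : ∀ X : V, Continuous fun x : V => dirD A X φ x := fun X =>
    (contDiff_dirD hA hφ contDiff_const contDiff_id).continuous
  have hip : Continuous fun z : ℂ × ℂ => ip z.1 z.2 :=
    (contDiff_ip (n := 0) contDiff_fst contDiff_snd).continuous
  have hball := two_mul_integral_sq_mul_le hR.le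
    (fun r => hasDerivAt_norm_sq_curve A hφ (hasDerivAt_pt_r τ r ω))
    (hip.comp ((hφ.continuous.comp hpt).prodMk ((hdir (spV ω)).comp hpt)))
    (((hdir (spV ω)).comp hpt).norm.pow 2) (fun _ => sq_nonneg _) (fun _ => sq_nonneg _)
    fun _ => ip_sq_le _ _
  have hcone := ofReal_boundary_le_lintegral (u := u) hR
    (fun v => hasDerivAt_norm_sq_curve A hφ (hasDerivAt_pt_v u v ω))
    (hip.comp ((hφ.continuous.comp hpv).prodMk ((hdir (outV ω)).comp hpv)))
    (((hdir (outV ω)).comp hpv).norm.pow 2) (fun _ => sq_nonneg _) (fun _ => sq_nonneg _)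
    (fun _ => ip_sq_le _ _) (by simpa using ((hv u ω hω).norm.pow 2))
  rw [e1] at hcone
  simp only [Pi.pow_apply, Function.comp_apply] at hball hcone
  rw [e0]
  have c1 : Continuous fun r => r ^ 2 * ‖φ (pt τ r ω)‖ ^ 2 :=
    (continuous_pow 2).mul ((hφ.continuous.comp hpt).norm.pow 2)
  have c2 : Continuous fun r => r ^ 2 * ‖dirD A (spV ω) φ (pt τ r ω)‖ ^ 2 :=
    (continuous_pow 2).mul (((hdir (spV ω)).comp hpt).norm.pow 2)
  rw [← ofReal_intervalIntegral hR.le c1 fun _ _ => by positivity,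
    ← ofReal_intervalIntegral hR.le c2 fun _ _ => by positivity]
  have hI : 0 ≤ ∫ r in (0 : ℝ)..R, r ^ 2 * ‖dirD A (spV ω) φ (pt τ r ω)‖ ^ 2 :=
    intervalIntegral.integral_nonneg hR.le fun _ _ => by positivity
  refine le_trans (ENNReal.ofReal_le_ofReal (q := R ^ 2 * (R / 2 * ‖φ (pt τ R ω)‖ ^ 2) +
    R ^ 2 * ∫ r in (0 : ℝ)..R, r ^ 2 * ‖dirD A (spV ω) φ (pt τ r ω)‖ ^ 2) ?_) ?_
  · nlinarith [mul_nonneg (sq_nonneg R) hI]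
  · refine ENNReal.ofReal_add_le.trans ?_
    rw [ENNReal.ofReal_mul (sq_nonneg R), ENNReal.ofReal_mul (sq_nonneg R)]
    gcongr

end Curves

section InitialBall

variable {A : V → Fin 4 → ℝ} {φ : V → ℂ} {ε p R τ r : ℝ} {ω : E3}

lemma norm_dirD_sq_le (X x : V) : ‖dirD A X φ x‖ ^ 2 ≤ (∑ μ, X μ ^ 2) * eD A φ x := by
  have h : eD A φ x = ∑ μ, (covD A μ φ x).re ^ 2 + ∑ μ, (covD A μ φ x).im ^ 2 := by
    rw [eD, ← Finset.sum_add_distrib]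
    refine Finset.sum_congr rfl fun μ _ => ?_
    rw [← Complex.normSq_eq_norm_sq, Complex.normSq_apply, sq, sq]
  rw [dirD_eq_ip, h, mul_add]
  exact add_le_add (Finset.sum_mul_sq_le_sq_mul_sq _ _ _) (Finset.sum_mul_sq_le_sq_mul_sq _ _ _)

lemma norm_dirD_outV_sq_le (hω : ‖ω‖ = 1) (x : V) : ‖dirD A (outV ω) φ x‖ ^ 2 ≤ 2 * eD A φ x := by
  refine (norm_dirD_sq_le _ x).trans_eq ?_
  congr 1
  simp [Fin.sum_univ_four, outV]
  linear_combination sum_sq_eq_one hω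

lemma norm_dirD_spV_sq_le (hω : ‖ω‖ = 1) (x : V) : ‖dirD A (spV ω) φ x‖ ^ 2 ≤ eD A φ x := by
  refine (norm_dirD_sq_le _ x).trans_eq ?_
  rw [show ∑ μ, spV ω μ ^ 2 = 1 by
    simp [Fin.sum_univ_four, spV]
    linear_combination sum_sq_eq_one hω, one_mul]

lemma pairSum_norm_dirD_sq_le (hω : ‖ω‖ = 1) (x : V) :
    (pairSum fun i j => ‖dirD A (spV (rotGen i j ω)) φ x‖ ^ 2) ≤ eD A φ x := by
  have h := sum_sq_eq_one hω
  have key : ∀ a b c : ℝ, (pairSum fun i j => (∑ k, spV (rotGen i j ω) k *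
      (![0, a, b, c] : Fin 4 → ℝ) k) ^ 2) ≤ a ^ 2 + b ^ 2 + c ^ 2 := fun a b c => by
    simp only [pairSum, rotGen_01, rotGen_02, rotGen_12, Fin.sum_univ_four]
    simp
    have e := congrArg (· * (a ^ 2 + b ^ 2 + c ^ 2)) h
    simp only at e
    nlinarith [sq_nonneg (ω 0 * a + ω 1 * b + ω 2 * c)]
  have h1 := key (covD A 1 φ x).re (covD A 2 φ x).re (covD A 3 φ x).re
  have h2 := key (covD A 1 φ x).im (covD A 2 φ x).im (covD A 3 φ x).im
  have h3 := fun μ => (Complex.normSq_eq_norm_sq (covD A μ φ x)).symm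
  simp only [Complex.normSq_apply] at h3
  simp only [pairSum, dirD_eq_ip, eD, Fin.sum_univ_four, h3, spV] at h1 h2 ⊢
  simp at h1 h2 ⊢
  nlinarith [sq_nonneg (covD A 0 φ x).re, sq_nonneg (covD A 0 φ x).im]

lemma flux_le_eD (hε : 0 < ε) (hp : 0 ≤ p) (hp2 : p ≤ 2) {u v : ℝ} (h0 : 0 ≤ v - u)
    (hr : v - u ≤ R) (hω : ‖ω‖ = 1) :
    fluxP A φ (gW ε) (qW ε p) u v ω + fluxQ A φ (gW ε) (qW ε p) u v ω ≤
      10 * (1 + 2 * massW ε) * R ^ 2 * ((v - u) ^ 2 * eD A φ (pt (u + v) (v - u) ω)) +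
        4 * (1 + 2 * massW ε) * ((v - u) ^ 2 * ‖φ (pt (u + v) (v - u) ω)‖ ^ 2) := by
  set x := pt (u + v) (v - u) ω with hx
  set r := v - u with hrd
  have hg := gW_mem hε u
  have hq0 := qW_nonneg hε hp hp2 r
  have hq2 := qW_le_two hε hp hp2 r
  have hD := norm_dirD_outV_sq_le (A := A) (φ := φ) hω x
  have hT := pairSum_norm_dirD_sq_le (A := A) (φ := φ) hω x
  have hD0 : 0 ≤ ‖dirD A (outV ω) φ x‖ ^ 2 := sq_nonneg _
  have hT0 : 0 ≤ pairSum fun i j => ‖dirD A (spV (rotGen i j ω)) φ x‖ ^ 2 := by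
    unfold pairSum; positivity
  have hrR : r ^ 2 ≤ R ^ 2 := pow_le_pow_left₀ h0 hr 2
  have hN : ‖radD A φ (u + v) r ω‖ ^ 2 ≤ 4 * R ^ 2 * eD A φ x + 2 * ‖φ x‖ ^ 2 := by
    have h1 : ‖radD A φ (u + v) r ω‖ ≤ r * ‖dirD A (outV ω) φ x‖ + ‖φ x‖ := by
      refine (norm_add_le _ _).trans_eq ?_
      rw [norm_mul, Complex.norm_real, Real.norm_of_nonneg h0]
    have h2 := pow_le_pow_left₀ (norm_nonneg _) h1 2
    have h3 := mul_le_mul hrR hD hD0 (sq_nonneg R)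
    nlinarith [sq_nonneg (r * ‖dirD A (outV ω) φ x‖ - ‖φ x‖)]
  have hΘ : (pairSum fun i j => ip (angD A φ i j (u + v) r ω) (angD A φ i j (u + v) r ω)) =
      r ^ 2 * (r ^ 2 * pairSum fun i j => ‖dirD A (spV (rotGen i j ω)) φ x‖ ^ 2) := by
    simp only [pairSum, ip_self, angD, norm_mul, norm_pow, Complex.norm_real, Real.norm_eq_abs,
      mul_pow, sq_abs, ← hx]
    ring
  have hgq : gW ε u * qW ε p r ≤ (1 + 2 * massW ε) * 2 :=
    mul_le_mul hg.2 hq2 hq0 (by linarith [hg.1, hg.2])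
  have hgq0 : 0 ≤ gW ε u * qW ε p r := mul_nonneg (by linarith [hg.1]) hq0
  have hP : fluxP A φ (gW ε) (qW ε p) u v ω = gW ε u * qW ε p r *
      (r ^ 2 * ‖radD A φ (u + v) r ω‖ ^ 2) := by
    rw [fluxP, ip_self]; ring
  rw [hP, fluxQ, hΘ, ← mul_add, ← mul_add]
  have h4 := mul_le_mul hrR hT hT0 (sq_nonneg R)
  have hm : 0 ≤ ‖radD A φ (u + v) r ω‖ ^ 2 +
      r ^ 2 * pairSum fun i j => ‖dirD A (spV (rotGen i j ω)) φ x‖ ^ 2 := by positivity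
  refine (mul_le_mul hgq (mul_le_mul_of_nonneg_left (add_le_add hN h4) (sq_nonneg r))
    (mul_nonneg (sq_nonneg r) hm) (by linarith)).trans_eq ?_
  ring

lemma setLIntegral_sphere_eD_le (hA : ContDiff ℝ (⊤ : ℕ∞) A) (hφ : ContDiff ℝ (⊤ : ℕ∞) φ) :
    ∫⁻ r in Icc 0 R, ∫⁻ ω, ENNReal.ofReal (r ^ 2 * eD A φ (pt τ r ω)) ∂sphM ≤
      20736 * lIntBall τ R (eD A φ) := by
  have hc : Continuous (eD A φ) := continuous_finsetSum _ fun μ _ =>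
    (contDiff_covD hA hφ μ).continuous.norm.pow 2
  have hF : Measurable ((closedBall (0 : E3) R).indicator
      fun x => ENNReal.ofReal (eD A φ (stp τ x))) :=
    (hc.comp (continuous_stp.comp (continuous_const.prodMk continuous_id))).measurable.ennreal_ofReal
      |>.indicator measurableSet_closedBall
  have h := polar_le hF
  rw [lintegral_indicator measurableSet_closedBall] at h
  refine le_trans ?_ h
  rw [setLIntegral_congr Ioc_ae_eq_Icc.symm]
  refine le_trans ?_ (lintegral_mono_set (Ioc_subset_Ioi_self : Ioc 0 R ⊆ Ioi 0))
  refine setLIntegral_mono' measurableSet_Ioc fun r hr => ?_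
  rw [← lintegral_const_mul' _ _ ENNReal.ofReal_ne_top]
  refine lintegral_mono_ae (ae_sphM_norm.mono fun ω hω => ?_)
  rw [indicator_of_mem, ← ENNReal.ofReal_mul (sq_nonneg r), pt_eq_stp]
  rw [mem_closedBall_zero_iff, norm_smul, hω, mul_one, Real.norm_of_nonneg hr.1.le]
  exact hr.2

lemma setLIntegral_sphere_norm_sq_le (hA : ContDiff ℝ (⊤ : ℕ∞) A) (hφ : ContDiff ℝ (⊤ : ℕ∞) φ)
    (hv : vanishNullInf φ) (hR : 0 < R) :
    ∫⁻ r in Icc 0 R, ∫⁻ ω, ENNReal.ofReal (r ^ 2 * ‖φ (pt τ r ω)‖ ^ 2) ∂sphM ≤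
      ENNReal.ofReal (R ^ 2) * EphiH A φ ((τ - R) / 2) ((τ + R) / 2) +
        ENNReal.ofReal (R ^ 2) * (20736 * lIntBall τ R (eD A φ)) := by
  set u := (τ - R) / 2 with hu
  have s1 : ContDiff ℝ (⊤ : ℕ∞) fun z : ℝ × E3 => z.1 := contDiff_fst
  have s2 : ContDiff ℝ (⊤ : ℕ∞) fun z : ℝ × E3 => z.2 := contDiff_snd
  have p1 : ContDiff ℝ (⊤ : ℕ∞) fun z : ℝ × E3 => pt τ z.1 z.2 := contDiff_pt contDiff_const s1 s2
  have p2 : ContDiff ℝ (⊤ : ℕ∞) fun z : ℝ × E3 => pt (u + z.1) (z.1 - u) z.2 :=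
    contDiff_pt (contDiff_const.add s1) (s1.sub contDiff_const) s2
  have m0 : Measurable fun z : ℝ × E3 => ENNReal.ofReal (z.1 ^ 2 * ‖φ (pt τ z.1 z.2)‖ ^ 2) :=
    ((s1.continuous.pow 2).mul
      ((hφ.comp p1).continuous.norm.pow 2)).measurable.ennreal_ofReal
  have m1 : Measurable fun z : ℝ × E3 => ENNReal.ofReal
      (z.1 ^ 2 * ‖dirD A (spV z.2) φ (pt τ z.1 z.2)‖ ^ 2) :=
    ((s1.continuous.pow 2).mul
      ((contDiff_dirD hA hφ (contDiff_spV s2) p1).continuous.norm.pow 2)).measurable.ennreal_ofReal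
  have m2 : Measurable fun z : ℝ × E3 => ENNReal.ofReal
      ((z.1 - u) ^ 2 * ‖dirD A (outV z.2) φ (pt (u + z.1) (z.1 - u) z.2)‖ ^ 2) :=
    (((s1.continuous.sub continuous_const).pow 2).mul
      ((contDiff_dirD hA hφ (contDiff_outV s2) p2).continuous.norm.pow 2)).measurable.ennreal_ofReal
  rw [lintegral_lintegral_swap m0.aemeasurable]
  refine (lintegral_mono_ae (ae_sphM_norm.mono fun ω hω =>
    lintegral_sq_mul_norm_sq_le (τ := τ) hA hφ hv hR hω)).trans ?_
  rw [lintegral_add_left, lintegral_const_mul' _ _ ENNReal.ofReal_ne_top,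
    lintegral_const_mul' _ _ ENNReal.ofReal_ne_top]
  · gcongr
    · rw [lintegral_lintegral_swap, EphiH, lIntH]
      swap
      · exact (m2.comp measurable_swap).aemeasurable
      refine setLIntegral_mono' measurableSet_Ici fun v hv => ?_
      have hr : 0 < v - u := by simp only [hu, mem_Ici] at hv ⊢; linarith
      rw [sphI, sphLInt_eq]
      refine lintegral_mono_ae (ae_sphM_norm.mono fun ω hω => ENNReal.ofReal_le_ofReal ?_)
      rw [rad_pt hω hr.le, eDL_pt hω hr, ← hu, mul_comm]
      refine mul_le_mul_of_nonneg_right (le_add_of_nonneg_right ?_) (sq_nonneg _)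
      exact Finset.sum_nonneg fun _ _ => sq_nonneg _
    · rw [lintegral_lintegral_swap]
      swap
      · exact (m1.comp measurable_swap).aemeasurable
      refine le_trans (setLIntegral_mono' measurableSet_Icc fun r _ => ?_)
        (setLIntegral_sphere_eD_le hA hφ)
      refine lintegral_mono_ae (ae_sphM_norm.mono fun ω hω => ENNReal.ofReal_le_ofReal ?_)
      exact mul_le_mul_of_nonneg_left (norm_dirD_spV_sq_le hω _) (sq_nonneg r)
  · exact (Measurable.lintegral_prod_left' (μ := volume.restrict (Ici ((τ + R) / 2))) m2).const_mul _

/-- The initial flux through the ball is controlled by the energy. -/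
lemma lintegral_flux_ball_le (hA : ContDiff ℝ (⊤ : ℕ∞) A) (hφ : ContDiff ℝ (⊤ : ℕ∞) φ)
    (hv : vanishNullInf φ) (hε : 0 < ε) (hp : 0 ≤ p) (hp2 : p ≤ 2) (hR : 1 ≤ R) (hτ : 0 ≤ τ) :
    ∫⁻ r in Icc 0 R, ENNReal.ofReal
        (sphAv (fluxP A φ (gW ε) (qW ε p)) ((τ - r) / 2, (τ + r) / 2) +
          sphAv (fluxQ A φ (gW ε) (qW ε p)) ((τ - r) / 2, (τ + r) / 2)) ≤
      ENNReal.ofReal (14 * (1 + 2 * massW ε) * R ^ 2 * 20736) * EphiSig R A φ τ := by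
  have hm := massW_nonneg (ε := ε)
  have s1 : ContDiff ℝ (⊤ : ℕ∞) fun z : ℝ × E3 => z.1 := contDiff_fst
  have s2 : ContDiff ℝ (⊤ : ℕ∞) fun z : ℝ × E3 => z.2 := contDiff_snd
  have p1 : Continuous fun z : ℝ × E3 => pt τ z.1 z.2 := (contDiff_pt contDiff_const s1 s2).continuous
  have hc : Continuous (eD A φ) := continuous_finsetSum _ fun μ _ =>
    (contDiff_covD hA hφ μ).continuous.norm.pow 2
  have m0 : Measurable fun z : ℝ × E3 => ENNReal.ofReal (z.1 ^ 2 * eD A φ (pt τ z.1 z.2)) :=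
    ((s1.continuous.pow 2).mul (hc.comp p1)).measurable.ennreal_ofReal
  have step : ∀ r ∈ Icc 0 R, ENNReal.ofReal
      (sphAv (fluxP A φ (gW ε) (qW ε p)) ((τ - r) / 2, (τ + r) / 2) +
        sphAv (fluxQ A φ (gW ε) (qW ε p)) ((τ - r) / 2, (τ + r) / 2)) ≤
      ENNReal.ofReal (10 * (1 + 2 * massW ε) * R ^ 2) *
          ∫⁻ ω, ENNReal.ofReal (r ^ 2 * eD A φ (pt τ r ω)) ∂sphM +
        ENNReal.ofReal (4 * (1 + 2 * massW ε)) *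
          ∫⁻ ω, ENNReal.ofReal (r ^ 2 * ‖φ (pt τ r ω)‖ ^ 2) ∂sphM := fun r hr => by
    have cP : Continuous (fluxP A φ (gW ε) (qW ε p) ((τ - r) / 2) ((τ + r) / 2)) :=
      (contDiff_fluxP hA hφ contDiff_gW contDiff_qW contDiff_const contDiff_const
        contDiff_id).continuous
    have cQ : Continuous (fluxQ A φ (gW ε) (qW ε p) ((τ - r) / 2) ((τ + r) / 2)) :=
      (contDiff_fluxQ hA hφ contDiff_gW contDiff_qW contDiff_const contDiff_const
        contDiff_id).continuous
    have e1 : (τ - r) / 2 + (τ + r) / 2 = τ := by ring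
    have e2 : (τ + r) / 2 - (τ - r) / 2 = r := by ring
    refine ENNReal.ofReal_add_le.trans ?_
    rw [ofReal_sphAv cP (fluxP_nonneg hε hp hp2 _ _), ofReal_sphAv cQ (fluxQ_nonneg hε hp hp2 _ _),
      ← lintegral_add_left cP.measurable.ennreal_ofReal,
      ← lintegral_const_mul' _ _ ENNReal.ofReal_ne_top,
      ← lintegral_const_mul' _ _ ENNReal.ofReal_ne_top, ← lintegral_add_left]
    · refine lintegral_mono_ae (ae_sphM_norm.mono fun ω hω => ?_)
      have h := flux_le_eD (A := A) (φ := φ) (u := (τ - r) / 2) (v := (τ + r) / 2) (R := R) hε hp hp2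
        (by rw [e2]; exact hr.1) (by rw [e2]; exact hr.2) hω
      rw [e1, e2] at h
      rw [← ENNReal.ofReal_add (fluxP_nonneg hε hp hp2 _ _ ω) (fluxQ_nonneg hε hp hp2 _ _ ω),
        ← ENNReal.ofReal_mul (by positivity), ← ENNReal.ofReal_mul (by positivity)]
      exact (ENNReal.ofReal_le_ofReal h).trans ENNReal.ofReal_add_le
    · exact (m0.comp (measurable_const.prodMk measurable_id)).const_mul _
  refine (setLIntegral_mono' measurableSet_Icc step).trans ?_
  rw [lintegral_add_left ((Measurable.lintegral_prod_right' (ν := sphM) m0).const_mul _),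
    lintegral_const_mul' _ _ ENNReal.ofReal_ne_top, lintegral_const_mul' _ _ ENNReal.ofReal_ne_top]
  have h1 := setLIntegral_sphere_eD_le (R := R) (τ := τ) hA hφ
  have h2 := setLIntegral_sphere_norm_sq_le (R := R) (τ := τ) hA hφ hv (by linarith)
  refine (add_le_add (mul_le_mul_right h1 _) (mul_le_mul_right h2 _)).trans ?_
  rw [EphiSig, if_pos hτ]
  generalize lIntBall τ R (eD A φ) = X
  generalize EphiH A φ ((τ - R) / 2) ((τ + R) / 2) = Y
  have hG : 0 ≤ 1 + 2 * massW ε := by linarith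
  have k1 : ENNReal.ofReal (14 * (1 + 2 * massW ε) * R ^ 2 * 20736) =
      ENNReal.ofReal (10 * (1 + 2 * massW ε) * R ^ 2) * 20736 +
        ENNReal.ofReal (4 * (1 + 2 * massW ε)) * ENNReal.ofReal (R ^ 2) * 20736 := by
    rw [← ENNReal.ofReal_mul (by positivity), ← add_mul, ← ENNReal.ofReal_add (by positivity)
      (by positivity), show (20736 : ℝ≥0∞) = ENNReal.ofReal 20736 by simp,
      ← ENNReal.ofReal_mul (by positivity)]
    congr 1
    ring
  have k2 : ENNReal.ofReal (4 * (1 + 2 * massW ε)) * ENNReal.ofReal (R ^ 2) ≤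
      ENNReal.ofReal (14 * (1 + 2 * massW ε) * R ^ 2 * 20736) := by
    rw [← ENNReal.ofReal_mul (by positivity)]
    refine ENNReal.ofReal_le_ofReal ?_
    nlinarith [mul_nonneg hG (sq_nonneg R)]
  calc _ = (ENNReal.ofReal (10 * (1 + 2 * massW ε) * R ^ 2) * 20736 +
        ENNReal.ofReal (4 * (1 + 2 * massW ε)) * ENNReal.ofReal (R ^ 2) * 20736) * X +
        ENNReal.ofReal (4 * (1 + 2 * massW ε)) * ENNReal.ofReal (R ^ 2) * Y := by ring
    _ ≤ _ := by
      rw [← k1, mul_add _ X Y]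
      gcongr

end InitialBall

section Estimates

variable {A : V → Fin 4 → ℝ} {φ : V → ℂ} {ε p R τ₁ τ₂ : ℝ}

lemma contDiff_sphAv_fluxP (hA : ContDiff ℝ (⊤ : ℕ∞) A) (hφ : ContDiff ℝ (⊤ : ℕ∞) φ) :
    ContDiff ℝ 1 (sphAv (fluxP A φ (gW ε) (qW ε p))) :=
  contDiff_sphAv (contDiff_fluxP hA hφ contDiff_gW contDiff_qW contDiff_fst.fst
    (contDiff_snd.comp contDiff_fst) contDiff_snd)

lemma contDiff_sphAv_fluxQ (hA : ContDiff ℝ (⊤ : ℕ∞) A) (hφ : ContDiff ℝ (⊤ : ℕ∞) φ) :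
    ContDiff ℝ 1 (sphAv (fluxQ A φ (gW ε) (qW ε p))) :=
  contDiff_sphAv (contDiff_fluxQ hA hφ contDiff_gW contDiff_qW contDiff_fst.fst
    (contDiff_snd.comp contDiff_fst) contDiff_snd)

lemma continuous_fluxP (hA : ContDiff ℝ (⊤ : ℕ∞) A) (hφ : ContDiff ℝ (⊤ : ℕ∞) φ) (u v : ℝ) :
    Continuous (fluxP A φ (gW ε) (qW ε p) u v) :=
  (contDiff_fluxP hA hφ contDiff_gW contDiff_qW contDiff_const contDiff_const
    contDiff_id).continuous

lemma continuous_fluxQ (hA : ContDiff ℝ (⊤ : ℕ∞) A) (hφ : ContDiff ℝ (⊤ : ℕ∞) φ) (u v : ℝ) :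
    Continuous (fluxQ A φ (gW ε) (qW ε p) u v) :=
  (contDiff_fluxQ hA hφ contDiff_gW contDiff_qW contDiff_const contDiff_const
    contDiff_id).continuous

lemma continuous_srcS_weights (hA : ContDiff ℝ (⊤ : ℕ∞) A) (hφ : ContDiff ℝ (⊤ : ℕ∞) φ) :
    Continuous fun z : (ℝ × ℝ) × E3 => srcS A φ (gW ε) (fun u => -(1 + u ^ 2) ^ (-(1 + ε) / 2))
      (qW ε p) (qW' ε p) z.1.1 z.1.2 z.2 :=
  continuous_srcS hA hφ contDiff_gW.continuous continuous_time_density.neg contDiff_qW.continuous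
    continuous_qW'

lemma sphAv_srcS_le (hA : ContDiff ℝ (⊤ : ℕ∞) A) (hφ : ContDiff ℝ (⊤ : ℕ∞) φ)
    (hε : 0 < ε) (hp : 0 ≤ p) (hp2 : p ≤ 2) {u v : ℝ} (huv : u ≤ v) :
    sphAv (srcS A φ (gW ε) (fun u => -(1 + u ^ 2) ^ (-(1 + ε) / 2)) (qW ε p) (qW' ε p)) (u, v) ≤
      sphAv (errD A φ ε p) (u, v) - sphAv (bulkD A φ ε p) (u, v) := by
  have iE := integrable_sphM (continuous_sphere_slice (continuous_errD (ε := ε) (p := p) hA hφ) u v)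
  have iB := integrable_sphM (continuous_sphere_slice (continuous_bulkD (ε := ε) (p := p) hA hφ) u v)
  have iS := integrable_sphM (continuous_sphere_slice
    (continuous_srcS_weights (ε := ε) (p := p) hA hφ) u v)
  simp only [sphAv]
  rw [← integral_sub iE iB]
  exact integral_mono iS (iE.sub iB) fun ω => srcS_le hε hp hp2 huv ω

lemma interior_flux_inequality (hA : ContDiff ℝ (⊤ : ℕ∞) A) (hφ : ContDiff ℝ (⊤ : ℕ∞) φ)
    (hε : 0 < ε) (hp : 0 ≤ p) (hp2 : p ≤ 2) {v₀ : ℝ} (hR : 0 ≤ R) (hτ : τ₁ ≤ τ₂)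
    (hv₀ : (τ₂ + R) / 2 ≤ v₀) {P Q B X : ℝ × ℝ → ℝ}
    (eP : P = sphAv (fluxP A φ (gW ε) (qW ε p))) (eQ : Q = sphAv (fluxQ A φ (gW ε) (qW ε p)))
    (eB : B = sphAv (bulkD A φ ε p)) (eX : X = sphAv (errD A φ ε p)) :
    ∫⁻ v in Ici ((τ₂ + R) / 2), ENNReal.ofReal (P ((τ₂ - R) / 2, v)) ≤ interiorRhs P Q X R τ₁ τ₂ ∧
    ∫⁻ u in Icc ((τ₁ - R) / 2) ((τ₂ - R) / 2), ENNReal.ofReal (Q (u, v₀)) ≤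
      interiorRhs P Q X R τ₁ τ₂ ∧
    ∫⁻ t in Icc τ₁ τ₂, ∫⁻ v in Ici ((t + R) / 2), ENNReal.ofReal (B ((t - R) / 2, v)) ≤
      interiorRhs P Q X R τ₁ τ₂ := by
  subst eP eQ eB eX
  refine interior_inequality (contDiff_sphAv_fluxP hA hφ) (contDiff_sphAv_fluxQ hA hφ)
    (fderiv_sphAv_flux hA hφ contDiff_gW contDiff_qW continuous_time_density.neg continuous_qW'
      hasDerivAt_gW (hasDerivAt_qW hε)) (continuous_sphAv (continuous_srcS_weights hA hφ))
    (continuous_sphAv (continuous_bulkD hA hφ)) (continuous_sphAv (continuous_errD hA hφ))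
    (fun u v huv => sphAv_srcS_le hA hφ hε hp hp2 huv)
    (fun u v huv => sphAv_nonneg (bulkD_nonneg hε hp hp2 huv))
    (fun u v _ => sphAv_nonneg (errD_nonneg hε hp hp2 u v))
    (fun u v _ => sphAv_nonneg (fluxP_nonneg hε hp hp2 u v))
    (fun u v _ => sphAv_nonneg (fluxQ_nonneg hε hp hp2 u v)) (fun u => ?_) (fun u => ?_) hR hτ hv₀
  · simp [sphAv, fluxP]
  · simp [sphAv, fluxQ, pairSum, angD, ip_self]

lemma exterior_flux_inequality (hA : ContDiff ℝ (⊤ : ℕ∞) A) (hφ : ContDiff ℝ (⊤ : ℕ∞) φ)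
    (hε : 0 < ε) (hp : 0 ≤ p) (hp2 : p ≤ 2) {u₁ u₂ : ℝ} (hu : u₁ ≤ u₂) (hu₂ : u₂ ≤ 0)
    {P Q B X : ℝ × ℝ → ℝ}
    (eP : P = sphAv (fluxP A φ (gW ε) (qW ε p))) (eQ : Q = sphAv (fluxQ A φ (gW ε) (qW ε p)))
    (eB : B = sphAv (bulkD A φ ε p)) (eX : X = sphAv (errD A φ ε p)) :
    (∫⁻ v in Icc (-u₂) (-u₁), ENNReal.ofReal (P (u₂, v)))
      + (∫⁻ u in Icc u₁ u₂, ENNReal.ofReal (Q (u, -u₁)))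
      + (∫⁻ u in Icc u₁ u₂, ∫⁻ v in Icc (-u) (-u₁), ENNReal.ofReal (B (u, v))) ≤
    (∫⁻ u in Icc u₁ u₂, ENNReal.ofReal (Q (u, -u) + P (u, -u)))
      + ∫⁻ u in Icc u₁ u₂, ∫⁻ v in Icc (-u) (-u₁), ENNReal.ofReal (X (u, v)) := by
  subst eP eQ eB eX
  exact exterior_inequality (contDiff_sphAv_fluxP hA hφ) (contDiff_sphAv_fluxQ hA hφ)
    (fderiv_sphAv_flux hA hφ contDiff_gW contDiff_qW continuous_time_density.neg continuous_qW'
      hasDerivAt_gW (hasDerivAt_qW hε)) (continuous_sphAv (continuous_srcS_weights hA hφ))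
    (continuous_sphAv (continuous_bulkD hA hφ)) (continuous_sphAv (continuous_errD hA hφ))
    (fun u v huv => sphAv_srcS_le hA hφ hε hp hp2 huv)
    (fun u v huv => sphAv_nonneg (bulkD_nonneg hε hp hp2 huv))
    (fun u v _ => sphAv_nonneg (errD_nonneg hε hp hp2 u v))
    (fun u v _ => sphAv_nonneg (fluxP_nonneg hε hp hp2 u v))
    (fun u v _ => sphAv_nonneg (fluxQ_nonneg hε hp hp2 u v)) hu hu₂

lemma sphI_eDL_le (hA : ContDiff ℝ (⊤ : ℕ∞) A) (hφ : ContDiff ℝ (⊤ : ℕ∞) φ)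
    (hε : 0 < ε) (hp : 0 ≤ p) (hp2 : p ≤ 2) {u v : ℝ} (hr : 1 ≤ v - u) :
    sphI (fun x => rad x ^ p * eDL A (psi φ) x) (u + v) (v - u) ≤
      ENNReal.ofReal 2 * ENNReal.ofReal (sphAv (fluxP A φ (gW ε) (qW ε p)) (u, v)) :=
  sphI_le_sphAv (continuous_fluxP hA hφ u v) (fluxP_nonneg hε hp hp2 u v) zero_le_two
    fun _ hω => rpow_mul_eDL_le hε hp hp2 (hφ.differentiable (by simp)) hr hω

lemma sphI_eDslash_le (hA : ContDiff ℝ (⊤ : ℕ∞) A) (hφ : ContDiff ℝ (⊤ : ℕ∞) φ)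
    (hε : 0 < ε) (hp : 0 ≤ p) (hp2 : p ≤ 2) {u v : ℝ} (hr : 1 ≤ v - u) :
    sphI (fun x => rad x ^ p * eDslash A (psi φ) x) (u + v) (v - u) ≤
      ENNReal.ofReal 2 * ENNReal.ofReal (sphAv (fluxQ A φ (gW ε) (qW ε p)) (u, v)) :=
  sphI_le_sphAv (continuous_fluxQ hA hφ u v) (fluxQ_nonneg hε hp hp2 u v) zero_le_two
    fun _ hω => rpow_mul_eDslash_le hε hp hp2 (hφ.differentiable (by simp)) hr hω

lemma sphI_bulk_le (hA : ContDiff ℝ (⊤ : ℕ∞) A) (hφ : ContDiff ℝ (⊤ : ℕ∞) φ)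
    (hε : 0 < ε) (hp : 0 ≤ p) (hp2 : p ≤ 2) {u v : ℝ} (hr : 1 ≤ v - u) :
    sphI (fun x => rad x ^ (p - 1) * (p * eDL A (psi φ) x + (2 - p) * eDslash A (psi φ) x))
        (u + v) (v - u) ≤
      ENNReal.ofReal 8 * ENNReal.ofReal (sphAv (bulkD A φ ε p) (u, v)) :=
  sphI_le_sphAv (continuous_sphere_slice (continuous_bulkD hA hφ) u v)
    (bulkD_nonneg hε hp hp2 (by linarith)) (by norm_num)
    fun _ hω => rpow_mul_bulk_le hε hp hp2 (hφ.differentiable (by simp)) hr hω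

lemma eDL_nonneg (x : V) : 0 ≤ eDL A φ x := sq_nonneg _

lemma eDslash_nonneg (x : V) : 0 ≤ eDslash A φ x := Finset.sum_nonneg fun _ _ => sq_nonneg _

lemma lintegral_flux_cone_le (hA : ContDiff ℝ (⊤ : ℕ∞) A) (hφ : ContDiff ℝ (⊤ : ℕ∞) φ)
    (hε : 0 < ε) (hp : 0 ≤ p) (hp2 : p ≤ 2) {u v₀ : ℝ} (hr : 1 ≤ v₀ - u) :
    ∫⁻ v in Ici v₀, ENNReal.ofReal (sphAv (fluxP A φ (gW ε) (qW ε p)) (u, v)) ≤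
      ENNReal.ofReal (2 * (1 + 2 * massW ε)) *
        lIntH u v₀ (fun x => rad x ^ p * eDL A (psi φ) x) := by
  have hm := massW_nonneg (ε := ε)
  rw [lIntH, ← lintegral_const_mul' _ _ ENNReal.ofReal_ne_top]
  refine setLIntegral_mono' measurableSet_Ici fun v hv => ?_
  exact ofReal_sphAv_le_sphI (continuous_fluxP hA hφ u v) (fluxP_nonneg hε hp hp2 u v)
    (by positivity) fun _ hω => fluxP_le hε hp hp2 (hφ.differentiable (by simp))
      (by linarith [mem_Ici.1 hv]) hω

/-- The initial flux through the annulus at time zero. -/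
lemma lintegral_flux_annulus_le (hA : ContDiff ℝ (⊤ : ℕ∞) A) (hφ : ContDiff ℝ (⊤ : ℕ∞) φ)
    (hε : 0 < ε) (hp : 0 ≤ p) (hp2 : p ≤ 2) (hR : 1 ≤ R) (hτ₁ : τ₁ ≤ 0) :
    ∫⁻ u in Icc ((τ₂ - R) / 2) ((τ₁ - R) / 2),
        ENNReal.ofReal (sphAv (fluxQ A φ (gW ε) (qW ε p)) (u, -u) +
          sphAv (fluxP A φ (gW ε) (qW ε p)) (u, -u)) ≤
      ENNReal.ofReal (4 * (1 + 2 * massW ε)) * ∫⁻ r in Icc (R - τ₁) (R - τ₂),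
        sphI (fun x => rad x ^ p * (eDL A (psi φ) x + eDslash A (psi φ) x)) 0 r := by
  have hm := massW_nonneg (ε := ε)
  set F : V → ℝ := fun x => rad x ^ p * (eDL A (psi φ) x + eDslash A (psi φ) x) with hF
  set H : ℝ → ℝ≥0∞ := (Icc (R - τ₁) (R - τ₂)).indicator (fun r => sphI F 0 r) with hH
  have hφd : Differentiable ℝ φ := hφ.differentiable (by simp)
  have hrad : ∀ x : V, 0 ≤ rad x ^ p := fun x => Real.rpow_nonneg (Real.sqrt_nonneg _) p
  have step : ∀ u ∈ Icc ((τ₂ - R) / 2) ((τ₁ - R) / 2),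
      ENNReal.ofReal (sphAv (fluxQ A φ (gW ε) (qW ε p)) (u, -u) +
          sphAv (fluxP A φ (gW ε) (qW ε p)) (u, -u)) ≤
      ENNReal.ofReal (4 * (1 + 2 * massW ε)) * H (-2 * u) := fun u hu => by
    have hr : 1 ≤ -u - u := by linarith [hu.2]
    have hmem : -2 * u ∈ Icc (R - τ₁) (R - τ₂) := ⟨by linarith [hu.2], by linarith [hu.1]⟩
    have hQ := ofReal_sphAv_le_sphI (F := F) (continuous_fluxQ (ε := ε) (p := p) hA hφ u (-u))
      (fluxQ_nonneg hε hp hp2 u (-u)) (by positivity : 0 ≤ 2 * (1 + 2 * massW ε))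
      fun ω hω => (fluxQ_le hε hp hp2 hφd hr hω).trans (mul_le_mul_of_nonneg_left
        (mul_le_mul_of_nonneg_left (le_add_of_nonneg_left (eDL_nonneg _)) (hrad _)) (by positivity))
    have hP := ofReal_sphAv_le_sphI (F := F) (continuous_fluxP (ε := ε) (p := p) hA hφ u (-u))
      (fluxP_nonneg hε hp hp2 u (-u)) (by positivity : 0 ≤ 2 * (1 + 2 * massW ε))
      fun ω hω => (fluxP_le hε hp hp2 hφd hr hω).trans (mul_le_mul_of_nonneg_left
        (mul_le_mul_of_nonneg_left (le_add_of_nonneg_right (eDslash_nonneg _)) (hrad _))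
        (by positivity))
    refine (ENNReal.ofReal_add_le.trans (add_le_add hQ hP)).trans_eq ?_
    rw [hH, indicator_of_mem hmem, ← add_mul, ← ENNReal.ofReal_add (by positivity) (by positivity),
      add_neg_cancel, show -u - u = -2 * u by ring]
    congr 2
    ring
  refine (setLIntegral_mono' measurableSet_Icc step).trans ?_
  rw [lintegral_const_mul' _ _ ENNReal.ofReal_ne_top,
    ← lintegral_indicator (s := Icc (R - τ₁) (R - τ₂)) measurableSet_Icc, ← hH]
  refine mul_le_mul_right ?_ _
  refine (setLIntegral_le_lintegral _ _).trans ?_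
  have h2 : (-2 : ℝ) ≠ 0 := by norm_num
  have hv : ENNReal.ofReal |(-2 : ℝ)| • Measure.map (Homeomorph.mulLeft₀ (-2 : ℝ) h2) volume =
    volume := Real.smul_map_volume_mul_left h2
  conv_rhs => rw [← hv]
  rw [lintegral_smul_measure, (Homeomorph.mulLeft₀ (-2 : ℝ) h2).measurableEmbedding.lintegral_map]
  simp only [Homeomorph.coe_mulLeft₀, abs_neg, abs_two, ENNReal.ofReal_ofNat, smul_eq_mul]
  exact le_mul_of_one_le_left' one_le_two

/-- The constant of the weighted estimates before comparing weights on the left-hand side. -/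
def rpConst (R ε : ℝ) : ℝ :=
  20736 * (22 * (1 + 2 * massW ε) * R ^ 2 + 8 * (1 + 2 * massW ε) ^ 2 / (ε / (2 * (1 + ε))))

lemma ofNat_mul_ofReal {c : ℝ} : (20736 : ℝ≥0∞) * ENNReal.ofReal c = ENNReal.ofReal (20736 * c) := by
  rw [ENNReal.ofReal_mul (by norm_num)]
  simp

lemma rpConst_pos (hε : 0 < ε) (hR : 1 ≤ R) : 0 < rpConst R ε := by
  have hm := massW_nonneg (ε := ε)
  unfold rpConst
  positivity

lemma ofReal_le_rpConst (hε : 0 < ε) (hR : 1 ≤ R) :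
    14 * (1 + 2 * massW ε) * R ^ 2 * 20736 ≤ rpConst R ε ∧
    4 * (1 + 2 * massW ε) ≤ rpConst R ε ∧
    2 * (20736 * (4 * (1 + 2 * massW ε) ^ 2 / (ε / (2 * (1 + ε))))) ≤ rpConst R ε ∧
    20736 * (4 * (1 + 2 * massW ε) * R ^ 2) ≤ rpConst R ε ∧
    20736 * (4 * (1 + 2 * massW ε)) ≤ rpConst R ε := by
  have hm := massW_nonneg (ε := ε)
  have hR2 : 1 ≤ R ^ 2 := one_le_pow₀ hR
  have hG : 1 + 2 * massW ε ≤ (1 + 2 * massW ε) * R ^ 2 := le_mul_of_one_le_right (by linarith) hR2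
  have hK : 0 ≤ (1 + 2 * massW ε) ^ 2 / (ε / (2 * (1 + ε))) := by positivity
  simp only [rpConst, mul_div_assoc]
  refine ⟨?_, ?_, ?_, ?_, ?_⟩ <;> nlinarith

lemma interiorRhs_le (hA : ContDiff ℝ (⊤ : ℕ∞) A) (hφ : ContDiff ℝ (⊤ : ℕ∞) φ)
    (hv : vanishNullInf φ) (hε : 0 < ε) (hp : 0 ≤ p) (hp2 : p ≤ 2) (hR : 1 ≤ R) (hτ₁ : 0 ≤ τ₁)
    {P Q X : ℝ × ℝ → ℝ}
    (eP : P = sphAv (fluxP A φ (gW ε) (qW ε p))) (eQ : Q = sphAv (fluxQ A φ (gW ε) (qW ε p)))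
    (eX : X = sphAv (errD A φ ε p)) :
    interiorRhs P Q X R τ₁ τ₂ ≤ ENNReal.ofReal (rpConst R ε) *
      (lIntH ((τ₁ - R) / 2) ((τ₁ + R) / 2) (fun x => rad x ^ p * eDL A (psi φ) x)
        + wI (max (1 + ε) p) (min (1 + ε) p) (fun x => ‖boxA A φ x‖ ^ 2) (Dint R τ₁ τ₂)
        + EphiSig R A φ τ₁
        + (∫⁻ x in Dint R τ₁ τ₂, oR (|FJcontr (curv A) A φ Lbv x| + |FJcontr (curv A) A φ Lv x|))
        + ∫⁻ x in DbarInt R τ₁ τ₂, oR (rad x ^ p * |FJcontr (curv A) A φ Lv x|)) := by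
  have hm := massW_nonneg (ε := ε)
  subst eP eQ eX
  obtain ⟨k0, k1, k2, k3, k4⟩ := ofReal_le_rpConst hε hR
  have h0 := lintegral_flux_ball_le hA hφ hv hε hp hp2 hR hτ₁
  have h1 := lintegral_flux_cone_le (u := (τ₁ - R) / 2) (v₀ := (τ₁ + R) / 2) hA hφ hε hp hp2
    (by linarith)
  have h2 := (lintegral_errD_ball_le (R := R) (τ₂ := τ₂) hA hφ hε hp hp2 hτ₁).trans
    (mul_le_mul_right (setLIntegral_majE_le hA hφ hε _) _)
  have h3 := (lintegral_errD_cones_le (τ₂ := τ₂) hA hφ hε hp hp2 hR hτ₁).trans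
    (mul_le_mul_right (setLIntegral_majE_le hA hφ hε _) _)
  have h4 : wI (max (1 + ε) p) (min (1 + ε) p) (fun x => ‖boxA A φ x‖ ^ 2) (DbarInt R τ₁ τ₂) ≤
      wI (max (1 + ε) p) (min (1 + ε) p) (fun x => ‖boxA A φ x‖ ^ 2) (Dint R τ₁ τ₂) :=
    lintegral_mono_set inter_subset_left
  have h5 : ∫⁻ x in Dint R τ₁ τ₂, oR (R ^ 2 * |FJcontr (curv A) A φ Lv x|) ≤
      ENNReal.ofReal (R ^ 2) * ∫⁻ x in Dint R τ₁ τ₂,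
        oR (|FJcontr (curv A) A φ Lbv x| + |FJcontr (curv A) A φ Lv x|) := by
    rw [← lintegral_const_mul' _ _ ENNReal.ofReal_ne_top]
    refine lintegral_mono fun x => ?_
    rw [oR, oR, ← ENNReal.ofReal_mul (sq_nonneg R)]
    exact ENNReal.ofReal_le_ofReal
      (mul_le_mul_of_nonneg_left (le_add_of_nonneg_left (abs_nonneg _)) (sq_nonneg R))
  rw [interiorRhs]
  refine (add_le_add (add_le_add (add_le_add h0 (mul_le_mul_right h1 _)) (h2.trans
    (mul_le_mul_right (add_le_add_right (mul_le_mul_right h5 _) _) _))) (h3.trans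
    (mul_le_mul_right (add_le_add_left (mul_le_mul_right h4 _) _) _))).trans ?_
  generalize lIntH ((τ₁ - R) / 2) ((τ₁ + R) / 2) _ = a
  generalize wI _ _ _ _ = b
  generalize EphiSig R A φ τ₁ = c
  generalize lintegral (volume.restrict (Dint R τ₁ τ₂)) _ = d
  generalize lintegral (volume.restrict (DbarInt R τ₁ τ₂)) _ = e
  have hG : 0 ≤ 1 + 2 * massW ε := by linarith
  calc _ = ENNReal.ofReal (2 * (2 * (1 + 2 * massW ε))) * a
        + ENNReal.ofReal (2 * (20736 * (4 * (1 + 2 * massW ε) ^ 2 / (ε / (2 * (1 + ε)))))) * b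
        + ENNReal.ofReal (14 * (1 + 2 * massW ε) * R ^ 2 * 20736) * c
        + ENNReal.ofReal (20736 * (4 * (1 + 2 * massW ε) * R ^ 2)) * d
        + ENNReal.ofReal (20736 * (4 * (1 + 2 * massW ε))) * e := by
        have e2 : ∀ x : ℝ, ENNReal.ofReal (2 * x) = 2 * ENNReal.ofReal x := fun x => by
          rw [ENNReal.ofReal_mul zero_le_two, ENNReal.ofReal_ofNat]
        rw [e2 (2 * (1 + 2 * massW ε)), e2 (20736 * _), ← ofNat_mul_ofReal, ← ofNat_mul_ofReal,
          ← ofNat_mul_ofReal, ENNReal.ofReal_mul (p := 4 * (1 + 2 * massW ε)) (by positivity)]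
        ring
    _ ≤ ENNReal.ofReal (rpConst R ε) * a + ENNReal.ofReal (rpConst R ε) * b
        + ENNReal.ofReal (rpConst R ε) * c + ENNReal.ofReal (rpConst R ε) * d
        + ENNReal.ofReal (rpConst R ε) * e := by
        gcongr
        linarith
    _ = _ := by ring

end Estimates

section MainEstimates

variable {A : V → Fin 4 → ℝ} {φ : V → ℂ} {ε p R τ₁ τ₂ : ℝ}

lemma setLIntegral_le_const_mul {s : Set ℝ} (hs : MeasurableSet s) {f g : ℝ → ℝ≥0∞} {c : ℝ}
    (h : ∀ x ∈ s, f x ≤ ENNReal.ofReal c * g x) :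
    ∫⁻ x in s, f x ≤ ENNReal.ofReal c * ∫⁻ x in s, g x :=
  (setLIntegral_mono' hs h).trans_eq (lintegral_const_mul' _ _ ENNReal.ofReal_ne_top)

lemma ofReal_twelve_mul {c : ℝ} (x y : ℝ≥0∞) (h : x ≤ ENNReal.ofReal c * y) :
    12 * x ≤ ENNReal.ofReal (12 * c) * y := by
  rw [ENNReal.ofReal_mul (by norm_num), mul_assoc]
  simpa using mul_le_mul_right h 12

lemma interior_estimate (hA : ContDiff ℝ (⊤ : ℕ∞) A) (hφ : ContDiff ℝ (⊤ : ℕ∞) φ)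
    (hv : vanishNullInf φ) (hε : 0 < ε) (hp : 0 ≤ p) (hp2 : p ≤ 2) (hR : 1 ≤ R) (hτ₁ : 0 ≤ τ₁)
    (hτ : τ₁ ≤ τ₂) {v₀ : ℝ} (hv₀ : (τ₂ + R) / 2 ≤ v₀) :
    lIntH ((τ₂ - R) / 2) ((τ₂ + R) / 2) (fun x => rad x ^ p * eDL A (psi φ) x)
      + (∫⁻ τ in Icc τ₁ τ₂, lIntH ((τ - R) / 2) ((τ + R) / 2) (fun x =>
          rad x ^ (p - 1) * (p * eDL A (psi φ) x + (2 - p) * eDslash A (psi φ) x)))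
      + lIntHb v₀ ((τ₁ - R) / 2) ((τ₂ - R) / 2) (fun x => rad x ^ p * eDslash A (psi φ) x) ≤
    oR (12 * rpConst R ε) *
      (lIntH ((τ₁ - R) / 2) ((τ₁ + R) / 2) (fun x => rad x ^ p * eDL A (psi φ) x)
        + wI (max (1 + ε) p) (min (1 + ε) p) (fun x => ‖boxA A φ x‖ ^ 2) (Dint R τ₁ τ₂)
        + EphiSig R A φ τ₁
        + wI (1 + ε) 0 (fun x => ‖boxA A φ x‖ ^ 2) (Dint R τ₁ τ₂)
        + (∫⁻ x in Dint R τ₁ τ₂, oR (|FJcontr (curv A) A φ Lbv x| + |FJcontr (curv A) A φ Lv x|))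
        + ∫⁻ x in DbarInt R τ₁ τ₂, oR (rad x ^ p * |FJcontr (curv A) A φ Lv x|)) := by
  obtain ⟨h1, h2, h3⟩ := interior_flux_inequality (R := R) (τ₁ := τ₁) hA hφ hε hp hp2
    (by linarith) hτ hv₀ rfl rfl rfl rfl
  have h4 := interiorRhs_le (τ₂ := τ₂) hA hφ hv hε hp hp2 hR hτ₁ rfl rfl rfl
  have g1 := (setLIntegral_le_const_mul measurableSet_Ici fun v (hv : (τ₂ + R) / 2 ≤ v) =>
    sphI_eDL_le (u := (τ₂ - R) / 2) (v := v) hA hφ hε hp hp2 (by linarith)).trans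
    (mul_le_mul_right h1 _)
  have g2 := (setLIntegral_le_const_mul measurableSet_Icc
    fun u (hu : u ∈ Icc ((τ₁ - R) / 2) ((τ₂ - R) / 2)) =>
    sphI_eDslash_le (u := u) (v := v₀) hA hφ hε hp hp2 (by linarith [hu.2])).trans
    (mul_le_mul_right h2 _)
  have g3 := (setLIntegral_le_const_mul measurableSet_Icc fun t (_ : t ∈ Icc τ₁ τ₂) =>
    setLIntegral_le_const_mul measurableSet_Ici fun v (hv : (t + R) / 2 ≤ v) =>
    sphI_bulk_le (u := (t - R) / 2) (v := v) hA hφ hε hp hp2 (by linarith)).trans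
    (mul_le_mul_right h3 _)
  refine (add_le_add (add_le_add g1 g3) g2).trans ?_
  rw [← add_mul, ← add_mul]
  have e : ENNReal.ofReal 2 + ENNReal.ofReal 8 + ENNReal.ofReal 2 = 12 := by
    rw [← ENNReal.ofReal_add, ← ENNReal.ofReal_add] <;> norm_num
  rw [e]
  refine ofReal_twelve_mul _ _ (h4.trans (mul_le_mul_right ?_ _))
  exact add_le_add (add_le_add le_self_add le_rfl) le_rfl

lemma exterior_estimate (hA : ContDiff ℝ (⊤ : ℕ∞) A) (hφ : ContDiff ℝ (⊤ : ℕ∞) φ)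
    (hε : 0 < ε) (hp : 0 ≤ p) (hp2 : p ≤ 2) (hR : 1 ≤ R) (hτ : τ₂ ≤ τ₁) (hτ₁ : τ₁ ≤ 0) :
    lIntHseg ((τ₁ - R) / 2) (-((τ₁ - R) / 2)) (-((τ₂ - R) / 2))
        (fun x => rad x ^ p * eDL A (psi φ) x)
      + lIntExtUV R τ₁ τ₂ (fun x =>
          rad x ^ (p - 1) * (p * eDL A (psi φ) x + (2 - p) * eDslash A (psi φ) x))
      + lIntHb (-((τ₂ - R) / 2)) ((τ₂ - R) / 2) ((τ₁ - R) / 2)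
          (fun x => rad x ^ p * eDslash A (psi φ) x) ≤
    oR (12 * rpConst R ε) *
      ((∫⁻ r in Icc (R - τ₁) (R - τ₂),
          sphI (fun x => rad x ^ p * (eDL A (psi φ) x + eDslash A (psi φ) x)) 0 r)
        + wI (max p (1 + ε)) (min (1 + ε) p) (fun x => ‖boxA A φ x‖ ^ 2) (Dext R τ₁ τ₂)
        + ∫⁻ x in Dext R τ₁ τ₂, oR (rad x ^ p * |FJcontr (curv A) A φ Lv x|)) := by
  have hm := massW_nonneg (ε := ε)
  have hu : (τ₂ - R) / 2 ≤ (τ₁ - R) / 2 := by linarith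
  have hle := exterior_flux_inequality hA hφ hε hp hp2 hu (by linarith) rfl rfl rfl rfl
  have h1 := lintegral_flux_annulus_le (τ₂ := τ₂) hA hφ hε hp hp2 hR hτ₁
  have h2 := (lintegral_errD_ext_le (R := R) (τ₂ := τ₂) hA hφ hε hp hp2 hR hτ₁).trans
    (mul_le_mul_right (setLIntegral_majE_le hA hφ hε _) _)
  obtain ⟨-, k1, k2, -, k4⟩ := ofReal_le_rpConst hε hR
  have g1 := setLIntegral_le_const_mul measurableSet_Icc
    fun v (hv : v ∈ Icc (-((τ₁ - R) / 2)) (-((τ₂ - R) / 2))) =>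
    sphI_eDL_le (u := (τ₁ - R) / 2) (v := v) hA hφ hε hp hp2 (by linarith [hv.1])
  have g2 := setLIntegral_le_const_mul measurableSet_Icc
    fun u (hu : u ∈ Icc ((τ₂ - R) / 2) ((τ₁ - R) / 2)) =>
    sphI_eDslash_le (u := u) (v := -((τ₂ - R) / 2)) hA hφ hε hp hp2 (by linarith [hu.2])
  have g3 := setLIntegral_le_const_mul measurableSet_Icc
    fun u (hu : u ∈ Icc ((τ₂ - R) / 2) ((τ₁ - R) / 2)) =>
    setLIntegral_le_const_mul measurableSet_Icc fun v (hv : v ∈ Icc (-u) (-((τ₂ - R) / 2))) =>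
    sphI_bulk_le (u := u) (v := v) hA hφ hε hp hp2 (by linarith [hv.1, hu.2])
  rw [max_comm p]
  have c1 : ENNReal.ofReal 2 ≤ 12 := by
    rw [← ENNReal.ofReal_ofNat 12]; exact ENNReal.ofReal_le_ofReal (by norm_num)
  have c2 : ENNReal.ofReal 8 ≤ 12 := by
    rw [← ENNReal.ofReal_ofNat 12]; exact ENNReal.ofReal_le_ofReal (by norm_num)
  refine (add_le_add (add_le_add (g1.trans (mul_le_mul_left c1 _))
    (g3.trans (mul_le_mul_left c2 _))) (g2.trans (mul_le_mul_left c1 _))).trans ?_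
  rw [← mul_add, ← mul_add, add_right_comm]
  refine ofReal_twelve_mul _ _ (hle.trans ((add_le_add h1 h2).trans ?_))
  rw [mul_add (20736 : ℝ≥0∞), ← mul_assoc (20736 : ℝ≥0∞), ← mul_assoc (20736 : ℝ≥0∞),
    ofNat_mul_ofReal, ofNat_mul_ofReal, ← add_assoc,
    mul_add (ENNReal.ofReal (rpConst R ε)), mul_add (ENNReal.ofReal (rpConst R ε))]
  have k2' : 20736 * (4 * (1 + 2 * massW ε) ^ 2 / (ε / (2 * (1 + ε)))) ≤ rpConst R ε :=
    (le_mul_of_one_le_left (by positivity) one_le_two).trans k2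
  exact add_le_add (add_le_add (mul_le_mul_left (ENNReal.ofReal_le_ofReal k1) _)
    (mul_le_mul_left (ENNReal.ofReal_le_ofReal k2') _))
    (mul_le_mul_left (ENNReal.ofReal_le_ofReal k4) _)

end MainEstimates

end MKG

open MKG in
/-- **r-weighted energy estimates for the scalar field, ψ = rφ.** -/
theorem statement6 (R γ₀ ε : ℝ) (hR : 1 < R) (hγ₀ : 0 < γ₀) (hγ₀' : γ₀ < 1) (hε : 0 < ε) :
    ∀ pw : ℝ, 0 ≤ pw → pw ≤ 2 →
    ∃ C : ℝ, 0 < C ∧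
      ∀ (A : V → Fin 4 → ℝ) (φ : V → ℂ), ContDiff ℝ (⊤ : ℕ∞) A → ContDiff ℝ (⊤ : ℕ∞) φ →
        vanishNullInf φ →
        ((∀ τ₁ τ₂ v₀ : ℝ, 0 ≤ τ₁ → τ₁ ≤ τ₂ → (τ₂ + R) / 2 ≤ v₀ →
            lIntH ((τ₂ - R) / 2) ((τ₂ + R) / 2) (fun p => rad p ^ pw * eDL A (psi φ) p)
              + (∫⁻ τ in Set.Icc τ₁ τ₂,
                  lIntH ((τ - R) / 2) ((τ + R) / 2) (fun p =>
                    rad p ^ (pw - 1) *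
                      (pw * eDL A (psi φ) p + (2 - pw) * eDslash A (psi φ) p)))
              + lIntHb v₀ ((τ₁ - R) / 2) ((τ₂ - R) / 2)
                  (fun p => rad p ^ pw * eDslash A (psi φ) p)
            ≤ oR C *
              (lIntH ((τ₁ - R) / 2) ((τ₁ + R) / 2) (fun p => rad p ^ pw * eDL A (psi φ) p)
                + wI (max (1 + ε) pw) (min (1 + ε) pw)
                    (fun p => ‖boxA A φ p‖ ^ 2) (Dint R τ₁ τ₂)
                + EphiSig R A φ τ₁
                + wI (1 + ε) 0 (fun p => ‖boxA A φ p‖ ^ 2) (Dint R τ₁ τ₂)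
                + (∫⁻ p in Dint R τ₁ τ₂,
                    oR (|FJcontr (curv A) A φ Lbv p| + |FJcontr (curv A) A φ Lv p|))
                + ∫⁻ p in DbarInt R τ₁ τ₂,
                    oR (rad p ^ pw * |FJcontr (curv A) A φ Lv p|)))
          ∧ (∀ τ₁ τ₂ : ℝ, τ₂ ≤ τ₁ → τ₁ ≤ 0 →
            lIntHseg ((τ₁ - R) / 2) (-((τ₁ - R) / 2)) (-((τ₂ - R) / 2))
                (fun p => rad p ^ pw * eDL A (psi φ) p)
              + lIntExtUV R τ₁ τ₂ (fun p =>
                  rad p ^ (pw - 1) *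
                    (pw * eDL A (psi φ) p + (2 - pw) * eDslash A (psi φ) p))
              + lIntHb (-((τ₂ - R) / 2)) ((τ₂ - R) / 2) ((τ₁ - R) / 2)
                  (fun p => rad p ^ pw * eDslash A (psi φ) p)
            ≤ oR C *
              ((∫⁻ r' in Set.Icc (R - τ₁) (R - τ₂),
                  sphI (fun p => rad p ^ pw * (eDL A (psi φ) p + eDslash A (psi φ) p)) 0 r')
                + wI (max pw (1 + ε)) (min (1 + ε) pw)
                    (fun p => ‖boxA A φ p‖ ^ 2) (Dext R τ₁ τ₂)
                + ∫⁻ p in Dext R τ₁ τ₂,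
                    oR (rad p ^ pw * |FJcontr (curv A) A φ Lv p|)))) := by
  intro pw hp hp2
  exact ⟨12 * rpConst R ε, mul_pos (by norm_num) (rpConst_pos hε hR.le), fun A φ hA hφ hv =>
    ⟨fun τ₁ τ₂ v₀ hτ₁ hτ hv₀ => interior_estimate hA hφ hv hε hp hp2 hR.le hτ₁ hτ hv₀,
      fun τ₁ τ₂ hτ hτ₁ => exterior_estimate hA hφ hε hp hp2 hR.le hτ hτ₁⟩⟩
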